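/- arXiv:2211.06359 — 9 statements merged into one kernel-verified Lean document; each statement's English description precedes it below -/
import Mathlib

section
/- Let d ≥ 1, R > 0, σ ∈ (0,1), and let 𝔏 = -Δ + R on ℝ^d, with heat kernel h_t(x,y) = e^{-tR} (4πt)^{-d/2} e^{-|x-y|²/(4t)} and e^{-t𝔏}f(x) := ∫_{ℝ^d} h_t(x,y) f(y) dy. Suppose f : ℝ^d → ℝ is measurable with ∫_{ℝ^d} |f(y)| · e^{-√(R(1+|y|²))} (1+|y|)^{-((d+1)/2+σ)} dy < ∞, and f is 2σ-smooth at a point x₀ ∈ ℝ^d. Then ∫₀^∞ | e^{-t𝔏}f(x₀) − f(x₀) | t^{-(1+σ)} dt < ∞, so the integral (−Δ+R)^σ f(x₀) = (1/Γ(-σ)) ∫₀^∞ ( e^{-t𝔏}f(x₀) − f(x₀) ) t^{-(1+σ)} dt, with Γ(-σ) := Γ(1-σ)/(-σ), converges absolutely. -/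
open MeasureTheory Set Filter
open RealInnerProductSpace

/-- `f` is `α`-smooth at `x₀` (`f ∈ D^α(x₀)`). -/
def DalphaAt (d : ℕ) (α : ℝ) (f : EuclideanSpace ℝ (Fin d) → ℝ)
    (x₀ : EuclideanSpace ℝ (Fin d)) : Prop :=
  ∃ δ > (0 : ℝ), MeasureTheory.IntegrableOn
    (fun h => |f (x₀ + h) + f (x₀ - h) - 2 * f x₀| / ‖h‖ ^ ((d : ℝ) + α))
    {h : EuclideanSpace ℝ (Fin d) | ‖h‖ ≤ δ}

/-- `f` is strictly `α`-smooth at `x₀` (`f ∈ D^α_st(x₀)`). -/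
def DalphaStAt (d : ℕ) (α : ℝ) (f : EuclideanSpace ℝ (Fin d) → ℝ)
    (x₀ : EuclideanSpace ℝ (Fin d)) : Prop :=
  DalphaAt d α f x₀ ∧
  ∃ δ > (0 : ℝ), MeasureTheory.IntegrableOn
    (fun h => |f (x₀ + h) - f (x₀ - h)| / ‖h‖ ^ max ((d : ℝ) + α - 3) 0)
    {h : EuclideanSpace ℝ (Fin d) | ‖h‖ ≤ δ}

/-- The heat kernel of `𝔏 = -Δ + R` on `ℝ^d`. -/
noncomputable def heatR (d : ℕ) (R t : ℝ) (x y : EuclideanSpace ℝ (Fin d)) : ℝ :=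
  Real.exp (-t * R) * (4 * Real.pi * t) ^ (-(d : ℝ) / 2) *
    Real.exp (-‖x - y‖ ^ 2 / (4 * t))

lemma Real.rpow_le_rpow_mul_exp {a u : ℝ} (ha : 0 < a) (hu : 0 ≤ u) :
    u ^ a ≤ a ^ a * Real.exp u := by
  have h1 : u ≤ a * Real.exp (u / a) := by
    have h := Real.add_one_le_exp (u / a)
    calc u = a * (u / a) := by field_simp
      _ ≤ a * Real.exp (u / a) := by gcongr; linarith
  calc u ^ a ≤ (a * Real.exp (u / a)) ^ a := Real.rpow_le_rpow hu h1 ha.le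
    _ = a ^ a * Real.exp u := by
      rw [Real.mul_rpow ha.le (Real.exp_pos _).le, ← Real.exp_mul]
      congr 2; field_simp

/-- Completing the square in the exponent of the heat kernel. -/
lemma sq_sqrt_mul_sub_div {s r t : ℝ} (ht : 0 < t) :
    (s * √t - r / (2 * √t)) ^ 2 = s ^ 2 * t + r ^ 2 / (4 * t) - s * r := by
  have h := Real.sq_sqrt ht.le
  have h' : √t ≠ 0 := (Real.sqrt_pos.2 ht).ne'
  have e : r ^ 2 / (4 * t) = (r / (2 * √t)) ^ 2 := by rw [div_pow, mul_pow, h]; norm_num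
  rw [e]
  nth_rewrite 3 [← h]
  field_simp
  ring

lemma rpow_neg_mul_exp_le {a s r t κ : ℝ} (ha : 0 < a) (ht : 0 < t) (hκ : 0 < κ)
    (hκr : κ ≤ r) :
    t ^ (-a) * Real.exp (-(s ^ 2 * t + r ^ 2 / (4 * t))) ≤
      (8 * a / κ) ^ a * Real.exp (κ * s / 2) * Real.exp (-(s * r)) * r ^ (-a) *
        Real.exp (-(s * √t - r / (2 * √t)) ^ 2 / 2) := by
  have hr : 0 < r := hκ.trans_le hκr
  set w := s * √t - r / (2 * √t)
  have hw : s ^ 2 * t + r ^ 2 / (4 * t) = s * r + w ^ 2 := by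
    rw [sq_sqrt_mul_sub_div ht]; ring
  have hw0 : κ * r / (4 * t) - κ * s ≤ w ^ 2 := by
    have h1 : κ / r * w ^ 2 ≤ w ^ 2 :=
      mul_le_of_le_one_left (sq_nonneg _) ((div_le_one hr).2 hκr)
    have h2 : κ / r * w ^ 2 = κ / r * (s ^ 2 * t) + (κ * r / (4 * t) - κ * s) := by
      rw [sq_sqrt_mul_sub_div ht]; field_simp; ring
    have h3 : 0 ≤ κ / r * (s ^ 2 * t) := by positivity
    linarith
  have hu := Real.rpow_le_rpow_mul_exp (u := κ * r / (8 * t)) ha (by positivity)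
  have hexp : Real.exp (κ * r / (8 * t)) ≤ Real.exp (κ * s / 2) * Real.exp (w ^ 2 / 2) := by
    rw [← Real.exp_add]
    apply Real.exp_le_exp.2
    have : κ * r / (8 * t) = κ * r / (4 * t) / 2 := by field_simp; norm_num
    rw [this]; linarith
  have hta : t ^ (-a) = (κ * r / (8 * t)) ^ a * ((8 / κ) ^ a * r ^ (-a)) := by
    rw [Real.rpow_neg ht.le, Real.rpow_neg hr.le, ← Real.inv_rpow ht.le, ← Real.inv_rpow hr.le,
      ← Real.mul_rpow (by positivity) (by positivity),
      ← Real.mul_rpow (by positivity) (by positivity)]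
    congr 1; field_simp
  have h8 : (8 * a / κ) ^ a = a ^ a * (8 / κ) ^ a := by
    rw [← Real.mul_rpow (by positivity) (by positivity)]; congr 1; ring
  calc t ^ (-a) * Real.exp (-(s ^ 2 * t + r ^ 2 / (4 * t)))
      ≤ a ^ a * (Real.exp (κ * s / 2) * Real.exp (w ^ 2 / 2)) * ((8 / κ) ^ a * r ^ (-a)) *
        Real.exp (-(s ^ 2 * t + r ^ 2 / (4 * t))) := by
        rw [hta]; gcongr; exact hu.trans (by gcongr)
    _ = _ := by
        have : Real.exp (-(s ^ 2 * t + r ^ 2 / (4 * t))) =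
            Real.exp (-(s * r)) * Real.exp (-w ^ 2 / 2) * (Real.exp (w ^ 2 / 2))⁻¹ := by
          rw [← Real.exp_neg, ← Real.exp_add, ← Real.exp_add, hw]; congr 1; ring
        rw [this, h8]
        have := Real.exp_ne_zero (w ^ 2 / 2)
        field_simp

lemma lintegral_rpow_mul_exp_le {s r : ℝ} (hs : 0 ≤ s) (hr : 0 < r) :
    ∫⁻ t in Ioi (0 : ℝ), ENNReal.ofReal
        (t ^ (-(3 / 2) : ℝ) * Real.exp (-(s * √t - r / (2 * √t)) ^ 2 / 2)) ≤
      ENNReal.ofReal (4 * √(2 * Real.pi) / r) := by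
  set φ : ℝ → ℝ := fun t => s * √t - r / (2 * √t) with hφ
  set φ' : ℝ → ℝ := fun t => s * (1 / (2 * √t)) + r / 4 * t ^ (-(3 / 2) : ℝ) with hφ'
  have hpow : ∀ t : ℝ, 0 < t → t ^ (-(3 / 2) : ℝ) = (t * √t)⁻¹ := by
    intro t ht
    rw [Real.rpow_neg ht.le, show (3 / 2 : ℝ) = 1 + 1 / 2 by norm_num, Real.rpow_add ht,
      Real.rpow_one, Real.sqrt_eq_rpow]
  have hder : ∀ t ∈ Ioi (0 : ℝ), HasDerivWithinAt φ (φ' t) (Ioi 0) t := by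
    intro t ht
    have ht : 0 < t := ht
    have h := Real.hasDerivAt_sqrt ht.ne'
    have h' : √t ≠ 0 := (Real.sqrt_pos.2 ht).ne'
    have h2 := (h.const_mul s).sub ((hasDerivAt_const t r).div (h.const_mul 2) (by positivity))
    refine (h2.congr_deriv ?_).hasDerivWithinAt
    simp only [hφ', hpow t ht]
    rw [mul_pow, Real.sq_sqrt ht.le]
    field_simp
    ring
  have hinj : InjOn φ (Ioi 0) := by
    apply StrictMonoOn.injOn
    intro x hx y hy hxy
    have hx : 0 < x := hx
    have h1 : √x < √y := Real.sqrt_lt_sqrt hx.le hxy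
    have h0 : 0 < √x := Real.sqrt_pos.2 hx
    have h2 : r / (2 * √y) < r / (2 * √x) := by gcongr
    have h3 : s * √x ≤ s * √y := by gcongr
    simp only [hφ]; linarith
  have key := lintegral_image_eq_lintegral_abs_deriv_mul measurableSet_Ioi hder hinj
    (fun w => ENNReal.ofReal (Real.exp (-(1 / 2) * w ^ 2)))
  have hg : ∫⁻ w, ENNReal.ofReal (Real.exp (-(1 / 2) * w ^ 2)) =
      ENNReal.ofReal √(2 * Real.pi) := by
    rw [← ofReal_integral_eq_lintegral_ofReal (integrable_exp_neg_mul_sq (by norm_num))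
      (ae_of_all _ fun _ => (Real.exp_pos _).le), integral_gaussian]
    congr 2; ring
  calc _ ≤ ∫⁻ t in Ioi (0 : ℝ), ENNReal.ofReal (4 / r) *
        (ENNReal.ofReal |φ' t| * ENNReal.ofReal (Real.exp (-(1 / 2) * φ t ^ 2))) := by
        refine setLIntegral_mono' measurableSet_Ioi fun t ht => ?_
        have ht : 0 < t := ht
        rw [← ENNReal.ofReal_mul (abs_nonneg _), ← ENNReal.ofReal_mul (by positivity)]
        apply ENNReal.ofReal_le_ofReal
        have e : -(s * √t - r / (2 * √t)) ^ 2 / 2 = -(1 / 2) * φ t ^ 2 := by simp only [hφ]; ring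
        rw [e, ← mul_assoc]
        gcongr
        have : r / 4 * t ^ (-(3 / 2) : ℝ) ≤ |φ' t| := by
          refine le_trans ?_ (le_abs_self _)
          simp only [hφ']
          have : 0 ≤ s * (1 / (2 * √t)) := by positivity
          linarith
        calc t ^ (-(3 / 2) : ℝ) = 4 / r * (r / 4 * t ^ (-(3 / 2) : ℝ)) := by field_simp
          _ ≤ _ := by gcongr
    _ = ENNReal.ofReal (4 / r) * ∫⁻ w in φ '' Ioi 0,
          ENNReal.ofReal (Real.exp (-(1 / 2) * w ^ 2)) := by
        rw [lintegral_const_mul' _ _ ENNReal.ofReal_ne_top, key]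
    _ ≤ ENNReal.ofReal (4 / r) * ENNReal.ofReal √(2 * Real.pi) := by
        rw [← hg]; gcongr; exact Measure.restrict_le_self
    _ = _ := by rw [← ENNReal.ofReal_mul (by positivity)]; congr 1; ring

lemma lintegral_rpow_mul_exp_neg_le {a s r κ : ℝ} (ha : 0 < a) (hs : 0 ≤ s) (hκ : 0 < κ)
    (hκr : κ ≤ r) :
    ∫⁻ t in Ioi (0 : ℝ), ENNReal.ofReal
        (t ^ (-(a + 3 / 2)) * Real.exp (-(s ^ 2 * t + r ^ 2 / (4 * t)))) ≤
      ENNReal.ofReal (4 * √(2 * Real.pi) * (8 * a / κ) ^ a * Real.exp (κ * s / 2) *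
        (Real.exp (-(s * r)) * r ^ (-(a + 1)))) := by
  have hr : 0 < r := hκ.trans_le hκr
  set B := (8 * a / κ) ^ a * Real.exp (κ * s / 2) * Real.exp (-(s * r)) * r ^ (-a) with hB
  have hB0 : 0 ≤ B := by positivity
  calc _ ≤ ∫⁻ t in Ioi (0 : ℝ), ENNReal.ofReal B * ENNReal.ofReal
        (t ^ (-(3 / 2) : ℝ) * Real.exp (-(s * √t - r / (2 * √t)) ^ 2 / 2)) := by
        refine setLIntegral_mono' measurableSet_Ioi fun t ht => ?_
        have ht : 0 < t := ht
        rw [← ENNReal.ofReal_mul hB0]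
        apply ENNReal.ofReal_le_ofReal
        have h := rpow_neg_mul_exp_le (s := s) ha ht hκ hκr
        rw [show -(a + 3 / 2) = -(3 / 2) + -a by ring, Real.rpow_add ht]
        calc _ = t ^ (-(3 / 2) : ℝ) *
              (t ^ (-a) * Real.exp (-(s ^ 2 * t + r ^ 2 / (4 * t)))) := by ring
          _ ≤ t ^ (-(3 / 2) : ℝ) * (B * Real.exp (-(s * √t - r / (2 * √t)) ^ 2 / 2)) := by
              gcongr
          _ = _ := by ring
    _ ≤ ENNReal.ofReal B * ENNReal.ofReal (4 * √(2 * Real.pi) / r) := by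
        rw [lintegral_const_mul' _ _ ENNReal.ofReal_ne_top]
        gcongr
        exact lintegral_rpow_mul_exp_le hs hr
    _ = _ := by
        rw [← ENNReal.ofReal_mul hB0, hB, show -(a + 1) = -a + -1 by ring, Real.rpow_add hr,
          Real.rpow_neg_one]
        congr 1
        field_simp

/-- The heat kernel of `-Δ + R` on `ℝ^d` as a function of the distance `r`. -/
noncomputable def heatProfile (d : ℕ) (R t r : ℝ) : ℝ :=
  Real.exp (-t * R) * (4 * Real.pi * t) ^ (-(d : ℝ) / 2) * Real.exp (-r ^ 2 / (4 * t))

lemma heatProfile_nonneg (d : ℕ) (R r : ℝ) {t : ℝ} (ht : 0 ≤ t) : 0 ≤ heatProfile d R t r := by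
  have := Real.pi_pos
  unfold heatProfile
  positivity

lemma heatProfile_mul_rpow (d : ℕ) (R r σ : ℝ) {t : ℝ} (ht : 0 < t) :
    heatProfile d R t r * t ^ (-(1 + σ)) = (4 * Real.pi) ^ (-(d : ℝ) / 2) *
      (t ^ (-((d : ℝ) / 2 + σ - 1 / 2 + 3 / 2)) * Real.exp (-(R * t + r ^ 2 / (4 * t)))) := by
  have := Real.pi_pos
  rw [heatProfile, Real.mul_rpow (by positivity) ht.le,
    show -((d : ℝ) / 2 + σ - 1 / 2 + 3 / 2) = -(d : ℝ) / 2 + -(1 + σ) by ring, Real.rpow_add ht,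
    show -(R * t + r ^ 2 / (4 * t)) = -t * R + -r ^ 2 / (4 * t) by ring, Real.exp_add]
  ring

lemma exists_lintegral_heatProfile_le_rpow {d : ℕ} (hd : 1 ≤ d) {R σ : ℝ} (hR : 0 ≤ R)
    (hσ : 0 < σ) :
    ∃ C : ℝ, 0 ≤ C ∧ ∀ r : ℝ, 0 < r →
      ∫⁻ t in Ioi (0 : ℝ), ENNReal.ofReal (heatProfile d R t r * t ^ (-(1 + σ))) ≤
        ENNReal.ofReal (C * r ^ (-((d : ℝ) + 2 * σ))) := by
  have hd' : (1 : ℝ) ≤ d := by exact_mod_cast hd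
  set a := (d : ℝ) / 2 + σ - 1 / 2 with ha_def
  have ha : 0 < a := by linarith
  have hpi := Real.pi_pos
  set c := (4 * Real.pi) ^ (-(d : ℝ) / 2)
  have hc : 0 ≤ c := by positivity
  refine ⟨c * (4 * √(2 * Real.pi) * (8 * a) ^ a), by positivity, fun r hr => ?_⟩
  calc _ ≤ ∫⁻ t in Ioi (0 : ℝ), ENNReal.ofReal c * ENNReal.ofReal
        (t ^ (-(a + 3 / 2)) * Real.exp (-((0 : ℝ) ^ 2 * t + r ^ 2 / (4 * t)))) := by
        refine setLIntegral_mono' measurableSet_Ioi fun t ht => ?_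
        have ht : 0 < t := ht
        rw [← ENNReal.ofReal_mul hc, heatProfile_mul_rpow d R r σ ht]
        gcongr
        have : 0 ≤ R * t := by positivity
        linarith
    _ ≤ ENNReal.ofReal c * ENNReal.ofReal (4 * √(2 * Real.pi) * (8 * a / r) ^ a *
        Real.exp (r * 0 / 2) * (Real.exp (-(0 * r)) * r ^ (-(a + 1)))) := by
        rw [lintegral_const_mul' _ _ ENNReal.ofReal_ne_top]
        gcongr
        exact lintegral_rpow_mul_exp_neg_le ha le_rfl hr le_rfl
    _ = _ := by
        rw [← ENNReal.ofReal_mul hc, Real.div_rpow (by positivity) hr.le,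
          show -((d : ℝ) + 2 * σ) = -a + -(a + 1) by rw [ha_def]; ring, Real.rpow_add hr,
          Real.rpow_neg hr.le a]
        simp only [mul_zero, zero_div, zero_mul, neg_zero, Real.exp_zero]
        congr 1
        ring

lemma exists_lintegral_heatProfile_le_exp {d : ℕ} (hd : 1 ≤ d) {R σ δ : ℝ} (hR : 0 ≤ R)
    (hσ : 0 < σ) (hδ : 0 < δ) :
    ∃ C : ℝ, 0 ≤ C ∧ ∀ r : ℝ, δ ≤ r →
      ∫⁻ t in Ioi (0 : ℝ), ENNReal.ofReal (heatProfile d R t r * t ^ (-(1 + σ))) ≤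
        ENNReal.ofReal (C * (Real.exp (-(√R * r)) * r ^ (-(((d : ℝ) + 1) / 2 + σ)))) := by
  have hd' : (1 : ℝ) ≤ d := by exact_mod_cast hd
  set a := (d : ℝ) / 2 + σ - 1 / 2 with ha_def
  have ha : 0 < a := by linarith
  have hpi := Real.pi_pos
  set c := (4 * Real.pi) ^ (-(d : ℝ) / 2)
  have hc : 0 ≤ c := by positivity
  refine ⟨c * (4 * √(2 * Real.pi) * (8 * a / δ) ^ a * Real.exp (δ * √R / 2)), by positivity,
    fun r hr => ?_⟩
  calc _ = ∫⁻ t in Ioi (0 : ℝ), ENNReal.ofReal c * ENNReal.ofReal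
        (t ^ (-(a + 3 / 2)) * Real.exp (-(√R ^ 2 * t + r ^ 2 / (4 * t)))) := by
        refine setLIntegral_congr_fun measurableSet_Ioi fun t ht => ?_
        rw [← ENNReal.ofReal_mul hc, heatProfile_mul_rpow d R r σ ht, Real.sq_sqrt hR]
    _ ≤ ENNReal.ofReal c * ENNReal.ofReal (4 * √(2 * Real.pi) * (8 * a / δ) ^ a *
        Real.exp (δ * √R / 2) * (Real.exp (-(√R * r)) * r ^ (-(a + 1)))) := by
        rw [lintegral_const_mul' _ _ ENNReal.ofReal_ne_top]
        gcongr
        exact lintegral_rpow_mul_exp_neg_le ha (Real.sqrt_nonneg R) hδ hr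
    _ = _ := by
        rw [← ENNReal.ofReal_mul hc,
          show -(((d : ℝ) + 1) / 2 + σ) = -(a + 1) by rw [ha_def]; ring]
        congr 1
        ring

lemma heatProfile_le_exp_mul_rpow (d : ℕ) {R p t r : ℝ} (hp : 1 ≤ p) (ht : 0 < t) (hr : 0 ≤ r) :
    heatProfile d R t r ≤ Real.exp (-t * R) * (4 * Real.pi * t) ^ (-(d : ℝ) / 2) *
      (Real.exp ((√R + 1) ^ 2 * t + 1) * p ^ p) *
        (Real.exp (-(√R * r)) * (1 + r) ^ (-p)) := by
  have hpi := Real.pi_pos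
  have h1 : -r ^ 2 / (4 * t) ≤ (√R + 1) ^ 2 * t - (√R + 1) * r := by
    have h := sq_nonneg ((√R + 1) * √t - r / (2 * √t))
    rw [sq_sqrt_mul_sub_div ht] at h
    have : -r ^ 2 / (4 * t) = -(r ^ 2 / (4 * t)) := by ring
    linarith
  have h2 := Real.rpow_le_rpow_mul_exp (a := p) (u := 1 + r) (by linarith) (by linarith)
  have hpos : 0 < (1 + r) ^ p := by positivity
  have h3 : 1 ≤ p ^ p * Real.exp (1 + r) * (1 + r) ^ (-p) := by
    rw [Real.rpow_neg (by linarith), ← div_eq_mul_inv, one_le_div hpos]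
    exact h2
  rw [heatProfile, mul_assoc _ (Real.exp ((√R + 1) ^ 2 * t + 1) * p ^ p)]
  gcongr
  calc Real.exp (-r ^ 2 / (4 * t))
      ≤ Real.exp ((√R + 1) ^ 2 * t - (√R + 1) * r) := Real.exp_le_exp.2 h1
    _ ≤ Real.exp ((√R + 1) ^ 2 * t - (√R + 1) * r) *
        (p ^ p * Real.exp (1 + r) * (1 + r) ^ (-p)) :=
        le_mul_of_one_le_right (Real.exp_pos _).le h3
    _ = _ := by
        have : Real.exp ((√R + 1) ^ 2 * t + 1) * Real.exp (-(√R * r)) =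
            Real.exp ((√R + 1) ^ 2 * t - (√R + 1) * r) * Real.exp (1 + r) := by
          rw [← Real.exp_add, ← Real.exp_add]; congr 1; ring
        linear_combination (-(p ^ p * (1 + r) ^ (-p))) * this

/-- The weight of `-Δ + R` does not change its size under translation. -/
lemma exp_mul_rpow_le_weight {d : ℕ} {R p : ℝ} (hR : 0 ≤ R) (hp : 0 ≤ p)
    (x h : EuclideanSpace ℝ (Fin d)) :
    Real.exp (-(√R * ‖h‖)) * (1 + ‖h‖) ^ (-p) ≤
      Real.exp (√R * (1 + ‖x‖)) * (1 + ‖x‖) ^ p *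
        (Real.exp (-√(R * (1 + ‖x + h‖ ^ 2))) / (1 + ‖x + h‖) ^ p) := by
  have hx := norm_nonneg x
  have hh := norm_nonneg h
  have hxh := norm_nonneg (x + h)
  have htri : ‖x + h‖ ≤ ‖x‖ + ‖h‖ := norm_add_le x h
  have h1 : √(R * (1 + ‖x + h‖ ^ 2)) ≤ √R * (1 + ‖x‖ + ‖h‖) := by
    rw [Real.sqrt_mul hR]
    gcongr
    apply Real.sqrt_le_iff.2
    constructor <;> nlinarith
  have h2 : (1 + ‖x + h‖) ^ p ≤ (1 + ‖x‖) ^ p * (1 + ‖h‖) ^ p := by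
    rw [← Real.mul_rpow (by linarith) (by linarith)]
    gcongr
    nlinarith
  have h3 : Real.exp (-(√R * ‖h‖)) ≤
      Real.exp (√R * (1 + ‖x‖)) * Real.exp (-√(R * (1 + ‖x + h‖ ^ 2))) := by
    rw [← Real.exp_add]
    apply Real.exp_le_exp.2
    linarith
  have hpos : 0 < (1 + ‖h‖) ^ p := by positivity
  have hpos' : 0 < (1 + ‖x + h‖) ^ p := by positivity
  have h4 : (1 + ‖h‖) ^ (-p) ≤ (1 + ‖x‖) ^ p * ((1 + ‖x + h‖) ^ p)⁻¹ := by
    rw [Real.rpow_neg (by linarith), ← div_eq_mul_inv, le_div_iff₀ hpos', inv_mul_le_iff₀ hpos]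
    linarith
  calc _ ≤ (Real.exp (√R * (1 + ‖x‖)) * Real.exp (-√(R * (1 + ‖x + h‖ ^ 2)))) *
        ((1 + ‖x‖) ^ p * ((1 + ‖x + h‖) ^ p)⁻¹) := by gcongr
    _ = _ := by ring

lemma integrable_abs_mul_exp_mul_rpow {d : ℕ} {R p : ℝ} (hR : 0 ≤ R) (hp : 0 ≤ p)
    {f : EuclideanSpace ℝ (Fin d) → ℝ} (hf : Measurable f)
    (hfint : Integrable
      (fun y => |f y| * (Real.exp (-√(R * (1 + ‖y‖ ^ 2))) / (1 + ‖y‖) ^ p)))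
    (x : EuclideanSpace ℝ (Fin d)) :
    Integrable (fun h => |f (x + h)| * (Real.exp (-(√R * ‖h‖)) * (1 + ‖h‖) ^ (-p))) := by
  refine ((hfint.comp_add_left x).const_mul
    (Real.exp (√R * (1 + ‖x‖)) * (1 + ‖x‖) ^ p)).mono' (by fun_prop) (ae_of_all _ fun h => ?_)
  rw [Real.norm_of_nonneg (by positivity)]
  calc _ ≤ |f (x + h)| * (Real.exp (√R * (1 + ‖x‖)) * (1 + ‖x‖) ^ p *
        (Real.exp (-√(R * (1 + ‖x + h‖ ^ 2))) / (1 + ‖x + h‖) ^ p)) := by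
        exact mul_le_mul_of_nonneg_left (exp_mul_rpow_le_weight hR hp x h) (abs_nonneg _)
    _ = _ := by ring

@[fun_prop]
lemma measurable_heatProfile (d : ℕ) (R : ℝ) :
    Measurable fun q : ℝ × ℝ => heatProfile d R q.1 q.2 := by
  unfold heatProfile
  fun_prop

lemma integrable_heatProfile_mul {d : ℕ} {R p t : ℝ} (hR : 0 ≤ R) (hp : 1 ≤ p) (ht : 0 < t)
    {f : EuclideanSpace ℝ (Fin d) → ℝ} (hf : Measurable f)
    (hfint : Integrable
      (fun y => |f y| * (Real.exp (-√(R * (1 + ‖y‖ ^ 2))) / (1 + ‖y‖) ^ p)))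
    (x : EuclideanSpace ℝ (Fin d)) :
    Integrable (fun h => heatProfile d R t ‖h‖ * f (x + h)) := by
  have hm : Measurable fun h : EuclideanSpace ℝ (Fin d) => heatProfile d R t ‖h‖ :=
    (measurable_heatProfile d R).comp (by fun_prop : Measurable fun h => (t, ‖h‖))
  refine ((integrable_abs_mul_exp_mul_rpow hR (by linarith) hf hfint x).const_mul
    (Real.exp (-t * R) * (4 * Real.pi * t) ^ (-(d : ℝ) / 2) *
      (Real.exp ((√R + 1) ^ 2 * t + 1) * p ^ p))).mono'
    (hm.mul (by fun_prop)).aestronglyMeasurable (ae_of_all _ fun h => ?_)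
  rw [norm_mul, Real.norm_of_nonneg (heatProfile_nonneg d R _ ht.le), Real.norm_eq_abs]
  calc _ ≤ _ := mul_le_mul_of_nonneg_right
        (heatProfile_le_exp_mul_rpow d (R := R) hp ht (norm_nonneg h)) (abs_nonneg _)
    _ = _ := by ring

lemma integral_heatProfile (d : ℕ) (R : ℝ) {t : ℝ} (ht : 0 < t) :
    Integrable (fun h : EuclideanSpace ℝ (Fin d) => heatProfile d R t ‖h‖) ∧
      ∫ h : EuclideanSpace ℝ (Fin d), heatProfile d R t ‖h‖ = Real.exp (-t * R) := by
  have hpi := Real.pi_pos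
  have e : (fun h : EuclideanSpace ℝ (Fin d) => heatProfile d R t ‖h‖) = fun h =>
      Real.exp (-t * R) * (4 * Real.pi * t) ^ (-(d : ℝ) / 2) *
        Real.exp (-(1 / (4 * t)) * ‖h‖ ^ 2) := by
    funext h; rw [heatProfile]; congr 2; ring
  have hb : 0 < 1 / (4 * t) := by positivity
  rw [e]
  constructor
  · have := (GaussianFourier.integrable_cexp_neg_mul_sq_norm_add (b := (1 / (4 * t) : ℝ))
      (by simpa using hb) 0 (0 : EuclideanSpace ℝ (Fin d))).norm
    refine Integrable.const_mul (this.congr (ae_of_all _ fun h => ?_)) _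
    simp [Complex.norm_exp, ← Complex.ofReal_pow]
  · rw [integral_const_mul, GaussianFourier.integral_rexp_neg_mul_sq_norm hb,
      finrank_euclideanSpace_fin, mul_assoc, neg_div, Real.rpow_neg (by positivity),
      show Real.pi / (1 / (4 * t)) = 4 * Real.pi * t by field_simp, inv_mul_cancel₀ (by positivity),
      mul_one]

lemma integrableOn_exp_sub_one_mul_rpow {R σ : ℝ} (hR : 0 ≤ R) (hσ : σ ∈ Ioo (0 : ℝ) 1) :
    IntegrableOn (fun t => (Real.exp (-t * R) - 1) * t ^ (-(1 + σ))) (Ioi 0) := by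
  have hm : Measurable fun t : ℝ => (Real.exp (-t * R) - 1) * t ^ (-(1 + σ)) := by fun_prop
  rw [← Ioc_union_Ioi_eq_Ioi (zero_le_one' ℝ)]
  refine IntegrableOn.union ?_ ?_
  · have h : IntegrableOn (fun t : ℝ => R * t ^ (-σ)) (Ioc 0 1) := by
      have := (intervalIntegral.intervalIntegrable_rpow' (a := 0) (b := 1) (r := -σ)
        (by linarith [hσ.2])).const_mul R
      rwa [intervalIntegrable_iff_integrableOn_Ioc_of_le zero_le_one] at this
    refine h.mono' hm.aestronglyMeasurable
      ((ae_restrict_iff' measurableSet_Ioc).2 (ae_of_all _ fun t ht => ?_))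
    have ht0 : 0 < t := ht.1
    have h1 : |Real.exp (-t * R) - 1| ≤ t * R := by
      have h1 := Real.add_one_le_exp (-t * R)
      have h2 : Real.exp (-t * R) ≤ 1 := Real.exp_le_one_iff.2 (by nlinarith)
      rw [abs_sub_comm, abs_of_nonneg (by linarith)]
      linarith
    rw [norm_mul, Real.norm_eq_abs, Real.norm_of_nonneg (by positivity)]
    calc _ ≤ t * R * t ^ (-(1 + σ)) := by gcongr
      _ = _ := by
        rw [show -(1 + σ) = -σ + -1 by ring, Real.rpow_add ht0, Real.rpow_neg_one]
        field_simp
  · refine (integrableOn_Ioi_rpow_of_lt (a := -(1 + σ)) (by linarith [hσ.1])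
      one_pos).mono' hm.aestronglyMeasurable
      ((ae_restrict_iff' measurableSet_Ioi).2 (ae_of_all _ fun t ht => ?_))
    have ht0 : 0 < t := one_pos.trans ht
    have h2 : Real.exp (-t * R) ≤ 1 := Real.exp_le_one_iff.2 (by nlinarith)
    rw [norm_mul, Real.norm_eq_abs, Real.norm_of_nonneg (by positivity : 0 ≤ t ^ (-(1 + σ)))]
    refine mul_le_of_le_one_left (by positivity) ?_
    rw [abs_sub_comm, abs_of_nonneg (by linarith)]
    linarith [Real.exp_pos (-t * R)]

lemma rpow_neg_le_mul_one_add_rpow_neg {δ r p : ℝ} (hδ : 0 < δ) (hr : δ ≤ r) (hp : 0 ≤ p) :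
    r ^ (-p) ≤ (1 + 1 / δ) ^ p * (1 + r) ^ (-p) := by
  have hr0 : 0 < r := hδ.trans_le hr
  rw [Real.rpow_neg hr0.le, Real.rpow_neg (by positivity), ← div_eq_mul_inv,
    ← Real.div_rpow (by positivity) (by positivity), ← Real.inv_rpow hr0.le]
  gcongr
  rw [le_div_iff₀ (by positivity), mul_add, inv_mul_cancel₀ hr0.ne', add_comm, mul_one,
    inv_eq_one_div]
  gcongr

/-- Splitting `heatProfile` at the radius `δ`, where the two bounds of its time integral meet
the local smoothness and the weighted integrability. -/
lemma integrable_heatProfile_mul_symmDiff {d : ℕ} (hd : 1 ≤ d) {R σ : ℝ} (hR : 0 ≤ R)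
    (hσ : 0 < σ) {f : EuclideanSpace ℝ (Fin d) → ℝ} (hf : Measurable f)
    (hfint : Integrable (fun y => |f y| * (Real.exp (-√(R * (1 + ‖y‖ ^ 2))) /
        (1 + ‖y‖) ^ (((d : ℝ) + 1) / 2 + σ))))
    {x : EuclideanSpace ℝ (Fin d)} (hsmooth : DalphaAt d (2 * σ) f x) :
    Integrable (fun q : ℝ × EuclideanSpace ℝ (Fin d) =>
      heatProfile d R q.1 ‖q.2‖ * q.1 ^ (-(1 + σ)) * (f (x + q.2) + f (x - q.2) - 2 * f x))
      ((volume.restrict (Ioi 0)).prod volume) := by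
  obtain ⟨δ, hδ, hloc⟩ := hsmooth
  obtain ⟨C₁, hC₁, h₁⟩ := exists_lintegral_heatProfile_le_rpow hd hR hσ
  obtain ⟨C₂, hC₂, h₂⟩ := exists_lintegral_heatProfile_le_exp hd hR hσ hδ
  set g : EuclideanSpace ℝ (Fin d) → ℝ := fun h => f (x + h) + f (x - h) - 2 * f x with hg
  set p := ((d : ℝ) + 1) / 2 + σ with hp_def
  have hp : 0 ≤ p := by positivity
  set s := (d : ℝ) + 2 * σ with hs_def
  have hs : 0 ≤ s := by positivity
  have hm : Measurable fun q : ℝ × EuclideanSpace ℝ (Fin d) =>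
      heatProfile d R q.1 ‖q.2‖ * q.1 ^ (-(1 + σ)) * g q.2 := by
    have hk : Measurable fun q : ℝ × EuclideanSpace ℝ (Fin d) => heatProfile d R q.1 ‖q.2‖ :=
      (measurable_heatProfile d R).comp
        (by fun_prop : Measurable fun q : ℝ × EuclideanSpace ℝ (Fin d) => (q.1, ‖q.2‖))
    have hgm : Measurable g := by fun_prop
    fun_prop
  set M : ℝ → ENNReal := fun r =>
    ∫⁻ t in Ioi (0 : ℝ), ENNReal.ofReal (heatProfile d R t r * t ^ (-(1 + σ)))
  have hF : ∫⁻ q, ‖heatProfile d R q.1 ‖q.2‖ * q.1 ^ (-(1 + σ)) * g q.2‖ₑ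
      ∂((volume.restrict (Ioi (0 : ℝ))).prod (volume : Measure (EuclideanSpace ℝ (Fin d)))) =
      ∫⁻ h, M ‖h‖ * ENNReal.ofReal |g h| := by
    rw [lintegral_prod_symm _ hm.enorm.aemeasurable]
    refine lintegral_congr fun h => ?_
    rw [← lintegral_mul_const' _ _ ENNReal.ofReal_ne_top]
    refine setLIntegral_congr_fun measurableSet_Ioi fun t ht => ?_
    have ht : 0 < t := ht
    simp only
    rw [enorm_mul, Real.enorm_of_nonneg
      (mul_nonneg (heatProfile_nonneg d R _ ht.le) (by positivity)), Real.enorm_eq_ofReal_abs]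
  refine ⟨hm.aestronglyMeasurable, ?_⟩
  rw [hasFiniteIntegral_iff_enorm, hF]
  have hA : MeasurableSet {h : EuclideanSpace ℝ (Fin d) | ‖h‖ ≤ δ} :=
    measurableSet_le measurable_norm measurable_const
  rw [← lintegral_add_compl _ hA, ENNReal.add_lt_top]
  constructor
  · refine lt_of_le_of_lt (setLIntegral_mono' hA fun h _ => ?_)
      (hloc.const_mul C₁).lintegral_lt_top
    rcases eq_or_ne h 0 with rfl | h0
    · have : g 0 = 0 := by simp only [hg, add_zero, sub_zero]; ring
      simp [this]
    · have hr : 0 < ‖h‖ := norm_pos_iff.2 h0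
      calc M ‖h‖ * ENNReal.ofReal |g h|
          ≤ ENNReal.ofReal (C₁ * ‖h‖ ^ (-s)) * ENNReal.ofReal |g h| := by
            gcongr; exact h₁ _ hr
        _ = _ := by
            rw [← ENNReal.ofReal_mul (by positivity), Real.rpow_neg hr.le]
            congr 1
            ring
  · have hint := integrable_abs_mul_exp_mul_rpow hR hp hf hfint x
    have hint' := hint.comp_neg
    have hone : Integrable fun h : EuclideanSpace ℝ (Fin d) => (1 + ‖h‖) ^ (-s) :=
      integrable_one_add_norm (by rw [finrank_euclideanSpace_fin]; linarith)
    refine lt_of_le_of_lt (setLIntegral_mono' hA.compl fun h hh => ?_)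
      (((hint.add hint').const_mul (C₂ * (1 + 1 / δ) ^ p)).add
        (hone.const_mul (C₁ * (1 + 1 / δ) ^ s * (2 * |f x|)))).integrableOn.lintegral_lt_top
    have hh : δ < ‖h‖ := not_le.1 hh
    have hr : 0 < ‖h‖ := hδ.trans hh
    have hM₁ : M ‖h‖ ≤ ENNReal.ofReal (C₁ * ((1 + 1 / δ) ^ s * (1 + ‖h‖) ^ (-s))) := by
      refine (h₁ _ hr).trans ?_
      gcongr
      exact rpow_neg_le_mul_one_add_rpow_neg hδ hh.le hs
    have hM₂ : M ‖h‖ ≤ ENNReal.ofReal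
        (C₂ * (Real.exp (-(√R * ‖h‖)) * ((1 + 1 / δ) ^ p * (1 + ‖h‖) ^ (-p)))) := by
      refine (h₂ _ hh.le).trans ?_
      gcongr
      exact rpow_neg_le_mul_one_add_rpow_neg hδ hh.le hp
    have hgle : |g h| ≤ (|f (x + h)| + |f (x - h)|) + 2 * |f x| := by
      have h1 := abs_sub (f (x + h) + f (x - h)) (2 * f x)
      have h2 := abs_add_le (f (x + h)) (f (x - h))
      rw [abs_mul, abs_two] at h1
      linarith
    calc M ‖h‖ * ENNReal.ofReal |g h|
        ≤ M ‖h‖ * ENNReal.ofReal ((|f (x + h)| + |f (x - h)|) + 2 * |f x|) := by gcongr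
      _ = M ‖h‖ * ENNReal.ofReal (|f (x + h)| + |f (x - h)|) +
          M ‖h‖ * ENNReal.ofReal (2 * |f x|) := by
          rw [ENNReal.ofReal_add (by positivity) (by positivity), mul_add]
      _ ≤ ENNReal.ofReal
            (C₂ * (Real.exp (-(√R * ‖h‖)) * ((1 + 1 / δ) ^ p * (1 + ‖h‖) ^ (-p)))) *
            ENNReal.ofReal (|f (x + h)| + |f (x - h)|) +
          ENNReal.ofReal (C₁ * ((1 + 1 / δ) ^ s * (1 + ‖h‖) ^ (-s))) *
            ENNReal.ofReal (2 * |f x|) := by gcongr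
      _ = _ := by
          rw [← ENNReal.ofReal_mul (by positivity), ← ENNReal.ofReal_mul (by positivity),
            ← ENNReal.ofReal_add (by positivity) (by positivity)]
          simp only [Pi.add_apply, norm_neg, ← sub_eq_add_neg]
          congr 1
          ring

lemma integral_heatR_mul_sub_eq {d : ℕ} {R p t : ℝ} (hR : 0 ≤ R) (hp : 1 ≤ p) (ht : 0 < t)
    {f : EuclideanSpace ℝ (Fin d) → ℝ} (hf : Measurable f)
    (hfint : Integrable
      (fun y => |f y| * (Real.exp (-√(R * (1 + ‖y‖ ^ 2))) / (1 + ‖y‖) ^ p)))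
    (x : EuclideanSpace ℝ (Fin d)) :
    (∫ y, heatR d R t x y * f y) - f x =
      1 / 2 * (∫ h, heatProfile d R t ‖h‖ * (f (x + h) + f (x - h) - 2 * f x)) +
        (Real.exp (-t * R) - 1) * f x := by
  have hint := integrable_heatProfile_mul hR hp ht hf hfint x
  have hint' : Integrable (fun h => heatProfile d R t ‖h‖ * f (x - h)) := by
    simpa only [norm_neg, ← sub_eq_add_neg] using hint.comp_neg
  obtain ⟨hk, hk'⟩ := integral_heatProfile d R ht
  have e₁ : ∫ y, heatR d R t x y * f y = ∫ h, heatProfile d R t ‖h‖ * f (x + h) := by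
    rw [← integral_add_left_eq_self _ x]
    refine integral_congr_ae (ae_of_all _ fun h => ?_)
    simp [heatR, heatProfile]
  have e₂ : ∫ h, heatProfile d R t ‖h‖ * f (x - h) = ∫ h, heatProfile d R t ‖h‖ * f (x + h) := by
    rw [← integral_neg_eq_self]
    simp only [norm_neg, sub_neg_eq_add]
  have e₃ : ∫ h, heatProfile d R t ‖h‖ * (f (x + h) + f (x - h) - 2 * f x) =
      (∫ h, heatProfile d R t ‖h‖ * f (x + h)) + (∫ h, heatProfile d R t ‖h‖ * f (x - h)) -
        Real.exp (-t * R) * (2 * f x) := by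
    rw [← hk', ← integral_mul_const, ← integral_add hint hint',
      ← integral_sub (by exact hint.add hint') (hk.mul_const _)]
    refine integral_congr_ae (ae_of_all _ fun h => ?_)
    ring
  rw [e₃, e₂, e₁]
  ring

/-- For `𝔏 = -Δ + R` with `R > 0` and `σ ∈ (0,1)`: if `f` is measurable
with `∫ |f(y)| e^{-√(R(1+|y|²))} (1+|y|)^{-((d+1)/2+σ)} dy < ∞` and `2σ`-smooth at `x₀`,
then `∫₀^∞ |e^{-t𝔏}f(x₀) - f(x₀)| t^{-(1+σ)} dt < ∞`, so `(-Δ+R)^σ f(x₀)` converges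
absolutely. -/
theorem laplacian_plus_R_fractional_power_absolutely_convergent
    (d : ℕ) (hd : 1 ≤ d) (R : ℝ) (hR : 0 < R)
    (σ : ℝ) (hσ : σ ∈ Set.Ioo (0 : ℝ) 1)
    (f : EuclideanSpace ℝ (Fin d) → ℝ) (hfmeas : Measurable f)
    (hfint : MeasureTheory.Integrable
      (fun y => |f y| * (Real.exp (-Real.sqrt (R * (1 + ‖y‖ ^ 2))) /
        (1 + ‖y‖) ^ (((d : ℝ) + 1) / 2 + σ))))
    (x₀ : EuclideanSpace ℝ (Fin d))
    (hsmooth : DalphaAt d (2 * σ) f x₀) :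
    MeasureTheory.IntegrableOn
      (fun t => |(∫ y, heatR d R t x₀ y * f y) - f x₀| * t ^ (-(1 + σ)))
      (Set.Ioi (0 : ℝ)) := by
  have hd' : (1 : ℝ) ≤ d := by exact_mod_cast hd
  have hp : 1 ≤ ((d : ℝ) + 1) / 2 + σ := by linarith [hσ.1]
  have h₁ := (integrable_heatProfile_mul_symmDiff hd hR.le hσ.1 hfmeas hfint
    hsmooth).integral_prod_left
  have h₂ : Integrable (fun t => (Real.exp (-t * R) - 1) * t ^ (-(1 + σ)))
      (volume.restrict (Ioi 0)) := integrableOn_exp_sub_one_mul_rpow hR.le hσ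
  refine ((h₁.const_mul (1 / 2)).add (h₂.mul_const (f x₀))).norm.congr
    ((ae_restrict_iff' measurableSet_Ioi).2 (ae_of_all _ fun t ht => ?_))
  have ht : 0 < t := ht
  simp only [Pi.add_apply]
  rw [integral_heatR_mul_sub_eq hR.le hp ht hfmeas hfint x₀, Real.norm_eq_abs]
  have habs := abs_of_nonneg (Real.rpow_nonneg ht.le (-(1 + σ)))
  conv_rhs => rw [← habs, ← abs_mul, add_mul, mul_assoc (1 / 2 : ℝ), ← integral_mul_const]
  simp only [mul_right_comm _ (t ^ (-(1 + σ)))]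
end

section
/- Let d ≥ 1, σ ∈ (0,1), and let h : (0,∞) × ℝ^d × ℝ^d → ℝ be measurable with 0 < h_s(x,y) ≤ C s^{-d/2} for all s > 0 and x,y ∈ ℝ^d. Define p^σ_t(x,y) = ((t/2)^{2σ}/Γ(σ)) ∫₀^∞ e^{-t²/(4s)} h_s(x,y) s^{-(1+σ)} ds and P^σ_t f(x) = ∫_{ℝ^d} p^σ_t(x,y) f(y) dy. Fix x ∈ ℝ^d and suppose: (i) there is a measurable Φ ≥ 0 such that for every t > 0 there is c₂(t,x) > 0 with p^σ_t(x,y) ≤ c₂(t,x) Φ(y) for all y; (ii) f is measurable with ∫_{ℝ^d} |f(y)| Φ(y) dy < ∞ and |f(x)| < ∞; and (iii) ∫₀^∞ | ∫_{ℝ^d} h_s(x,y) f(y) dy − f(x) | s^{-(1+σ)} ds < ∞. Then t ↦ P^σ_t f(x) is differentiable on (0,∞) and lim_{t→0⁺} ( −c_σ t^{1−2σ} ∂_t P^σ_t f(x) ) = (1/Γ(-σ)) ∫₀^∞ ( ∫_{ℝ^d} h_s(x,y) f(y) dy − f(x) ) s^{-(1+σ)} ds, where c_σ = 2^{2σ−1}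 Γ(σ)/Γ(1−σ) and Γ(-σ) := Γ(1-σ)/(-σ). -/
open MeasureTheory Set Filter
open RealInnerProductSpace

/-- The subordinated (Poisson) kernel obtained from a heat kernel `h` by the
subordination formula. -/
noncomputable def subord {X : Type*} (σ : ℝ) (h : ℝ → X → X → ℝ) (t : ℝ) (x y : X) : ℝ :=
  ((t / 2) ^ (2 * σ) / Real.Gamma σ) *
    ∫ s in Set.Ioi (0 : ℝ), Real.exp (-t ^ 2 / (4 * s)) * h s x y * s ^ (-(1 + σ))

/-- The substitution `s ↦ s⁻¹` turns the inverse-Gamma density into the Gamma density. -/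
theorem inverseGamma_integrableOn_and_integral {a r : ℝ} (ha : 0 < a) (hr : 0 < r) :
    IntegrableOn (fun s : ℝ => Real.exp (-a / s) * s ^ (-(1 + r))) (Ioi 0) ∧
      ∫ s in Ioi (0 : ℝ), Real.exp (-a / s) * s ^ (-(1 + r)) = (1 / a) ^ r * Real.Gamma r := by
  have key : EqOn (fun s : ℝ => (|(-1 : ℝ)| * s ^ ((-1 : ℝ) - 1)) •
      (fun v : ℝ => v ^ (r - 1) * Real.exp (-(a * v))) (s ^ (-1 : ℝ)))
      (fun s : ℝ => Real.exp (-a / s) * s ^ (-(1 + r))) (Ioi 0) := by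
    intro s hs
    have hs : 0 < s := hs
    simp only [abs_neg, abs_one, one_mul, smul_eq_mul]
    rw [← Real.rpow_mul hs.le, ← mul_assoc, ← Real.rpow_add hs, Real.rpow_neg_one, mul_comm,
      neg_div, div_eq_mul_inv]
    congr 2
    ring
  have hval := Real.integral_rpow_mul_exp_neg_mul_Ioi hr ha
  constructor
  · refine IntegrableOn.congr_fun ?_ key measurableSet_Ioi
    refine (integrableOn_Ioi_comp_rpow_iff (fun v => v ^ (r - 1) * Real.exp (-(a * v)))
      (by norm_num : (-1 : ℝ) ≠ 0)).2 (Integrable.of_integral_ne_zero ?_)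
    rw [hval]
    have := Real.Gamma_pos_of_pos hr
    positivity
  · rw [← setIntegral_congr_fun measurableSet_Ioi key]
    exact (integral_comp_rpow_Ioi (fun v => v ^ (r - 1) * Real.exp (-(a * v)))
      (by norm_num : (-1 : ℝ) ≠ 0)).trans hval

theorem heatWeight_integrableOn {t r : ℝ} (ht : 0 < t) (hr : 0 < r) :
    IntegrableOn (fun s : ℝ => Real.exp (-t ^ 2 / (4 * s)) * s ^ (-(1 + r))) (Ioi 0) := by
  have := (inverseGamma_integrableOn_and_integral (a := t ^ 2 / 4) (by positivity) hr).1
  refine this.congr_fun (fun s _ => ?_) measurableSet_Ioi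
  simp only
  congr 2
  rw [← neg_div, div_div]

theorem heatWeight_integral {t r : ℝ} (ht : 0 < t) (hr : 0 < r) :
    ((t / 2) ^ (2 * r) / Real.Gamma r) *
      ∫ s in Ioi (0 : ℝ), Real.exp (-t ^ 2 / (4 * s)) * s ^ (-(1 + r)) = 1 := by
  have hI := (inverseGamma_integrableOn_and_integral (a := t ^ 2 / 4) (by positivity) hr).2
  have hG := (Real.Gamma_pos_of_pos hr).ne'
  have hfun : ∀ s : ℝ, -t ^ 2 / (4 * s) = -(t ^ 2 / 4) / s := fun s => by
    rw [← neg_div, div_div]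
  simp_rw [hfun, hI]
  have hsq : t ^ 2 / 4 = (t / 2) ^ (2 : ℝ) := by
    rw [Real.rpow_two]; ring
  rw [hsq, Real.div_rpow zero_le_one (by positivity), Real.one_rpow,
    ← Real.rpow_mul (by positivity)]
  have : (t / 2) ^ (2 * r) ≠ 0 := (Real.rpow_pos_of_pos (by positivity) _).ne'
  field_simp

theorem mul_exp_neg_le_one (v : ℝ) : v * Real.exp (-v) ≤ 1 := by
  rw [Real.exp_neg, ← div_eq_mul_inv, div_le_one (Real.exp_pos v)]
  linarith [Real.add_one_le_exp v]

theorem heatWeight_le_one (t : ℝ) {s : ℝ} (hs : 0 < s) : Real.exp (-t ^ 2 / (4 * s)) ≤ 1 := by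
  rw [Real.exp_le_one_iff, neg_div]
  exact neg_nonpos.2 (by positivity)

theorem measurable_heatWeight (t : ℝ) :
    Measurable (fun s : ℝ => Real.exp (-t ^ 2 / (4 * s))) := by fun_prop

theorem hasDerivAt_heatWeight (t s : ℝ) :
    HasDerivAt (fun u : ℝ => Real.exp (-u ^ 2 / (4 * s)))
      (-(t / (2 * s)) * Real.exp (-t ^ 2 / (4 * s))) t := by
  have := (((hasDerivAt_pow 2 t).neg).div_const (4 * s)).exp
  refine this.congr_deriv ?_
  rcases eq_or_ne s 0 with rfl | hs
  · simp
  · simp only [Pi.neg_apply]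
    field_simp
    push_cast
    ring

theorem integrable_heatWeight_mul {w : ℝ → ℝ} (hw : IntegrableOn w (Ioi 0)) (t : ℝ) :
    IntegrableOn (fun s => Real.exp (-t ^ 2 / (4 * s)) * w s) (Ioi 0) := by
  refine Integrable.bdd_mul (c := 1) hw (measurable_heatWeight t).aestronglyMeasurable ?_
  filter_upwards [ae_restrict_mem measurableSet_Ioi] with s hs
  rw [Real.norm_of_nonneg (Real.exp_pos _).le]
  exact heatWeight_le_one t hs

theorem hasDerivAt_integral_heatWeight {w : ℝ → ℝ} (hw : IntegrableOn w (Ioi 0)) {t : ℝ}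
    (ht : 0 < t) :
    HasDerivAt (fun u => ∫ s in Ioi (0 : ℝ), Real.exp (-u ^ 2 / (4 * s)) * w s)
      (∫ s in Ioi (0 : ℝ), -(t / (2 * s)) * Real.exp (-t ^ 2 / (4 * s)) * w s) t := by
  refine (hasDerivAt_integral_of_dominated_loc_of_deriv_le
    (μ := volume.restrict (Ioi 0)) (bound := fun s => 4 / t * |w s|) (s := Ioi (t / 2))
    (F := fun u s => Real.exp (-u ^ 2 / (4 * s)) * w s)
    (F' := fun u s => -(u / (2 * s)) * Real.exp (-u ^ 2 / (4 * s)) * w s)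
    (Ioi_mem_nhds (by linarith)) (Eventually.of_forall fun u => ?_)
    (integrable_heatWeight_mul hw t) ?_ ?_ (hw.abs.const_mul _) ?_).2
  · exact (integrable_heatWeight_mul hw u).aestronglyMeasurable
  · exact (by fun_prop : Measurable fun s : ℝ => -(t / (2 * s)) * Real.exp (-t ^ 2 / (4 * s)))
      |>.aestronglyMeasurable.mul hw.aestronglyMeasurable
  · filter_upwards [ae_restrict_mem measurableSet_Ioi] with s hs u hu
    have hs : 0 < s := hs
    have hu : t / 2 < u := hu
    have hu0 : 0 < u := by linarith
    rw [norm_mul, Real.norm_eq_abs (w s)]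
    gcongr
    rw [neg_mul, norm_neg, Real.norm_of_nonneg (by positivity)]
    have h1 : u / (2 * s) * Real.exp (-u ^ 2 / (4 * s)) =
        2 / u * (u ^ 2 / (4 * s) * Real.exp (-(u ^ 2 / (4 * s)))) := by
      rw [neg_div]
      field_simp
      norm_num
    rw [h1]
    calc _ ≤ 2 / u * 1 := by gcongr; exact mul_exp_neg_le_one _
      _ ≤ 4 / t := by
        rw [mul_one, div_le_div_iff₀ hu0 ht]
        linarith
  · exact Eventually.of_forall fun s u _ => (hasDerivAt_heatWeight u s).mul_const (w s)

theorem tendsto_heatWeight_exponent (s : ℝ) :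
    Tendsto (fun t : ℝ => t ^ 2 / (4 * s)) (nhdsWithin 0 (Ioi 0)) (nhds 0) := by
  have : Continuous fun t : ℝ => t ^ 2 / (4 * s) := by fun_prop
  simpa using (this.tendsto 0).mono_left nhdsWithin_le_nhds

theorem tendsto_integral_heatWeight {w : ℝ → ℝ} (hw : IntegrableOn w (Ioi 0)) :
    Tendsto (fun t => ∫ s in Ioi (0 : ℝ), Real.exp (-t ^ 2 / (4 * s)) * w s)
      (nhdsWithin 0 (Ioi 0)) (nhds (∫ s in Ioi (0 : ℝ), w s)) := by
  refine tendsto_integral_filter_of_dominated_convergence (fun s => |w s|)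
    (Eventually.of_forall fun t => (integrable_heatWeight_mul hw t).aestronglyMeasurable)
    (Eventually.of_forall fun t => ?_) hw.abs (Eventually.of_forall fun s => ?_)
  · filter_upwards [ae_restrict_mem measurableSet_Ioi] with s hs
    rw [norm_mul, Real.norm_of_nonneg (Real.exp_pos _).le]
    exact mul_le_of_le_one_left (abs_nonneg _) (heatWeight_le_one t hs)
  · have := ((tendsto_heatWeight_exponent s).neg.rexp).mul_const (w s)
    simpa [neg_div] using this

theorem tendsto_mul_deriv_integral_heatWeight {w : ℝ → ℝ} (hw : IntegrableOn w (Ioi 0)) :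
    Tendsto (fun t => t * ∫ s in Ioi (0 : ℝ), -(t / (2 * s)) * Real.exp (-t ^ 2 / (4 * s)) * w s)
      (nhdsWithin 0 (Ioi 0)) (nhds 0) := by
  have hlim : Tendsto (fun t => ∫ s in Ioi (0 : ℝ),
      t ^ 2 / (4 * s) * Real.exp (-(t ^ 2 / (4 * s))) * w s)
      (nhdsWithin 0 (Ioi 0)) (nhds (∫ s in Ioi (0 : ℝ), 0)) := by
    refine tendsto_integral_filter_of_dominated_convergence (fun s => |w s|)
      (Eventually.of_forall fun t => ?_)
      (Eventually.of_forall fun t => ?_) hw.abs (Eventually.of_forall fun s => ?_)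
    · exact (by fun_prop : Measurable fun s : ℝ =>
        t ^ 2 / (4 * s) * Real.exp (-(t ^ 2 / (4 * s))))
        |>.aestronglyMeasurable.mul hw.aestronglyMeasurable
    · filter_upwards [ae_restrict_mem measurableSet_Ioi] with s hs
      have hs : 0 < s := hs
      rw [norm_mul, Real.norm_of_nonneg (by positivity)]
      exact mul_le_of_le_one_left (abs_nonneg _) (mul_exp_neg_le_one _)
    · have h0 := tendsto_heatWeight_exponent s
      simpa using (h0.mul h0.neg.rexp).mul_const (w s)
  have := hlim.const_mul (-2)
  simp only [integral_zero, mul_zero] at this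
  refine this.congr fun t => ?_
  rw [← integral_const_mul, ← integral_const_mul]
  congr 1 with s
  rw [neg_div]
  rcases eq_or_ne s 0 with rfl | hs
  · simp
  · field_simp
    ring

/-- Neumann limit of the subordinated extension of a function of `s` that is integrable
against the Bochner weight. -/
theorem subordination_differentiable_and_neumann_limit {σ : ℝ} (hσ : σ ∈ Ioo (0 : ℝ) 1) (b : ℝ)
    {w : ℝ → ℝ} (hw : IntegrableOn w (Ioi 0)) {P : ℝ → ℝ}
    (hP : ∀ t, 0 < t → P t = b + (t / 2) ^ (2 * σ) / Real.Gamma σ *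
      ∫ s in Ioi (0 : ℝ), Real.exp (-t ^ 2 / (4 * s)) * w s) :
    (∀ t ∈ Ioi (0 : ℝ), DifferentiableAt ℝ P t) ∧
    Tendsto (fun t => -((2 : ℝ) ^ (2 * σ - 1) * Real.Gamma σ / Real.Gamma (1 - σ)) *
        t ^ (1 - 2 * σ) * deriv P t) (nhdsWithin 0 (Ioi 0))
      (nhds ((1 / (Real.Gamma (1 - σ) / (-σ))) * ∫ s in Ioi (0 : ℝ), w s)) := by
  obtain ⟨hσ0, hσ1⟩ := hσ
  set K := fun u => ∫ s in Ioi (0 : ℝ), Real.exp (-u ^ 2 / (4 * s)) * w s with hK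
  set D := fun t => ∫ s in Ioi (0 : ℝ), -(t / (2 * s)) * Real.exp (-t ^ 2 / (4 * s)) * w s with hD
  have hΓ := (Real.Gamma_pos_of_pos hσ0).ne'
  have hΓ' := (Real.Gamma_pos_of_pos (sub_pos.2 hσ1)).ne'
  have hderiv : ∀ t, 0 < t → HasDerivAt P
      ((1 / 2 * (2 * σ) * (t / 2) ^ (2 * σ - 1)) / Real.Gamma σ * K t +
        (t / 2) ^ (2 * σ) / Real.Gamma σ * D t) t := by
    intro t ht
    have h1 : HasDerivAt (fun u : ℝ => (u / 2) ^ (2 * σ))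
        (1 / 2 * (2 * σ) * (t / 2) ^ (2 * σ - 1)) t :=
      ((hasDerivAt_id t).div_const 2).rpow_const (Or.inl (by simp; positivity))
    have h2 := ((h1.div_const (Real.Gamma σ)).mul
      (hasDerivAt_integral_heatWeight hw ht)).const_add b
    refine h2.congr_of_eventuallyEq ?_
    filter_upwards [Ioi_mem_nhds ht] with u hu
    exact hP u hu
  refine ⟨fun t ht => (hderiv t ht).differentiableAt, ?_⟩
  have hlim := (((tendsto_integral_heatWeight hw).const_mul (2 * σ)).add
    (tendsto_mul_deriv_integral_heatWeight hw)).const_mul (-(1 / (2 * Real.Gamma (1 - σ))))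
  have hval : -(1 / (2 * Real.Gamma (1 - σ))) * (2 * σ * (∫ s in Ioi (0 : ℝ), w s) + 0) =
      (1 / (Real.Gamma (1 - σ) / (-σ))) * ∫ s in Ioi (0 : ℝ), w s := by
    field_simp
    ring
  rw [hval] at hlim
  refine hlim.congr' ?_
  filter_upwards [self_mem_nhdsWithin] with t ht
  have ht : 0 < t := ht
  rw [(hderiv t ht).deriv]
  change -(1 / (2 * Real.Gamma (1 - σ))) * (2 * σ * K t + t * D t) = _
  rw [Real.div_rpow ht.le zero_le_two, Real.div_rpow ht.le zero_le_two,
    Real.rpow_sub_one ht.ne', Real.rpow_sub_one two_ne_zero, Real.rpow_sub ht, Real.rpow_one]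
  have h1 := (Real.rpow_pos_of_pos ht (2 * σ)).ne'
  have h2 := (Real.rpow_pos_of_pos two_pos (2 * σ)).ne'
  field_simp

section Subordination

variable {Y : Type*} [MeasurableSpace Y] {μ : Measure Y} [SFinite μ] {σ t : ℝ} {k : ℝ → Y → ℝ}
  {f : Y → ℝ}

/-- Fubini for the subordination formula: positivity of the kernel makes integrability in `y` of
the subordinated kernel against `f` sufficient. -/
theorem integrable_prod_heatWeight (hk : Measurable (Function.uncurry k)) (hf : Measurable f)
    (hpos : ∀ s, 0 < s → ∀ y, 0 ≤ k s y)
    (hint : ∀ y, IntegrableOn (fun s => Real.exp (-t ^ 2 / (4 * s)) * k s y * s ^ (-(1 + σ)))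
      (Ioi 0))
    (hfint : Integrable (fun y => |f y| * ∫ s in Ioi (0 : ℝ),
      Real.exp (-t ^ 2 / (4 * s)) * k s y * s ^ (-(1 + σ))) μ) :
    Integrable (fun p : ℝ × Y =>
      Real.exp (-t ^ 2 / (4 * p.1)) * k p.1 p.2 * p.1 ^ (-(1 + σ)) * f p.2)
      ((volume.restrict (Ioi 0)).prod μ) := by
  have hk' : Measurable fun p : ℝ × Y => k p.1 p.2 := hk
  have hmeas : Measurable (fun p : ℝ × Y =>
      Real.exp (-t ^ 2 / (4 * p.1)) * k p.1 p.2 * p.1 ^ (-(1 + σ)) * f p.2) := by fun_prop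
  rw [integrable_prod_iff' hmeas.aestronglyMeasurable]
  refine ⟨Eventually.of_forall fun y => (hint y).mul_const (f y), ?_⟩
  refine hfint.congr (Eventually.of_forall fun y => ?_)
  simp only
  rw [← integral_const_mul]
  refine setIntegral_congr_fun measurableSet_Ioi fun s hs => ?_
  have hs : 0 < s := hs
  have := hpos s hs y
  rw [norm_mul, Real.norm_of_nonneg (by positivity), Real.norm_eq_abs, mul_comm]

end Subordination

/-- Let `h` be a measurable kernel with `0 < h_s(x,y) ≤ C s^{-d/2}`,
and let `p^σ_t`, `P^σ_t` be obtained by subordination.  If (i) `p^σ_t(x,·) ≤ c₂(t,x) Φ`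
for a nonnegative measurable `Φ`, (ii) `f ∈ L¹(Φ)`, and (iii) the point `x` is
`L^σ`-admissible for `f`, then `t ↦ P^σ_t f(x)` is differentiable on `(0,∞)` and
`lim_{t→0⁺} (-c_σ t^{1-2σ} ∂_t P^σ_t f(x)) = (1/Γ(-σ)) ∫₀^∞ (e^{-sL}f(x) - f(x)) s^{-(1+σ)} ds`. -/
theorem subordinated_neumann_limit_eq_bochner
    (d : ℕ) (hd : 1 ≤ d) (σ : ℝ) (hσ : σ ∈ Set.Ioo (0 : ℝ) 1)
    (h : ℝ → EuclideanSpace ℝ (Fin d) → EuclideanSpace ℝ (Fin d) → ℝ)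
    (hmeas : Measurable
      (fun p : ℝ × EuclideanSpace ℝ (Fin d) × EuclideanSpace ℝ (Fin d) => h p.1 p.2.1 p.2.2))
    (C : ℝ) (hC : 0 < C)
    (hpos : ∀ s, 0 < s → ∀ x y, 0 < h s x y)
    (hbd : ∀ s, 0 < s → ∀ x y, h s x y ≤ C * s ^ (-(d : ℝ) / 2))
    (x : EuclideanSpace ℝ (Fin d))
    (Φ : EuclideanSpace ℝ (Fin d) → ℝ) (hΦmeas : Measurable Φ) (hΦnonneg : ∀ y, 0 ≤ Φ y)
    (hdom : ∀ t, 0 < t → ∃ c₂ > (0 : ℝ), ∀ y, subord σ h t x y ≤ c₂ * Φ y)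
    (f : EuclideanSpace ℝ (Fin d) → ℝ) (hfmeas : Measurable f)
    (hfint : MeasureTheory.Integrable (fun y => |f y| * Φ y))
    (hadm : MeasureTheory.IntegrableOn
      (fun s => |(∫ y, h s x y * f y) - f x| * s ^ (-(1 + σ))) (Set.Ioi (0 : ℝ))) :
    (∀ t ∈ Set.Ioi (0 : ℝ),
      DifferentiableAt ℝ (fun u => ∫ y, subord σ h u x y * f y) t) ∧
    Filter.Tendsto
      (fun t => -((2 : ℝ) ^ (2 * σ - 1) * Real.Gamma σ / Real.Gamma (1 - σ)) *
        t ^ (1 - 2 * σ) * deriv (fun u => ∫ y, subord σ h u x y * f y) t)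
      (nhdsWithin 0 (Set.Ioi 0))
      (nhds ((1 / (Real.Gamma (1 - σ) / (-σ))) *
        ∫ s in Set.Ioi (0 : ℝ), ((∫ y, h s x y * f y) - f x) * s ^ (-(1 + σ)))) := by
  obtain ⟨hσ0, hσ1⟩ := hσ
  have hΓ : 0 < Real.Gamma σ := Real.Gamma_pos_of_pos hσ0
  have hk : Measurable (Function.uncurry fun (s : ℝ) y => h s x y) :=
    hmeas.comp (by fun_prop : Measurable fun p : ℝ × EuclideanSpace ℝ (Fin d) => (p.1, x, p.2))
  have hk' : Measurable fun p : ℝ × EuclideanSpace ℝ (Fin d) => h p.1 x p.2 := hk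
  set g : ℝ → ℝ := fun s => ∫ y, h s x y * f y with hg
  have hgmeas : StronglyMeasurable g :=
    StronglyMeasurable.integral_prod_right (f := fun s y => h s x y * f y)
      (by fun_prop : Measurable fun p : ℝ × EuclideanSpace ℝ (Fin d) =>
        h p.1 x p.2 * f p.2).stronglyMeasurable
  have hw : IntegrableOn (fun s => (g s - f x) * s ^ (-(1 + σ))) (Ioi 0) := by
    have hm : Measurable fun s => (g s - f x) * s ^ (-(1 + σ)) := by
      have := hgmeas.measurable
      fun_prop
    refine hadm.mono' hm.aestronglyMeasurable ?_
    filter_upwards [ae_restrict_mem measurableSet_Ioi] with s hs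
    rw [norm_mul, Real.norm_of_nonneg (Real.rpow_nonneg (le_of_lt hs) _), Real.norm_eq_abs]
  refine subordination_differentiable_and_neumann_limit ⟨hσ0, hσ1⟩ (f x) hw fun t ht => ?_
  have hint : ∀ y, IntegrableOn
      (fun s => Real.exp (-t ^ 2 / (4 * s)) * h s x y * s ^ (-(1 + σ))) (Ioi 0) := by
    intro y
    have hb := (heatWeight_integrableOn ht (r := σ + d / 2) (by positivity)).const_mul C
    have hky : Measurable fun s => h s x y := hk'.comp (measurable_id.prodMk measurable_const)
    refine hb.mono' (by fun_prop : Measurable _).aestronglyMeasurable ?_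
    filter_upwards [ae_restrict_mem measurableSet_Ioi] with s hs
    have hs : 0 < s := hs
    have hp := (hpos s hs x y).le
    rw [Real.norm_of_nonneg (by positivity)]
    calc _ ≤ Real.exp (-t ^ 2 / (4 * s)) * (C * s ^ (-(d : ℝ) / 2)) * s ^ (-(1 + σ)) := by
          gcongr
          exact hbd s hs x y
      _ = C * (Real.exp (-t ^ 2 / (4 * s)) * (s ^ (-(d : ℝ) / 2) * s ^ (-(1 + σ)))) := by ring
      _ = _ := by
          rw [← Real.rpow_add hs]
          congr 3
          ring
  have hc : 0 < (t / 2) ^ (2 * σ) / Real.Gamma σ := by positivity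
  obtain ⟨c₂, -, hc₂⟩ := hdom t ht
  have hfi : Integrable (fun y => |f y| * ∫ s in Ioi (0 : ℝ),
      Real.exp (-t ^ 2 / (4 * s)) * h s x y * s ^ (-(1 + σ))) := by
    have hm : StronglyMeasurable fun y => ∫ s in Ioi (0 : ℝ),
        Real.exp (-t ^ 2 / (4 * s)) * h s x y * s ^ (-(1 + σ)) :=
      StronglyMeasurable.integral_prod_left
        (f := fun s y => Real.exp (-t ^ 2 / (4 * s)) * h s x y * s ^ (-(1 + σ)))
        (by fun_prop : Measurable fun p : ℝ × EuclideanSpace ℝ (Fin d) =>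
          Real.exp (-t ^ 2 / (4 * p.1)) * h p.1 x p.2 * p.1 ^ (-(1 + σ))).stronglyMeasurable
    refine (hfint.const_mul (((t / 2) ^ (2 * σ) / Real.Gamma σ)⁻¹ * c₂)).mono'
      ((hfmeas.abs.mul hm.measurable).aestronglyMeasurable) (Eventually.of_forall fun y => ?_)
    have hnn : 0 ≤ ∫ s in Ioi (0 : ℝ), Real.exp (-t ^ 2 / (4 * s)) * h s x y * s ^ (-(1 + σ)) :=
      setIntegral_nonneg measurableSet_Ioi fun s hs => by
        have hs : 0 < s := hs
        have := hpos s hs x y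
        positivity
    rw [Real.norm_of_nonneg (by positivity)]
    have h1 : ∫ s in Ioi (0 : ℝ), Real.exp (-t ^ 2 / (4 * s)) * h s x y * s ^ (-(1 + σ)) ≤
        ((t / 2) ^ (2 * σ) / Real.Gamma σ)⁻¹ * (c₂ * Φ y) := by
      rw [le_inv_mul_iff₀ hc]
      exact hc₂ y
    calc _ ≤ |f y| * (((t / 2) ^ (2 * σ) / Real.Gamma σ)⁻¹ * (c₂ * Φ y)) := by gcongr
      _ = _ := by ring
  have hF := integrable_prod_heatWeight hk hfmeas (fun s hs y => (hpos s hs x y).le) hint hfi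
  have hswap : ∫ y, subord σ h t x y * f y = (t / 2) ^ (2 * σ) / Real.Gamma σ *
      ∫ s in Ioi (0 : ℝ), Real.exp (-t ^ 2 / (4 * s)) * (g s * s ^ (-(1 + σ))) := by
    have h1 := integral_integral_swap (f := fun (s : ℝ) y =>
      Real.exp (-t ^ 2 / (4 * s)) * h s x y * s ^ (-(1 + σ)) * f y) hF
    have h2 : ∀ s, ∫ y, Real.exp (-t ^ 2 / (4 * s)) * h s x y * s ^ (-(1 + σ)) * f y =
        Real.exp (-t ^ 2 / (4 * s)) * (g s * s ^ (-(1 + σ))) := by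
      intro s
      rw [hg, ← integral_mul_const, ← integral_const_mul]
      congr 1 with y
      ring
    simp_rw [h2] at h1
    rw [h1, ← integral_const_mul]
    congr 1 with y
    rw [integral_mul_const, subord]
    ring
  rw [hswap]
  have hsplit : ∫ s in Ioi (0 : ℝ), Real.exp (-t ^ 2 / (4 * s)) * (g s * s ^ (-(1 + σ))) =
      (∫ s in Ioi (0 : ℝ), Real.exp (-t ^ 2 / (4 * s)) * ((g s - f x) * s ^ (-(1 + σ)))) +
      ∫ s in Ioi (0 : ℝ), f x * (Real.exp (-t ^ 2 / (4 * s)) * s ^ (-(1 + σ))) := by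
    rw [← integral_add (integrable_heatWeight_mul hw t)
      ((heatWeight_integrableOn ht hσ0).const_mul (f x))]
    congr 1 with s
    ring
  rw [hsplit, integral_const_mul]
  linear_combination f x * heatWeight_integral ht hσ0
end

section
/- Let d ≥ 1, σ ∈ (0,1), and let h : (0,∞) × ℝ^d × ℝ^d → ℝ be measurable and positive, with subordinated kernel p^σ_t(x,y) = ((t/2)^{2σ}/Γ(σ)) ∫₀^∞ e^{-t²/(4s)} h_s(x,y) s^{-(1+σ)} ds. Fix x ∈ ℝ^d and suppose there is a measurable Φ ≥ 0 and a constant c₂(1,x) > 0 with p^σ_1(x,y) ≤ c₂(1,x) Φ(y) for all y ∈ ℝ^d. Then: (i) for every A > 0 there exists c(x,A) > 0 such that ∫_A^∞ h_s(x,y) s^{-(1+σ)} ds ≤ c(x,A) Φ(y) for all y ∈ ℝ^d; and (ii) if moreover f is measurable with ∫_{ℝ^d} |f(y)| Φ(y) dy < ∞ and |f(x)| < ∞, then ∫_A^∞ | ∫_{ℝ^d} h_s(x,y) f(y) dy − f(x) | s^{-(1+σ)} ds < ∞. -/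
open MeasureTheory Set Filter
open RealInnerProductSpace

open scoped ENNReal

/-- The subordinated (Poisson) kernel obtained from a positive heat kernel `h` by the
subordination formula, as a Lebesgue (`ℝ≥0∞`-valued) integral. -/
noncomputable def subordLin {X : Type*} (σ : ℝ) (h : ℝ → X → X → ℝ) (t : ℝ) (x y : X) :
    ℝ≥0∞ :=
  ENNReal.ofReal ((t / 2) ^ (2 * σ) / Real.Gamma σ) *
    ∫⁻ s in Set.Ioi (0 : ℝ),
      ENNReal.ofReal (Real.exp (-t ^ 2 / (4 * s)) * h s x y * s ^ (-(1 + σ)))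

/-- A bound on the subordinated kernel at `y` controls the tail `∫_A^∞ h_s(x,y) s^{-(1+σ)} ds`. -/
theorem lintegral_tail_le_of_subordLin_le {X : Type*} {σ : ℝ} (hσ : 0 < σ)
    {h : ℝ → X → X → ℝ} (hnonneg : ∀ s, 0 < s → ∀ x y, 0 ≤ h s x y)
    {t : ℝ} (ht : 0 < t) {A : ℝ} (hA : 0 < A) {x y : X} {b : ℝ}
    (hb : subordLin σ h t x y ≤ ENNReal.ofReal b) :
    ∫⁻ s in Ioi A, ENNReal.ofReal (h s x y * s ^ (-(1 + σ))) ≤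
      ENNReal.ofReal
        (Real.exp (t ^ 2 / (4 * A)) * (b / ((t / 2) ^ (2 * σ) / Real.Gamma σ))) := by
  have hK : 0 < (t / 2) ^ (2 * σ) / Real.Gamma σ :=
    div_pos (Real.rpow_pos_of_pos (by positivity) _) (Real.Gamma_pos_of_pos hσ)
  have hsub : ∫⁻ s in Ioi (0 : ℝ),
      ENNReal.ofReal (Real.exp (-t ^ 2 / (4 * s)) * h s x y * s ^ (-(1 + σ))) ≤
      ENNReal.ofReal (b / ((t / 2) ^ (2 * σ) / Real.Gamma σ)) := by
    rw [ENNReal.ofReal_div_of_pos hK, ENNReal.le_div_iff_mul_le (Or.inl (by simpa using hK))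
      (Or.inl ENNReal.ofReal_ne_top), mul_comm]
    exact hb
  calc ∫⁻ s in Ioi A, ENNReal.ofReal (h s x y * s ^ (-(1 + σ)))
      ≤ ∫⁻ s in Ioi A, ENNReal.ofReal (Real.exp (t ^ 2 / (4 * A))) *
          ENNReal.ofReal (Real.exp (-t ^ 2 / (4 * s)) * h s x y * s ^ (-(1 + σ))) := by
        refine setLIntegral_mono' measurableSet_Ioi fun s hs => ?_
        have hs0 : 0 < s := hA.trans hs
        rw [← ENNReal.ofReal_mul (Real.exp_pos _).le]
        refine ENNReal.ofReal_le_ofReal ?_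
        have hexp : 1 ≤ Real.exp (t ^ 2 / (4 * A)) * Real.exp (-t ^ 2 / (4 * s)) := by
          rw [← Real.exp_add, Real.one_le_exp_iff, neg_div, ← sub_eq_add_neg, sub_nonneg]
          have := (mem_Ioi.1 hs).le
          gcongr
        have hw : 0 ≤ h s x y * s ^ (-(1 + σ)) :=
          mul_nonneg (hnonneg s hs0 x y) (Real.rpow_nonneg hs0.le _)
        nlinarith [mul_le_mul_of_nonneg_right hexp hw]
    _ = ENNReal.ofReal (Real.exp (t ^ 2 / (4 * A))) * ∫⁻ s in Ioi A,
          ENNReal.ofReal (Real.exp (-t ^ 2 / (4 * s)) * h s x y * s ^ (-(1 + σ))) :=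
        lintegral_const_mul' _ _ ENNReal.ofReal_ne_top
    _ ≤ ENNReal.ofReal (Real.exp (t ^ 2 / (4 * A))) *
          ENNReal.ofReal (b / ((t / 2) ^ (2 * σ) / Real.Gamma σ)) := by
        gcongr
        exact (lintegral_mono_set (Ioi_subset_Ioi hA.le)).trans hsub
    _ = _ := (ENNReal.ofReal_mul (Real.exp_pos _).le).symm

/-- If the weighted tails of a nonnegative kernel `k` are dominated by `c Φ` and `f Φ` is
integrable, then `s ↦ (∫ k_s(y) f(y) dy - a) s^{-(1+σ)}` is absolutely integrable on `(A, ∞)`. -/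
theorem integrableOn_tail_of_lintegral_le {X : Type*} [MeasurableSpace X] {μ : Measure X}
    [SFinite μ] {σ : ℝ} (hσ : 0 < σ) {k : ℝ → X → ℝ} (hk : Measurable k.uncurry)
    (hnonneg : ∀ s, 0 < s → ∀ y, 0 ≤ k s y) {Φ : X → ℝ} {A c : ℝ} (hA : 0 < A)
    (hle : ∀ y, ∫⁻ s in Ioi A, ENNReal.ofReal (k s y * s ^ (-(1 + σ))) ≤
      ENNReal.ofReal (c * Φ y))
    {f : X → ℝ} (hf : Measurable f) (hfΦ : Integrable (fun y => |f y| * Φ y) μ) (a : ℝ) :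
    IntegrableOn (fun s => |(∫ y, k s y * f y ∂μ) - a| * s ^ (-(1 + σ))) (Ioi A) := by
  have hF : Measurable (fun p : ℝ × X => k p.1 p.2 * f p.2 * p.1 ^ (-(1 + σ))) :=
    (hk.mul (hf.comp measurable_snd)).mul (measurable_fst.pow_const _)
  have hint : Integrable (fun p : ℝ × X => k p.1 p.2 * f p.2 * p.1 ^ (-(1 + σ)))
      ((volume.restrict (Ioi A)).prod μ) := by
    refine ⟨hF.aestronglyMeasurable, ?_⟩
    rw [hasFiniteIntegral_iff_enorm, lintegral_prod_symm' _ hF.enorm]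
    have hbound : ∀ y, ∫⁻ s in Ioi A, ‖k s y * f y * s ^ (-(1 + σ))‖ₑ ≤
        ENNReal.ofReal (c * (|f y| * Φ y)) := fun y => by
      calc ∫⁻ s in Ioi A, ‖k s y * f y * s ^ (-(1 + σ))‖ₑ
          = ∫⁻ s in Ioi A, ENNReal.ofReal |f y| *
              ENNReal.ofReal (k s y * s ^ (-(1 + σ))) := by
            refine setLIntegral_congr_fun measurableSet_Ioi fun s hs => ?_
            have hs0 : 0 < s := hA.trans hs
            rw [← ENNReal.ofReal_mul (abs_nonneg _), Real.enorm_eq_ofReal_abs, abs_mul, abs_mul,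
              abs_of_nonneg (hnonneg s hs0 y), abs_of_nonneg (Real.rpow_nonneg hs0.le _)]
            ring_nf
        _ = ENNReal.ofReal |f y| * ∫⁻ s in Ioi A, ENNReal.ofReal (k s y * s ^ (-(1 + σ))) :=
            lintegral_const_mul' _ _ ENNReal.ofReal_ne_top
        _ ≤ ENNReal.ofReal |f y| * ENNReal.ofReal (c * Φ y) := by gcongr; exact hle y
        _ = ENNReal.ofReal (c * (|f y| * Φ y)) := by
            rw [← ENNReal.ofReal_mul (abs_nonneg _)]
            ring_nf
    exact (lintegral_mono hbound).trans_lt (hfΦ.const_mul c).lintegral_lt_top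
  have hw : IntegrableOn (fun s : ℝ => s ^ (-(1 + σ))) (Ioi A) :=
    integrableOn_Ioi_rpow_of_lt (by linarith) hA
  refine ((hint.integral_prod_left.sub (hw.const_mul a)).abs).congr ?_
  filter_upwards [ae_restrict_mem measurableSet_Ioi] with s hs
  have hs0 : 0 < s := hA.trans hs
  rw [Pi.sub_apply, integral_mul_const, ← sub_mul, abs_mul,
    abs_of_nonneg (Real.rpow_nonneg hs0.le _)]

/-- Let `h` be a measurable positive kernel whose subordinated kernel
satisfies `p^σ_1(x,y) ≤ c₂(1,x) Φ(y)` for a nonnegative measurable `Φ`.  Then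
(i) for every `A > 0` there is `c(x,A) > 0` with
`∫_A^∞ h_s(x,y) s^{-(1+σ)} ds ≤ c(x,A) Φ(y)` for all `y`; and (ii) if `f ∈ L¹(Φ)`,
then `∫_A^∞ |e^{-sL}f(x) - f(x)| s^{-(1+σ)} ds < ∞`. -/
theorem tail_admissibility_from_poisson_bound
    (d : ℕ) (hd : 1 ≤ d) (σ : ℝ) (hσ : σ ∈ Set.Ioo (0 : ℝ) 1)
    (h : ℝ → EuclideanSpace ℝ (Fin d) → EuclideanSpace ℝ (Fin d) → ℝ)
    (hmeas : Measurable
      (fun p : ℝ × EuclideanSpace ℝ (Fin d) × EuclideanSpace ℝ (Fin d) => h p.1 p.2.1 p.2.2))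
    (hpos : ∀ s, 0 < s → ∀ x y, 0 < h s x y)
    (x : EuclideanSpace ℝ (Fin d))
    (Φ : EuclideanSpace ℝ (Fin d) → ℝ) (hΦmeas : Measurable Φ) (hΦnonneg : ∀ y, 0 ≤ Φ y)
    (c₂ : ℝ) (hc₂ : 0 < c₂)
    (hdom : ∀ y, subordLin σ h 1 x y ≤ ENNReal.ofReal (c₂ * Φ y)) :
    (∀ A > (0 : ℝ), ∃ c > (0 : ℝ), ∀ y,
      ∫⁻ s in Set.Ioi A, ENNReal.ofReal (h s x y * s ^ (-(1 + σ)))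
        ≤ ENNReal.ofReal (c * Φ y)) ∧
    (∀ (f : EuclideanSpace ℝ (Fin d) → ℝ), Measurable f →
      MeasureTheory.Integrable (fun y => |f y| * Φ y) →
      ∀ A > (0 : ℝ),
        MeasureTheory.IntegrableOn
          (fun s => |(∫ y, h s x y * f y) - f x| * s ^ (-(1 + σ))) (Set.Ioi A)) := by
  have htail : ∀ A > (0 : ℝ), ∃ c > (0 : ℝ), ∀ y,
      ∫⁻ s in Set.Ioi A, ENNReal.ofReal (h s x y * s ^ (-(1 + σ)))
        ≤ ENNReal.ofReal (c * Φ y) := fun A hA => by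
    have hΓ := Real.Gamma_pos_of_pos hσ.1
    refine ⟨Real.exp (1 ^ 2 / (4 * A)) * (c₂ / ((1 / 2) ^ (2 * σ) / Real.Gamma σ)),
      by positivity, fun y => ?_⟩
    convert lintegral_tail_le_of_subordLin_le hσ.1 (fun s hs x y => (hpos s hs x y).le)
      one_pos hA (hdom y) using 2
    ring
  refine ⟨htail, fun f hf hfΦ A hA => ?_⟩
  obtain ⟨c, hc, hle⟩ := htail A hA
  exact integrableOn_tail_of_lintegral_le (k := fun s => h s x) hσ.1
    (hmeas.comp (measurable_fst.prodMk (measurable_const.prodMk measurable_snd)))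
    (fun s hs y => (hpos s hs x y).le) hA hle hf hfΦ (f x)
end

section
/- Let d ≥ 1, σ ∈ (0,1), x₀ ∈ ℝ^d, δ > 0, A ∈ (0,∞], and let h : (0,A) × ℝ^d → [0,∞) be a measurable kernel (s,y) ↦ h_s(x₀,y) satisfying: (i) ∫₀^A h_s(x₀, x₀+y) s^{-(1+σ)} ds ≤ c(x₀)/|y|^{d+2σ} for all 0 < |y| ≤ δ, and (ii) ∫₀^A | h_s(x₀, x₀+y) − h_s(x₀, x₀−y) | s^{-(1+σ)} ds ≤ c(x₀)/|y|^{max(d+2σ−3,0)} for all 0 < |y| ≤ δ. Then for every locally integrable f : ℝ^d → ℝ that is strictly 2σ-smooth at x₀ (with the same δ), the local admissibility integrals ℐ_δ f(x₀,s) = ∫_{|x₀−y|<δ} h_s(x₀,y) ( f(y) − f(x₀) ) dy satisfy ∫₀^A | ℐ_δ f(x₀,s) | s^{-(1+σ)} ds < ∞. -/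
open MeasureTheory Set Filter
open RealInnerProductSpace

open scoped ENNReal

theorem isNegInvariant_restrict {E : Type*} [MeasurableSpace E] [InvolutiveNeg E]
    [MeasurableNeg E] (μ : Measure E) [μ.IsNegInvariant] {B : Set E}
    (hB : (fun z : E => -z) ⁻¹' B = B) : (μ.restrict B).IsNegInvariant := by
  refine ⟨?_⟩
  have key := (Measure.measurePreserving_neg μ).restrict_preimage_emb
    (MeasurableEquiv.neg E).measurableEmbedding B
  have hB' : (Neg.neg : E → E) ⁻¹' B = B := hB
  rw [hB'] at key
  exact key.map_eq

/-- The integral against a symmetric measure is controlled by the even part of the integrand,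
whether or not the integrand is integrable. -/
theorem enorm_integral_le_lintegral_enorm_add_neg {E : Type*} [MeasurableSpace E]
    [AddGroup E] [MeasurableNeg E] (μ : Measure E) [μ.IsNegInvariant] (G : E → ℝ) :
    ‖∫ z, G z ∂μ‖ₑ ≤ ∫⁻ z, ‖G z + G (-z)‖ₑ ∂μ := by
  by_cases hG : Integrable G μ
  · have h2 : ∫ z, (G z + G (-z)) ∂μ = 2 * ∫ z, G z ∂μ := by
      rw [integral_add hG hG.comp_neg, integral_neg_eq_self]
      ring
    calc ‖∫ z, G z ∂μ‖ₑ ≤ ‖∫ z, (G z + G (-z)) ∂μ‖ₑ := by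
          rw [h2, Real.enorm_eq_ofReal_abs, Real.enorm_eq_ofReal_abs, abs_mul]
          refine ENNReal.ofReal_le_ofReal ?_
          norm_num
          linarith [abs_nonneg (∫ z, G z ∂μ)]
      _ ≤ _ := enorm_integral_le_lintegral_enorm _
  · simp [integral_undef hG]

theorem abs_mul_add_mul_le {a b u v : ℝ} (ha : 0 ≤ a) (hb : 0 ≤ b) :
    |a * u + b * v| ≤ |u + v| * (a + b) + |u - v| * |a - b| := by
  have e : a * u + b * v = ((u + v) * (a + b) + (u - v) * (a - b)) / 2 := by ring
  have h1 := abs_add_le ((u + v) * (a + b)) ((u - v) * (a - b))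
  rw [abs_mul, abs_mul, abs_of_nonneg (add_nonneg ha hb)] at h1
  rw [e, abs_div, abs_two]
  have h0 := abs_nonneg ((u + v) * (a + b) + (u - v) * (a - b))
  linarith

theorem aemeasurable_ofReal_mul_prod {α β : Type*} [MeasurableSpace α] [MeasurableSpace β]
    {μ : Measure α} {ν : Measure β} [SFinite μ] [SFinite ν] {φ : β → ℝ} {k : α → β → ℝ}
    (hφ : AEMeasurable φ ν) (hk : Measurable (Function.uncurry k)) :
    AEMeasurable (Function.uncurry fun s z =>
      ENNReal.ofReal (φ z) * ENNReal.ofReal (k s z)) (μ.prod ν) :=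
  (hφ.comp_snd).ennreal_ofReal.mul hk.ennreal_ofReal.aemeasurable

/-- Tonelli: a kernel whose `s`-integral is dominated by `c / w z` pairs finitely with any `φ`
for which `φ / w` is integrable. -/
theorem lintegral_lintegral_ofReal_mul_lt_top {α β : Type*} [MeasurableSpace α]
    [MeasurableSpace β] {μ : Measure α} {ν : Measure β} [SFinite μ] [SFinite ν]
    {φ w : β → ℝ} {k : α → β → ℝ} {c : ℝ} (hφ : AEMeasurable φ ν) (hφ0 : ∀ z, 0 ≤ φ z)
    (hk : Measurable (Function.uncurry k))
    (hint : Integrable (fun z => φ z / w z) ν)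
    (hle : ∀ᵐ z ∂ν, ∫⁻ s, ENNReal.ofReal (k s z) ∂μ ≤ ENNReal.ofReal (c / w z)) :
    ∫⁻ s, ∫⁻ z, ENNReal.ofReal (φ z) * ENNReal.ofReal (k s z) ∂ν ∂μ < ⊤ := by
  rw [lintegral_lintegral_swap (aemeasurable_ofReal_mul_prod hφ hk)]
  refine lt_of_le_of_lt ?_ (hint.const_mul c).lintegral_lt_top
  refine lintegral_mono_ae ?_
  filter_upwards [hle] with z hz
  rw [lintegral_const_mul' _ _ ENNReal.ofReal_ne_top]
  calc ENNReal.ofReal (φ z) * ∫⁻ s, ENNReal.ofReal (k s z) ∂μ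
      ≤ ENNReal.ofReal (φ z) * ENNReal.ofReal (c / w z) := by gcongr
    _ = ENNReal.ofReal (c * (φ z / w z)) := by
      rw [← ENNReal.ofReal_mul (hφ0 z)]
      congr 1
      ring

theorem lintegral_lintegral_add_lt_top {α β : Type*} [MeasurableSpace α]
    [MeasurableSpace β] {μ : Measure α} {ν : Measure β} [SFinite ν] {u v : α → β → ℝ≥0∞}
    (hu : AEMeasurable (Function.uncurry u) (μ.prod ν))
    (hu_lt : ∫⁻ s, ∫⁻ z, u s z ∂ν ∂μ < ⊤) (hv_lt : ∫⁻ s, ∫⁻ z, v s z ∂ν ∂μ < ⊤) :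
    ∫⁻ s, ∫⁻ z, (u s z + v s z) ∂ν ∂μ < ⊤ := by
  have hsplit : ∀ᵐ s ∂μ, ∫⁻ z, (u s z + v s z) ∂ν = ∫⁻ z, u s z ∂ν + ∫⁻ z, v s z ∂ν := by
    filter_upwards [hu.aestronglyMeasurable.prodMk_left] with s hs
    exact lintegral_add_left' hs.aemeasurable _
  rw [lintegral_congr_ae hsplit, lintegral_add_left' hu.lintegral_prod_right]
  exact ENNReal.add_lt_top.2 ⟨hu_lt, hv_lt⟩

/-- (Proposition on local admissibility.)  Let `σ ∈ (0,1)`, `x₀ ∈ ℝ^d`,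
`δ > 0` and `A ∈ (0,∞]`.  Suppose the nonnegative measurable kernel `(s,y) ↦ h_s(x₀,y)`
satisfies the size estimate
`∫₀^A h_s(x₀,x₀+y) s^{-(1+σ)} ds ≤ c(x₀)/|y|^{d+2σ}` and the smoothness estimate
`∫₀^A |h_s(x₀,x₀+y) - h_s(x₀,x₀-y)| s^{-(1+σ)} ds ≤ c(x₀)/|y|^{max(d+2σ-3,0)}` for
`0 < |y| ≤ δ`.  Then for every locally integrable `f` that is strictly `2σ`-smooth at
`x₀` with the same `δ`, the local admissibility integrals
`ℐ_δ f(x₀,s) = ∫_{|x₀-y|<δ} h_s(x₀,y)(f(y)-f(x₀)) dy` satisfy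
`∫₀^A |ℐ_δ f(x₀,s)| s^{-(1+σ)} ds < ∞`. -/
theorem local_admissibility_of_strict_smoothness
    (d : ℕ) (hd : 1 ≤ d) (σ : ℝ) (hσ : σ ∈ Set.Ioo (0 : ℝ) 1)
    (x₀ : EuclideanSpace ℝ (Fin d)) (δ : ℝ) (hδ : 0 < δ)
    (A : ℝ≥0∞) (hA : 0 < A)
    (h : ℝ → EuclideanSpace ℝ (Fin d) → ℝ)
    (hmeas : Measurable (Function.uncurry h))
    (hpos : ∀ s y, 0 ≤ h s y)
    (c : ℝ)
    (hsize : ∀ y : EuclideanSpace ℝ (Fin d), 0 < ‖y‖ → ‖y‖ ≤ δ →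
      ∫⁻ s in {s : ℝ | 0 < s ∧ ENNReal.ofReal s < A},
          ENNReal.ofReal (h s (x₀ + y) * s ^ (-(1 + σ)))
        ≤ ENNReal.ofReal (c / ‖y‖ ^ ((d : ℝ) + 2 * σ)))
    (hsmoothker : ∀ y : EuclideanSpace ℝ (Fin d), 0 < ‖y‖ → ‖y‖ ≤ δ →
      ∫⁻ s in {s : ℝ | 0 < s ∧ ENNReal.ofReal s < A},
          ENNReal.ofReal (|h s (x₀ + y) - h s (x₀ - y)| * s ^ (-(1 + σ)))
        ≤ ENNReal.ofReal (c / ‖y‖ ^ max ((d : ℝ) + 2 * σ - 3) 0))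
    (f : EuclideanSpace ℝ (Fin d) → ℝ)
    (hfloc : MeasureTheory.LocallyIntegrable f)
    (hf2 : MeasureTheory.IntegrableOn
      (fun z => |f (x₀ + z) + f (x₀ - z) - 2 * f x₀| / ‖z‖ ^ ((d : ℝ) + 2 * σ))
      {z : EuclideanSpace ℝ (Fin d) | ‖z‖ ≤ δ})
    (hf1 : MeasureTheory.IntegrableOn
      (fun z => |f (x₀ + z) - f (x₀ - z)| / ‖z‖ ^ max ((d : ℝ) + 2 * σ - 3) 0)
      {z : EuclideanSpace ℝ (Fin d) | ‖z‖ ≤ δ}) :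
    MeasureTheory.IntegrableOn
      (fun s =>
        |∫ y in {y : EuclideanSpace ℝ (Fin d) | ‖x₀ - y‖ < δ}, h s y * (f y - f x₀)|
          * s ^ (-(1 + σ)))
      {s : ℝ | 0 < s ∧ ENNReal.ofReal s < A} := by
  have : Nonempty (Fin d) := ⟨⟨0, hd⟩⟩
  set S : Set ℝ := {s : ℝ | 0 < s ∧ ENNReal.ofReal s < A} with hS
  have hSm : MeasurableSet S :=
    (measurableSet_lt measurable_const measurable_id).inter
      (measurableSet_lt ENNReal.measurable_ofReal measurable_const)
  set B : Set (EuclideanSpace ℝ (Fin d)) := {z | ‖z‖ < δ} with hB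
  have hBm : MeasurableSet B := measurableSet_lt measurable_norm measurable_const
  have hBle : B ⊆ {z | ‖z‖ ≤ δ} := fun z (hz : ‖z‖ < δ) => hz.le
  set ν : Measure (EuclideanSpace ℝ (Fin d)) := volume.restrict B with hν
  have hνneg : ν.IsNegInvariant := isNegInvariant_restrict volume (by ext z; simp [hB])
  have hball : ∀ᵐ z ∂ν, 0 < ‖z‖ ∧ ‖z‖ ≤ δ := by
    have h0 : ∀ᵐ z ∂ν, z ≠ 0 := ae_restrict_of_ae (Measure.ae_ne volume 0)
    filter_upwards [h0, ae_restrict_mem hBm] with z hz hzB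
    exact ⟨norm_pos_iff.2 hz, hBle hzB⟩
  have hfm : AEMeasurable f := hfloc.aestronglyMeasurable.aemeasurable
  have hfp : AEMeasurable (fun z => f (x₀ + z)) ν :=
    (hfm.comp_quasiMeasurePreserving
      (measurePreserving_add_left volume x₀).quasiMeasurePreserving).restrict
  have hfn : AEMeasurable (fun z => f (x₀ - z)) ν :=
    (hfm.comp_quasiMeasurePreserving
      (quasiMeasurePreserving_sub_left volume x₀)).restrict
  have hwm : Measurable fun s : ℝ => s ^ (-(1 + σ)) := measurable_id.pow_const _
  have hkp : Measurable (Function.uncurry fun s z => h s (x₀ + z) * s ^ (-(1 + σ))) :=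
    (hmeas.comp (measurable_fst.prodMk (measurable_snd.const_add x₀))).mul
      (hwm.comp measurable_fst)
  have hkn : Measurable (Function.uncurry fun s z => h s (x₀ - z) * s ^ (-(1 + σ))) :=
    (hmeas.comp (measurable_fst.prodMk (measurable_snd.const_sub x₀))).mul
      (hwm.comp measurable_fst)
  have hkd : Measurable
      (Function.uncurry fun s z => |h s (x₀ + z) - h s (x₀ - z)| * s ^ (-(1 + σ))) :=
    ((hmeas.comp (measurable_fst.prodMk (measurable_snd.const_add x₀))).sub
      (hmeas.comp (measurable_fst.prodMk (measurable_snd.const_sub x₀)))).abs.mul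
      (hwm.comp measurable_fst)
  have hP : AEMeasurable (fun z => |f (x₀ + z) + f (x₀ - z) - 2 * f x₀|) ν := by
    simpa only [Real.norm_eq_abs, Pi.add_apply] using ((hfp.add hfn).sub_const (2 * f x₀)).norm
  have hM : AEMeasurable (fun z => |f (x₀ + z) - f (x₀ - z)|) ν := by
    simpa only [Real.norm_eq_abs, Pi.sub_apply] using (hfp.sub hfn).norm
  have T1 := lintegral_lintegral_ofReal_mul_lt_top (μ := volume.restrict S) hP
    (fun _ => abs_nonneg _) hkp (hf2.mono_set hBle)
    (by filter_upwards [hball] with z hz using hsize z hz.1 hz.2)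
  have T2 := lintegral_lintegral_ofReal_mul_lt_top (μ := volume.restrict S) hP
    (fun _ => abs_nonneg _) hkn (hf2.mono_set hBle)
    (by
      filter_upwards [hball] with z hz
      simpa only [norm_neg, ← sub_eq_add_neg] using
        hsize (-z) (by simpa using hz.1) (by simpa using hz.2))
  have T3 := lintegral_lintegral_ofReal_mul_lt_top (μ := volume.restrict S) hM
    (fun _ => abs_nonneg _) hkd (hf1.mono_set hBle)
    (by filter_upwards [hball] with z hz using hsmoothker z hz.1 hz.2)
  have M1 := aemeasurable_ofReal_mul_prod (μ := volume.restrict S) hP hkp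
  have M2 := aemeasurable_ofReal_mul_prod (μ := volume.restrict S) hP hkn
  have htrans : ∀ s, ∫ y in {y : EuclideanSpace ℝ (Fin d) | ‖x₀ - y‖ < δ},
      h s y * (f y - f x₀) = ∫ z, h s (x₀ + z) * (f (x₀ + z) - f x₀) ∂ν := by
    intro s
    rw [← (measurePreserving_add_left volume x₀).setIntegral_preimage_emb
      (measurableEmbedding_addLeft x₀)]
    simp [hν, hB]
  refine ⟨?_, ?_⟩
  · refine AEStronglyMeasurable.mul ?_ hwm.aestronglyMeasurable
    refine continuous_abs.comp_aestronglyMeasurable ?_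
    refine AEStronglyMeasurable.integral_prod_right'
      (f := fun p : ℝ × EuclideanSpace ℝ (Fin d) => h p.1 p.2 * (f p.2 - f x₀)) ?_
    exact (hmeas.aemeasurable.mul
      ((hfm.restrict.sub_const (f x₀)).comp_snd)).aestronglyMeasurable
  · have hpt : ∀ s ∈ S,
        ‖|∫ y in {y : EuclideanSpace ℝ (Fin d) | ‖x₀ - y‖ < δ}, h s y * (f y - f x₀)|
          * s ^ (-(1 + σ))‖ₑ ≤
        ∫⁻ z, (ENNReal.ofReal |f (x₀ + z) + f (x₀ - z) - 2 * f x₀|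
                * ENNReal.ofReal (h s (x₀ + z) * s ^ (-(1 + σ)))
            + ENNReal.ofReal |f (x₀ + z) + f (x₀ - z) - 2 * f x₀|
                * ENNReal.ofReal (h s (x₀ - z) * s ^ (-(1 + σ)))
            + ENNReal.ofReal |f (x₀ + z) - f (x₀ - z)|
                * ENNReal.ofReal (|h s (x₀ + z) - h s (x₀ - z)| * s ^ (-(1 + σ)))) ∂ν := by
      intro s hs
      have hw : 0 ≤ s ^ (-(1 + σ)) := Real.rpow_nonneg hs.1.le _
      rw [htrans s, enorm_mul, Real.enorm_abs]
      refine (mul_le_mul_left (enorm_integral_le_lintegral_enorm_add_neg ν _) _).trans ?_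
      rw [← lintegral_mul_const' _ _ enorm_ne_top]
      refine lintegral_mono fun z => ?_
      have hp := hpos s (x₀ + z)
      have hn := hpos s (x₀ - z)
      have key := abs_mul_add_mul_le (u := f (x₀ + z) - f x₀) (v := f (x₀ - z) - f x₀) hp hn
      have e1 : f (x₀ + z) - f x₀ + (f (x₀ - z) - f x₀)
          = f (x₀ + z) + f (x₀ - z) - 2 * f x₀ := by ring
      have e2 : f (x₀ + z) - f x₀ - (f (x₀ - z) - f x₀) = f (x₀ + z) - f (x₀ - z) := by ring
      rw [e1, e2] at key
      rw [← sub_eq_add_neg, Real.enorm_eq_ofReal_abs, Real.enorm_eq_ofReal hw,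
        ← ENNReal.ofReal_mul (abs_nonneg _), ← ENNReal.ofReal_mul (abs_nonneg _),
        ← ENNReal.ofReal_mul (abs_nonneg _), ← ENNReal.ofReal_mul (abs_nonneg _),
        ← ENNReal.ofReal_add (by positivity) (by positivity),
        ← ENNReal.ofReal_add (by positivity) (by positivity)]
      refine ENNReal.ofReal_le_ofReal ((mul_le_mul_of_nonneg_right key hw).trans_eq ?_)
      ring
    refine (setLIntegral_mono' hSm hpt).trans_lt ?_
    exact lintegral_lintegral_add_lt_top (M1.add M2) (lintegral_lintegral_add_lt_top M1 T1 T2) T3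
end

section
/- Let d ≥ 1, m ≥ -d, σ ∈ (0,1), and let h_t be the Mehler heat kernel of L = -Δ + |x|² + m, with subordinated kernel p^σ_t(x,y) = ((t/2)^{2σ}/Γ(σ)) ∫₀^∞ e^{-t²/(4s)} h_s(x,y) s^{-(1+σ)} ds. Then for every t > 0 and x ∈ ℝ^d there exist finite constants c₁(t,x) > 0 and c₂(t,x) > 0 such that c₁(t,x) Φ_σ(y) ≤ p^σ_t(x,y) ≤ c₂(t,x) Φ_σ(y) for all y ∈ ℝ^d. -/
open MeasureTheory Set Filter
open RealInnerProductSpace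

/-- The Mehler heat kernel of the Hermite-type operator `L = -Δ + |x|² + m` on `ℝ^d`. -/
noncomputable def mehler (d : ℕ) (m : ℝ) (t : ℝ)
    (x y : EuclideanSpace ℝ (Fin d)) : ℝ :=
  Real.exp (-t * m) * (2 * Real.pi * Real.sinh (2 * t)) ^ (-(d : ℝ) / 2) *
    Real.exp (-‖x - y‖ ^ 2 / (2 * Real.tanh (2 * t)) - Real.tanh t * ⟪x, y⟫)

/-- The weight `Φ_σ` associated with `L = -Δ + |x|² + m`. -/
noncomputable def PhiSigma (d : ℕ) (m σ : ℝ) (y : EuclideanSpace ℝ (Fin d)) : ℝ :=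
  if m = -(d : ℝ) then
    Real.exp (-‖y‖ ^ 2 / 2) / Real.log (Real.exp 1 + ‖y‖) ^ σ
  else
    Real.exp (-‖y‖ ^ 2 / 2) /
      ((1 + ‖y‖) ^ (((d : ℝ) + m) / 2) * Real.log (Real.exp 1 + ‖y‖) ^ (1 + σ))

/-- The subordinated (Poisson) kernel of the Hermite-type operator. -/
noncomputable def hermitePoisson (d : ℕ) (m σ : ℝ) (t : ℝ)
    (x y : EuclideanSpace ℝ (Fin d)) : ℝ :=
  ((t / 2) ^ (2 * σ) / Real.Gamma σ) *
    ∫ s in Set.Ioi (0 : ℝ), Real.exp (-t ^ 2 / (4 * s)) * mehler d m s x y * s ^ (-(1 + σ))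

lemma exists_one_add_pow_le_exp (k : ℝ) (hk : 0 < k) (N : ℕ) :
    ∃ C > (0 : ℝ), ∀ z : ℝ, 0 ≤ z → (1 + z) ^ N ≤ C * Real.exp (k * z) := by
  refine ⟨N.factorial / k ^ N * Real.exp k, by positivity, fun z hz => ?_⟩
  have h := Real.pow_div_factorial_le_exp (k * (1 + z)) (by positivity) N
  rw [div_le_iff₀ (by positivity), mul_pow] at h
  have e : Real.exp (k * (1 + z)) = Real.exp k * Real.exp (k * z) := by
    rw [← Real.exp_add]; ring_nf
  rw [e] at h
  have : (1 + z) ^ N = k ^ N * (1 + z) ^ N / k ^ N := by field_simp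
  rw [this, div_le_iff₀ (by positivity)]
  refine h.trans (le_of_eq ?_)
  field_simp

lemma exists_one_add_pow_mul_exp_sub_exp_le (l : ℝ) (N : ℕ) :
    ∃ C > (0 : ℝ), ∀ w : ℝ, 0 ≤ w →
      (1 + w) ^ N * Real.exp (l * w - Real.exp (4 * w) / 4) ≤ C := by
  obtain ⟨C, hC, h⟩ := exists_one_add_pow_le_exp 1 one_pos N
  refine ⟨C * Real.exp ((l + 1) ^ 2 / 8), by positivity, fun w hw => ?_⟩
  have h2 := Real.quadratic_le_exp_of_nonneg (x := 4 * w) (by positivity)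
  calc (1 + w) ^ N * Real.exp (l * w - Real.exp (4 * w) / 4)
      ≤ C * Real.exp (1 * w) * Real.exp (l * w - Real.exp (4 * w) / 4) := by
        gcongr; exact h w hw
    _ = C * Real.exp (1 * w + (l * w - Real.exp (4 * w) / 4)) := by
        rw [mul_assoc, ← Real.exp_add]
    _ ≤ _ := by
        gcongr
        nlinarith [sq_nonneg (4 * w - (l + 1))]

lemma mehler_eq_of_pos (d : ℕ) (m : ℝ) {s : ℝ} (hs : 0 < s) (x y : EuclideanSpace ℝ (Fin d)) :
    mehler d m s x y =
      Real.pi ^ (-(d : ℝ) / 2) * Real.exp (‖x‖ ^ 2 / 2) * Real.exp (-‖y‖ ^ 2 / 2) *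
        (Real.exp (-(d + m) * s) * (1 - Real.exp (-4 * s)) ^ (-(d : ℝ) / 2) *
          Real.exp (-‖x - Real.exp (-2 * s) • y‖ ^ 2 / (1 - Real.exp (-4 * s)))) := by
  have hq : 0 < 1 - Real.exp (-4 * s) := by
    rw [sub_pos, Real.exp_lt_one_iff]; linarith
  set u := Real.exp (-2 * s) with hu
  have hu0 : 0 < u := Real.exp_pos _
  have h4 : Real.exp (-4 * s) = u ^ 2 := by
    rw [hu, ← Real.exp_nat_mul]; ring_nf
  have hu2 : Real.exp (2 * s) = u⁻¹ := by
    rw [hu, ← Real.exp_neg]; ring_nf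
  have hu2' : Real.exp (-(2 * s)) = u := by rw [hu]; ring_nf
  have hu1 : u < 1 := by rw [hu, Real.exp_lt_one_iff]; linarith
  rw [h4] at hq ⊢
  have hsinh : 2 * Real.pi * Real.sinh (2 * s) = Real.pi * Real.exp (2 * s) * (1 - u ^ 2) := by
    rw [Real.sinh_eq, hu2', hu2]; field_simp
  have htanh2 : Real.tanh (2 * s) = (1 - u ^ 2) / (1 + u ^ 2) := by
    rw [Real.tanh_eq_sinh_div_cosh, Real.sinh_eq, Real.cosh_eq, hu2', hu2]; field_simp
  have htanh : Real.tanh s = (1 - u) / (1 + u) := by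
    have hv : u = Real.exp (-s) ^ 2 := by
      rw [hu, ← Real.exp_nat_mul]; ring_nf
    have hv' : Real.exp s = (Real.exp (-s))⁻¹ := by rw [← Real.exp_neg]; ring_nf
    rw [Real.tanh_eq_sinh_div_cosh, Real.sinh_eq, Real.cosh_eq, hv', hv]
    have := Real.exp_pos (-s)
    field_simp
  have hexp : -‖x - y‖ ^ 2 / (2 * Real.tanh (2 * s)) - Real.tanh s * ⟪x, y⟫ =
      ‖x‖ ^ 2 / 2 + -‖y‖ ^ 2 / 2 + -‖x - u • y‖ ^ 2 / (1 - u ^ 2) := by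
    rw [htanh, htanh2, norm_sub_sq_real, norm_sub_sq_real, norm_smul, inner_smul_right,
      Real.norm_of_nonneg hu0.le]
    have : (1 - u ^ 2) = (1 - u) * (1 + u) := by ring
    have h1 : 0 < 1 - u := by linarith
    rw [this]
    field_simp
    ring
  unfold mehler
  rw [hexp, hsinh, Real.mul_rpow (by positivity) hq.le,
    Real.mul_rpow (by positivity) (by positivity),
    ← Real.exp_mul, Real.exp_add, Real.exp_add]
  have : Real.exp (-(d + m) * s) = Real.exp (-s * m) * Real.exp (2 * s * (-(d : ℝ) / 2)) := by
    rw [← Real.exp_add]; ring_nf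
  rw [this]; ring

lemma exists_subordination_weight_le (d : ℕ) {σ t : ℝ} (hσ : σ ∈ Set.Ioo (0 : ℝ) 1) (ht : 0 < t) :
    ∃ C > (0 : ℝ), ∀ s : ℝ, 0 < s →
      Real.exp (-t ^ 2 / (4 * s)) * (1 - Real.exp (-4 * s)) ^ (-(d : ℝ) / 2) * s ^ (-(1 + σ)) ≤
        C * (1 + s) ^ (-(1 + σ)) := by
  obtain ⟨C, hC, h⟩ := exists_one_add_pow_le_exp (t ^ 2 / 4) (by positivity) (d + 2)
  refine ⟨C, hC, fun s hs => ?_⟩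
  have h1 : 1 ≤ 1 + 1 / s := by
    have : 0 < 1 / s := by positivity
    linarith
  have hb : (1 + 1 / s)⁻¹ ≤ 1 - Real.exp (-4 * s) := by
    have e1 : Real.exp (-4 * s) ≤ (1 + s)⁻¹ := by
      rw [show -4 * s = -(4 * s) by ring, Real.exp_neg]
      apply inv_anti₀ (by positivity)
      linarith [Real.add_one_le_exp (4 * s)]
    have e2 : (1 + 1 / s)⁻¹ = 1 - (1 + s)⁻¹ := by field_simp; ring
    linarith
  have hA : (1 - Real.exp (-4 * s)) ^ (-(d : ℝ) / 2) ≤ (1 + 1 / s) ^ d := by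
    calc (1 - Real.exp (-4 * s)) ^ (-(d : ℝ) / 2) ≤ ((1 + 1 / s)⁻¹) ^ (-(d : ℝ) / 2) := by
          apply Real.rpow_le_rpow_of_nonpos (by positivity) hb
          have : (0 : ℝ) ≤ d := Nat.cast_nonneg d
          linarith
      _ = (1 + 1 / s) ^ ((d : ℝ) / 2) := by
          rw [Real.inv_rpow (by positivity), ← Real.rpow_neg (by positivity)]; ring_nf
      _ ≤ (1 + 1 / s) ^ (d : ℝ) := by
          apply Real.rpow_le_rpow_of_exponent_le h1
          have : (0 : ℝ) ≤ d := Nat.cast_nonneg d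
          linarith
      _ = _ := Real.rpow_natCast _ _
  have hB : s ^ (-(1 + σ)) ≤ (1 + 1 / s) ^ 2 * (1 + s) ^ (-(1 + σ)) := by
    have e : s = (1 + s) * (1 + 1 / s)⁻¹ := by field_simp; ring
    calc s ^ (-(1 + σ)) = (1 + s) ^ (-(1 + σ)) * (1 + 1 / s) ^ (1 + σ) := by
          conv_lhs => rw [e]
          rw [Real.mul_rpow (by positivity) (by positivity), Real.inv_rpow (by positivity),
            Real.rpow_neg (x := 1 + 1 / s) (by positivity), inv_inv]
      _ ≤ (1 + s) ^ (-(1 + σ)) * (1 + 1 / s) ^ (2 : ℝ) := by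
          gcongr
          linarith [hσ.2]
      _ = _ := by rw [Real.rpow_two, mul_comm]
  have hE : Real.exp (-t ^ 2 / (4 * s)) * (1 + 1 / s) ^ (d + 2) ≤ C := by
    have := h (1 / s) (by positivity)
    have e : -t ^ 2 / (4 * s) = -(t ^ 2 / 4 * (1 / s)) := by field_simp
    rw [e, Real.exp_neg, inv_mul_le_iff₀ (by positivity), mul_comm _ C]
    exact this
  calc _ ≤ Real.exp (-t ^ 2 / (4 * s)) * (1 + 1 / s) ^ d *
          ((1 + 1 / s) ^ 2 * (1 + s) ^ (-(1 + σ))) := by gcongr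
    _ = Real.exp (-t ^ 2 / (4 * s)) * (1 + 1 / s) ^ (d + 2) * (1 + s) ^ (-(1 + σ)) := by ring
    _ ≤ _ := by gcongr

lemma exp_neg_norm_sub_smul_sq_le {E : Type*} [NormedAddCommGroup E] [InnerProductSpace ℝ E]
    {s : ℝ} (hs : 0 < s) (x y : E) :
    Real.exp (-‖x - Real.exp (-2 * s) • y‖ ^ 2 / (1 - Real.exp (-4 * s))) ≤
      Real.exp (‖x‖ ^ 2 + 1 / 2) *
        Real.exp (-(Real.exp (4 * (Real.log (1 + ‖y‖) / 2 - s)) / 4)) := by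
  have hq : 0 < 1 - Real.exp (-4 * s) := by
    rw [sub_pos, Real.exp_lt_one_iff]; linarith
  have hq1 : 1 - Real.exp (-4 * s) ≤ 1 := by linarith [Real.exp_pos (-4 * s)]
  have hq0 : Real.exp (-4 * s) ≤ 1 := by linarith
  have hL : Real.exp (4 * (Real.log (1 + ‖y‖) / 2 - s)) = (1 + ‖y‖) ^ 2 * Real.exp (-4 * s) := by
    rw [show 4 * (Real.log (1 + ‖y‖) / 2 - s) = (2 : ℕ) * Real.log (1 + ‖y‖) + -4 * s by
      push_cast; ring, Real.exp_add, Real.exp_nat_mul, Real.exp_log (by positivity)]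
  have h4 : Real.exp (-4 * s) = Real.exp (-2 * s) ^ 2 := by
    rw [← Real.exp_nat_mul]; ring_nf
  rw [← Real.exp_add, hL]
  gcongr
  have h1 : ‖x - Real.exp (-2 * s) • y‖ ^ 2 ≤
      ‖x - Real.exp (-2 * s) • y‖ ^ 2 / (1 - Real.exp (-4 * s)) :=
    le_div_self (by positivity) hq hq1
  have h2 : Real.exp (-2 * s) * ‖y‖ ≤ ‖x‖ + ‖x - Real.exp (-2 * s) • y‖ := by
    have := norm_sub_le x (x - Real.exp (-2 * s) • y)
    rwa [sub_sub_cancel, norm_smul, Real.norm_of_nonneg (Real.exp_pos _).le] at this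
  have h3 : Real.exp (-4 * s) * ‖y‖ ^ 2 ≤ 2 * ‖x‖ ^ 2 + 2 * ‖x - Real.exp (-2 * s) • y‖ ^ 2 := by
    have := pow_le_pow_left₀ (by positivity) h2 2
    rw [mul_pow, ← h4] at this
    nlinarith [sq_nonneg (‖x‖ - ‖x - Real.exp (-2 * s) • y‖)]
  have h5 : Real.exp (-4 * s) * ((1 + ‖y‖) ^ 2) ≤ Real.exp (-4 * s) * (2 + 2 * ‖y‖ ^ 2) := by
    gcongr
    nlinarith [sq_nonneg (1 - ‖y‖)]
  rw [neg_div]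
  nlinarith

lemma rpow_neg_le_rpow_neg_mul_sq {a b p k : ℝ} (ha : 0 < a) (hb : 0 < b) (hp : 1 ≤ p)
    (hk : k ∈ Set.Icc (0 : ℝ) 2) (h : a ≤ b * p) : b ^ (-k) ≤ a ^ (-k) * p ^ 2 := by
  have hp0 : 0 < p := by linarith
  calc b ^ (-k) = (b * p) ^ (-k) * p ^ k := by
        rw [Real.mul_rpow hb.le hp0.le, mul_assoc, ← Real.rpow_add hp0]; simp
    _ ≤ a ^ (-k) * p ^ (2 : ℝ) := by
        have h1 : (b * p) ^ (-k) ≤ a ^ (-k) :=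
          Real.rpow_le_rpow_of_nonpos ha h (by linarith [hk.1])
        have h2 : p ^ k ≤ p ^ (2 : ℝ) := Real.rpow_le_rpow_of_exponent_le hp hk.2
        gcongr
    _ = _ := by rw [Real.rpow_two]

/-- The subordination integrand of the Hermite Poisson kernel, with the factor depending on
`‖x‖` and `‖y‖` only removed and `l = d + m`. -/
noncomputable def poissonProfile (d : ℕ) (l σ t : ℝ) (x y : EuclideanSpace ℝ (Fin d)) (s : ℝ) :
    ℝ :=
  Real.exp (-t ^ 2 / (4 * s)) * (1 - Real.exp (-4 * s)) ^ (-(d : ℝ) / 2) * s ^ (-(1 + σ)) *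
    Real.exp (-l * s) *
    Real.exp (-‖x - Real.exp (-2 * s) • y‖ ^ 2 / (1 - Real.exp (-4 * s)))

lemma poissonProfile_nonneg (d : ℕ) (l σ t : ℝ) (x y : EuclideanSpace ℝ (Fin d)) {s : ℝ}
    (hs : 0 < s) : 0 ≤ poissonProfile d l σ t x y s := by
  have hq : 0 < 1 - Real.exp (-4 * s) := by
    rw [sub_pos, Real.exp_lt_one_iff]; linarith
  unfold poissonProfile
  positivity

lemma measurable_poissonProfile (d : ℕ) (l σ t : ℝ) (x y : EuclideanSpace ℝ (Fin d)) :
    Measurable (poissonProfile d l σ t x y) := by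
  unfold poissonProfile
  fun_prop

lemma hermitePoisson_eq (d : ℕ) (m σ t : ℝ) (x y : EuclideanSpace ℝ (Fin d)) :
    hermitePoisson d m σ t x y =
      (t / 2) ^ (2 * σ) / Real.Gamma σ * (Real.pi ^ (-(d : ℝ) / 2) * Real.exp (‖x‖ ^ 2 / 2)) *
        Real.exp (-‖y‖ ^ 2 / 2) * ∫ s in Set.Ioi (0 : ℝ), poissonProfile d (d + m) σ t x y s := by
  have h : ∫ s in Set.Ioi (0 : ℝ),
      Real.exp (-t ^ 2 / (4 * s)) * mehler d m s x y * s ^ (-(1 + σ)) =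
        Real.pi ^ (-(d : ℝ) / 2) * Real.exp (‖x‖ ^ 2 / 2) * Real.exp (-‖y‖ ^ 2 / 2) *
          ∫ s in Set.Ioi (0 : ℝ), poissonProfile d (d + m) σ t x y s := by
    rw [← integral_const_mul]
    refine setIntegral_congr_fun measurableSet_Ioi fun s hs => ?_
    simp only [mehler_eq_of_pos d m hs x y, poissonProfile]
    ring
  rw [hermitePoisson, h]
  ring

lemma exists_poissonProfile_le (d : ℕ) (l : ℝ) {σ t : ℝ} (hσ : σ ∈ Set.Ioo (0 : ℝ) 1)
    (ht : 0 < t) (x : EuclideanSpace ℝ (Fin d)) :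
    ∃ C > (0 : ℝ), ∀ (y : EuclideanSpace ℝ (Fin d)) (s : ℝ), 0 < s →
      poissonProfile d l σ t x y s ≤ C * ((1 + s) ^ (-(1 + σ)) * Real.exp (-l * s) *
        Real.exp (-(Real.exp (4 * (Real.log (1 + ‖y‖) / 2 - s)) / 4))) := by
  obtain ⟨C, hC, h⟩ := exists_subordination_weight_le d hσ ht
  refine ⟨C * Real.exp (‖x‖ ^ 2 + 1 / 2), by positivity, fun y s hs => ?_⟩
  have hq : 0 < 1 - Real.exp (-4 * s) := by
    rw [sub_pos, Real.exp_lt_one_iff]; linarith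
  unfold poissonProfile
  calc _ ≤ C * (1 + s) ^ (-(1 + σ)) * Real.exp (-l * s) * (Real.exp (‖x‖ ^ 2 + 1 / 2) *
          Real.exp (-(Real.exp (4 * (Real.log (1 + ‖y‖) / 2 - s)) / 4))) :=
        mul_le_mul (mul_le_mul_of_nonneg_right (h s hs) (Real.exp_pos _).le)
          (exp_neg_norm_sub_smul_sq_le hs x y) (by positivity) (by positivity)
    _ = _ := by ring

lemma exists_poissonProfile_zero_le (d : ℕ) {σ t : ℝ} (hσ : σ ∈ Set.Ioo (0 : ℝ) 1)
    (ht : 0 < t) (x : EuclideanSpace ℝ (Fin d)) :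
    ∃ C > (0 : ℝ), ∀ (y : EuclideanSpace ℝ (Fin d)) (s : ℝ), 0 < s →
      poissonProfile d 0 σ t x y s ≤ C * (s + (1 + Real.log (1 + ‖y‖))) ^ (-(1 + σ)) := by
  obtain ⟨C, hC, h⟩ := exists_poissonProfile_le d 0 hσ ht x
  obtain ⟨B, hB, h'⟩ := exists_one_add_pow_mul_exp_sub_exp_le 0 2
  refine ⟨C * (9 * (B + 1)), by positivity, fun y s hs => (h y s hs).trans ?_⟩
  set L := Real.log (1 + ‖y‖) with hL
  have hL0 : 0 ≤ L := Real.log_nonneg (by linarith [norm_nonneg y])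
  set w := max (L / 2 - s) 0 with hw
  have hw0 : 0 ≤ w := le_max_right _ _
  have hw1 : L / 2 - s ≤ w := le_max_left _ _
  have h1 := rpow_neg_le_rpow_neg_mul_sq (a := s + (1 + L)) (b := 1 + s) (p := 3 * (1 + w))
    (k := 1 + σ) (by positivity) (by positivity) (by linarith)
    ⟨by linarith [hσ.1], by linarith [hσ.2]⟩ (by nlinarith [mul_nonneg hs.le hw0])
  have h2 : (1 + w) ^ 2 * Real.exp (-(Real.exp (4 * (L / 2 - s)) / 4)) ≤ B + 1 := by
    rcases le_total 0 (L / 2 - s) with hc | hc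
    · have := h' w hw0
      rw [hw, max_eq_left hc] at this ⊢
      simp only [zero_mul, zero_sub] at this
      linarith
    · have e : w = 0 := by rw [hw, max_eq_right hc]
      rw [e]
      have : Real.exp (-(Real.exp (4 * (L / 2 - s)) / 4)) ≤ 1 := by
        rw [Real.exp_le_one_iff]; linarith [Real.exp_pos (4 * (L / 2 - s))]
      linarith
  rw [neg_zero, zero_mul, Real.exp_zero, mul_one, mul_assoc C]
  refine mul_le_mul_of_nonneg_left ?_ hC.le
  calc _ ≤ (s + (1 + L)) ^ (-(1 + σ)) * (3 * (1 + w)) ^ 2 *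
          Real.exp (-(Real.exp (4 * (L / 2 - s)) / 4)) := by gcongr
    _ = 9 * ((1 + w) ^ 2 * Real.exp (-(Real.exp (4 * (L / 2 - s)) / 4))) *
          (s + (1 + L)) ^ (-(1 + σ)) := by ring
    _ ≤ _ := by gcongr

lemma exists_poissonProfile_pos_le (d : ℕ) {l σ t : ℝ} (hl : 0 < l) (hσ : σ ∈ Set.Ioo (0 : ℝ) 1)
    (ht : 0 < t) (x : EuclideanSpace ℝ (Fin d)) :
    ∃ C > (0 : ℝ), ∀ (y : EuclideanSpace ℝ (Fin d)) (s : ℝ), 0 < s →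
      poissonProfile d l σ t x y s ≤ C * (Real.exp (-l * (Real.log (1 + ‖y‖) / 2)) *
        (1 + Real.log (1 + ‖y‖) / 2) ^ (-(1 + σ))) *
          (1 + (s - Real.log (1 + ‖y‖) / 2) ^ 2)⁻¹ := by
  obtain ⟨C, hC, h⟩ := exists_poissonProfile_le d l hσ ht x
  obtain ⟨B, hB, h1⟩ := exists_one_add_pow_mul_exp_sub_exp_le l 4
  obtain ⟨B', hB', h2⟩ := exists_one_add_pow_le_exp l hl 4
  refine ⟨C * (B + B'), by positivity, fun y s hs => (h y s hs).trans ?_⟩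
  set A := Real.log (1 + ‖y‖) / 2 with hA
  have hA0 : 0 ≤ A := by
    have : 0 ≤ Real.log (1 + ‖y‖) := Real.log_nonneg (by linarith [norm_nonneg y])
    positivity
  have h3 := rpow_neg_le_rpow_neg_mul_sq (a := 1 + A) (b := 1 + s) (p := 1 + |s - A|)
    (k := 1 + σ) (by positivity) (by positivity) (by linarith [abs_nonneg (s - A)])
    ⟨by linarith [hσ.1], by linarith [hσ.2]⟩
    (by nlinarith [mul_nonneg hs.le (abs_nonneg (s - A)), neg_abs_le (s - A)])
  have h4 : (1 + |s - A|) ^ 4 * Real.exp (-l * (s - A) - Real.exp (4 * (A - s)) / 4) ≤ B + B' := by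
    rcases le_total s A with hc | hc
    · have := h1 (A - s) (by linarith)
      rw [abs_of_nonpos (by linarith), show -l * (s - A) = l * (A - s) by ring, neg_sub]
      linarith
    · have := h2 (s - A) (by linarith)
      rw [abs_of_nonneg (by linarith)]
      calc _ ≤ B' * Real.exp (l * (s - A)) * Real.exp (-l * (s - A)) := by
            gcongr
            linarith [Real.exp_pos (4 * (A - s))]
        _ = B' := by rw [mul_assoc, ← Real.exp_add]; simp
        _ ≤ _ := by linarith
  have h5 : Real.exp (-l * s) * Real.exp (-(Real.exp (4 * (A - s)) / 4)) =
      Real.exp (-l * A) * Real.exp (-l * (s - A) - Real.exp (4 * (A - s)) / 4) := by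
    rw [← Real.exp_add, ← Real.exp_add]; ring_nf
  have h6 : 1 + (s - A) ^ 2 ≤ (1 + |s - A|) ^ 2 := by
    nlinarith [abs_nonneg (s - A), sq_abs (s - A)]
  rw [← div_eq_mul_inv, le_div_iff₀ (by positivity), mul_assoc ((1 + s) ^ (-(1 + σ))), h5]
  calc _ ≤ C * (((1 + A) ^ (-(1 + σ)) * (1 + |s - A|) ^ 2) * (Real.exp (-l * A) *
          Real.exp (-l * (s - A) - Real.exp (4 * (A - s)) / 4))) * (1 + |s - A|) ^ 2 := by gcongr
    _ = C * ((1 + |s - A|) ^ 4 * Real.exp (-l * (s - A) - Real.exp (4 * (A - s)) / 4)) *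
          (Real.exp (-l * A) * (1 + A) ^ (-(1 + σ))) := by ring
    _ ≤ _ := by gcongr

lemma integrableOn_poissonProfile_of_le {d : ℕ} {l σ t : ℝ} {x y : EuclideanSpace ℝ (Fin d)}
    {g : ℝ → ℝ} (hg : IntegrableOn g (Set.Ioi 0))
    (h : ∀ s : ℝ, 0 < s → poissonProfile d l σ t x y s ≤ g s) :
    IntegrableOn (poissonProfile d l σ t x y) (Set.Ioi 0) := by
  refine Integrable.mono' hg (measurable_poissonProfile d l σ t x y).aestronglyMeasurable ?_
  refine (ae_restrict_iff' measurableSet_Ioi).2 (Filter.Eventually.of_forall fun s hs => ?_)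
  rw [Real.norm_of_nonneg (poissonProfile_nonneg d l σ t x y hs)]
  exact h s hs

lemma integrableOn_poissonProfile (d : ℕ) {l σ t : ℝ} (hl : 0 ≤ l) (hσ : σ ∈ Set.Ioo (0 : ℝ) 1)
    (ht : 0 < t) (x y : EuclideanSpace ℝ (Fin d)) :
    IntegrableOn (poissonProfile d l σ t x y) (Set.Ioi 0) := by
  obtain ⟨C, hC, h⟩ := exists_poissonProfile_le d l hσ ht x
  refine integrableOn_poissonProfile_of_le (g := fun s => C * (s + 1) ^ (-(1 + σ)))
    ((integrableOn_add_rpow_Ioi_of_lt (by linarith [hσ.1]) (by norm_num)).const_mul C)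
    fun s hs => (h y s hs).trans ?_
  rw [add_comm s 1, mul_assoc ((1 + s) ^ (-(1 + σ))), ← Real.exp_add]
  gcongr
  apply mul_le_of_le_one_right (by positivity)
  rw [Real.exp_le_one_iff]
  nlinarith [Real.exp_pos (4 * (Real.log (1 + ‖y‖) / 2 - s)), mul_nonneg hl hs.le]

lemma integral_Ioi_add_rpow {σ a : ℝ} (hσ : 0 < σ) (ha : 0 < a) :
    ∫ s in Set.Ioi (0 : ℝ), (s + a) ^ (-(1 + σ)) = a ^ (-σ) / σ := by
  have h := (measurePreserving_add_right volume a).setIntegral_preimage_emb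
    (measurableEmbedding_addRight a) (fun s : ℝ => s ^ (-(1 + σ))) (Set.Ioi a)
  rw [Set.preimage_add_const_Ioi, sub_self] at h
  rw [h, integral_Ioi_rpow_of_lt (by linarith) ha, show -(1 + σ) + 1 = -σ by ring, neg_div_neg_eq]

lemma exists_integral_poissonProfile_zero_le (d : ℕ) {σ t : ℝ} (hσ : σ ∈ Set.Ioo (0 : ℝ) 1)
    (ht : 0 < t) (x : EuclideanSpace ℝ (Fin d)) :
    ∃ C > (0 : ℝ), ∀ y : EuclideanSpace ℝ (Fin d),
      ∫ s in Set.Ioi (0 : ℝ), poissonProfile d 0 σ t x y s ≤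
        C * (1 + Real.log (1 + ‖y‖)) ^ (-σ) := by
  obtain ⟨C, hC, h⟩ := exists_poissonProfile_zero_le d hσ ht x
  have hσ0 := hσ.1
  refine ⟨C / σ, by positivity, fun y => ?_⟩
  have hL0 : 0 ≤ Real.log (1 + ‖y‖) := Real.log_nonneg (by linarith [norm_nonneg y])
  have hi : IntegrableOn (fun s => C * (s + (1 + Real.log (1 + ‖y‖))) ^ (-(1 + σ)))
      (Set.Ioi 0) :=
    (integrableOn_add_rpow_Ioi_of_lt (by linarith) (by linarith)).const_mul C
  refine (setIntegral_mono_on (integrableOn_poissonProfile d le_rfl hσ ht x y) hi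
    measurableSet_Ioi fun s hs => h y s hs).trans (le_of_eq ?_)
  rw [integral_const_mul, integral_Ioi_add_rpow hσ0 (by positivity)]
  ring

lemma exists_integral_poissonProfile_pos_le (d : ℕ) {l σ t : ℝ} (hl : 0 < l)
    (hσ : σ ∈ Set.Ioo (0 : ℝ) 1) (ht : 0 < t) (x : EuclideanSpace ℝ (Fin d)) :
    ∃ C > (0 : ℝ), ∀ y : EuclideanSpace ℝ (Fin d),
      ∫ s in Set.Ioi (0 : ℝ), poissonProfile d l σ t x y s ≤
        C * (Real.exp (-l * (Real.log (1 + ‖y‖) / 2)) *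
          (1 + Real.log (1 + ‖y‖) / 2) ^ (-(1 + σ))) := by
  obtain ⟨C, hC, h⟩ := exists_poissonProfile_pos_le d hl hσ ht x
  refine ⟨C * Real.pi, by positivity, fun y => ?_⟩
  set A := Real.log (1 + ‖y‖) / 2 with hA
  have hA0 : 0 ≤ A := by
    have : 0 ≤ Real.log (1 + ‖y‖) := Real.log_nonneg (by linarith [norm_nonneg y])
    positivity
  have hi : Integrable (fun s : ℝ => C * (Real.exp (-l * A) * (1 + A) ^ (-(1 + σ))) *
      (1 + (s - A) ^ 2)⁻¹) :=
    (integrable_inv_one_add_sq.comp_sub_right A).const_mul _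
  calc _ ≤ ∫ s in Set.Ioi (0 : ℝ), C * (Real.exp (-l * A) * (1 + A) ^ (-(1 + σ))) *
          (1 + (s - A) ^ 2)⁻¹ :=
        setIntegral_mono_on (integrableOn_poissonProfile d hl.le hσ ht x y) hi.integrableOn
          measurableSet_Ioi fun s hs => h y s hs
    _ ≤ ∫ s : ℝ, C * (Real.exp (-l * A) * (1 + A) ^ (-(1 + σ))) * (1 + (s - A) ^ 2)⁻¹ :=
        setIntegral_le_integral hi (Filter.Eventually.of_forall fun s => by
          dsimp only [Pi.zero_apply]; positivity)
    _ = _ := by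
        rw [integral_const_mul, integral_sub_right_eq_self (fun s : ℝ => (1 + s ^ 2)⁻¹) A,
          integral_univ_inv_one_add_sq]
        ring

lemma exists_le_poissonProfile (d : ℕ) (l σ : ℝ) {t : ℝ} (x : EuclideanSpace ℝ (Fin d)) :
    ∃ c > (0 : ℝ), ∀ (y : EuclideanSpace ℝ (Fin d)) (s : ℝ), 1 + Real.log (1 + ‖y‖) / 2 ≤ s →
      c * (Real.exp (-l * s) * s ^ (-(1 + σ))) ≤ poissonProfile d l σ t x y s := by
  refine ⟨Real.exp (-t ^ 2 / 4) * Real.exp (-(2 * (‖x‖ + 1) ^ 2)), by positivity,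
    fun y s hs => ?_⟩
  have hL0 : 0 ≤ Real.log (1 + ‖y‖) := Real.log_nonneg (by linarith [norm_nonneg y])
  have hs1 : 1 ≤ s := by linarith
  have hq : 1 / 2 ≤ 1 - Real.exp (-4 * s) := by
    have : Real.exp (-4 * s) ≤ (1 + 4 * s)⁻¹ := by
      rw [show -4 * s = -(4 * s) by ring, Real.exp_neg]
      apply inv_anti₀ (by positivity)
      linarith [Real.add_one_le_exp (4 * s)]
    have h2 : (1 + 4 * s)⁻¹ ≤ 2⁻¹ := inv_anti₀ (by norm_num) (by linarith)
    linarith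
  have hq0 : 0 < 1 - Real.exp (-4 * s) := by linarith
  have h1 : Real.exp (-t ^ 2 / 4) ≤ Real.exp (-t ^ 2 / (4 * s)) := by
    rw [Real.exp_le_exp, neg_div, neg_div, neg_le_neg_iff]
    gcongr
    linarith
  have h2 : 1 ≤ (1 - Real.exp (-4 * s)) ^ (-(d : ℝ) / 2) := by
    apply Real.one_le_rpow_of_pos_of_le_one_of_nonpos hq0
    · linarith [Real.exp_pos (-4 * s)]
    · have : (0 : ℝ) ≤ d := Nat.cast_nonneg d
      linarith
  have h3 : ‖x - Real.exp (-2 * s) • y‖ ≤ ‖x‖ + 1 := by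
    refine (norm_sub_le _ _).trans ?_
    gcongr
    rw [norm_smul, Real.norm_of_nonneg (Real.exp_pos _).le]
    calc Real.exp (-2 * s) * ‖y‖ ≤ Real.exp (-Real.log (1 + ‖y‖)) * (1 + ‖y‖) := by
          gcongr
          · linarith
          · linarith
      _ = 1 := by
          rw [Real.exp_neg, Real.exp_log (by positivity), inv_mul_cancel₀ (by positivity)]
  have h4 : Real.exp (-(2 * (‖x‖ + 1) ^ 2)) ≤
      Real.exp (-‖x - Real.exp (-2 * s) • y‖ ^ 2 / (1 - Real.exp (-4 * s))) := by
    gcongr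
    rw [neg_div, neg_le_neg_iff, div_le_iff₀ hq0]
    have := pow_le_pow_left₀ (norm_nonneg _) h3 2
    nlinarith [sq_nonneg (‖x‖ + 1)]
  unfold poissonProfile
  calc _ = Real.exp (-t ^ 2 / 4) * 1 * s ^ (-(1 + σ)) * Real.exp (-l * s) *
        Real.exp (-(2 * (‖x‖ + 1) ^ 2)) := by ring
    _ ≤ _ := by gcongr

lemma exists_le_integral_poissonProfile_zero (d : ℕ) {σ t : ℝ} (hσ : σ ∈ Set.Ioo (0 : ℝ) 1)
    (ht : 0 < t) (x : EuclideanSpace ℝ (Fin d)) :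
    ∃ c > (0 : ℝ), ∀ y : EuclideanSpace ℝ (Fin d),
      c * (1 + Real.log (1 + ‖y‖) / 2) ^ (-σ) ≤
        ∫ s in Set.Ioi (0 : ℝ), poissonProfile d 0 σ t x y s := by
  obtain ⟨c, hc, h⟩ := exists_le_poissonProfile d 0 σ (t := t) x
  have hσ0 := hσ.1
  refine ⟨c / σ, by positivity, fun y => ?_⟩
  set A := 1 + Real.log (1 + ‖y‖) / 2 with hA
  have hA0 : 0 < A := by
    have : 0 ≤ Real.log (1 + ‖y‖) := Real.log_nonneg (by linarith [norm_nonneg y])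
    positivity
  have hi := integrableOn_poissonProfile d le_rfl hσ ht x y
  have hsub : Set.Ioi A ⊆ Set.Ioi 0 := Set.Ioi_subset_Ioi hA0.le
  calc c / σ * A ^ (-σ) = ∫ s in Set.Ioi A, c * s ^ (-(1 + σ)) := by
        rw [integral_const_mul, integral_Ioi_rpow_of_lt (by linarith) hA0,
          show -(1 + σ) + 1 = -σ by ring, neg_div_neg_eq]
        ring
    _ ≤ ∫ s in Set.Ioi A, poissonProfile d 0 σ t x y s := by
        refine setIntegral_mono_on ((integrableOn_Ioi_rpow_of_lt (by linarith) hA0).const_mul c)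
          (hi.mono_set hsub) measurableSet_Ioi fun s hs => ?_
        simpa using h y s (le_of_lt hs)
    _ ≤ _ := setIntegral_mono_set hi
        ((ae_restrict_iff' measurableSet_Ioi).2 (Filter.Eventually.of_forall fun s hs =>
          poissonProfile_nonneg d 0 σ t x y hs)) hsub.eventuallyLE

lemma exists_le_integral_poissonProfile (d : ℕ) {l σ t : ℝ} (hl : 0 ≤ l)
    (hσ : σ ∈ Set.Ioo (0 : ℝ) 1) (ht : 0 < t) (x : EuclideanSpace ℝ (Fin d)) :
    ∃ c > (0 : ℝ), ∀ y : EuclideanSpace ℝ (Fin d),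
      c * (Real.exp (-l * (Real.log (1 + ‖y‖) / 2)) *
          (2 + Real.log (1 + ‖y‖) / 2) ^ (-(1 + σ))) ≤
        ∫ s in Set.Ioi (0 : ℝ), poissonProfile d l σ t x y s := by
  obtain ⟨c, hc, h⟩ := exists_le_poissonProfile d l σ (t := t) x
  refine ⟨c * Real.exp (-l * 2), by positivity, fun y => ?_⟩
  set A := Real.log (1 + ‖y‖) / 2 with hA
  have hA0 : 0 ≤ A := by
    have : 0 ≤ Real.log (1 + ‖y‖) := Real.log_nonneg (by linarith [norm_nonneg y])
    positivity
  have hi := integrableOn_poissonProfile d hl hσ ht x y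
  have hsub : Set.Ioc (1 + A) (2 + A) ⊆ Set.Ioi 0 := fun s hs => lt_trans (by positivity) hs.1
  calc c * Real.exp (-l * 2) * (Real.exp (-l * A) * (2 + A) ^ (-(1 + σ)))
      = ∫ s in Set.Ioc (1 + A) (2 + A), c * (Real.exp (-l * (2 + A)) * (2 + A) ^ (-(1 + σ))) := by
        rw [setIntegral_const, Real.volume_real_Ioc_of_le (by linarith),
          mul_add, Real.exp_add, smul_eq_mul]
        ring
    _ ≤ ∫ s in Set.Ioc (1 + A) (2 + A), poissonProfile d l σ t x y s := by
        refine setIntegral_mono_on (integrableOn_const (by simp))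
          (hi.mono_set hsub) measurableSet_Ioc fun s hs => (le_trans ?_ (h y s hs.1.le))
        have hs0 : 0 < s := hsub hs
        have h1 : Real.exp (-l * (2 + A)) ≤ Real.exp (-l * s) := by
          gcongr Real.exp ?_
          nlinarith [hs.2]
        have h2 : (2 + A) ^ (-(1 + σ)) ≤ s ^ (-(1 + σ)) :=
          Real.rpow_le_rpow_of_nonpos hs0 hs.2 (by linarith [hσ.1])
        gcongr
    _ ≤ _ := setIntegral_mono_set hi
        ((ae_restrict_iff' measurableSet_Ioi).2 (Filter.Eventually.of_forall fun s hs =>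
          poissonProfile_nonneg d l σ t x y hs)) hsub.eventuallyLE

lemma log_exp_one_add_le {r : ℝ} (hr : 0 ≤ r) :
    Real.log (Real.exp 1 + r) ≤ 1 + Real.log (1 + r) := by
  have h : 1 + Real.log (1 + r) = Real.log (Real.exp 1 * (1 + r)) := by
    rw [Real.log_mul (by positivity) (by positivity), Real.log_exp]
  rw [h]
  apply Real.log_le_log (by positivity)
  nlinarith [Real.add_one_le_exp (1 : ℝ)]

lemma log_one_add_le_log_exp_one_add {r : ℝ} (hr : 0 ≤ r) :
    Real.log (1 + r) ≤ Real.log (Real.exp 1 + r) := by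
  apply Real.log_le_log (by positivity)
  linarith [Real.add_one_le_exp (1 : ℝ)]

lemma one_le_log_exp_one_add {r : ℝ} (hr : 0 ≤ r) : 1 ≤ Real.log (Real.exp 1 + r) := by
  rw [Real.le_log_iff_exp_le (by positivity)]
  linarith

/-- Negative powers of comparable positive quantities are comparable. -/
lemma rpow_neg_le_mul_inv_rpow {a b K k : ℝ} (ha : 0 < a) (hK : 0 < K) (hb : 0 < b)
    (hk : 0 ≤ k) (h : b ≤ K * a) : a ^ (-k) ≤ K ^ k * (b ^ k)⁻¹ := by
  rw [Real.rpow_neg ha.le, ← div_eq_mul_inv, le_div_iff₀ (by positivity),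
    inv_mul_le_iff₀ (by positivity), mul_comm, ← Real.mul_rpow hK.le ha.le]
  gcongr

lemma mul_inv_rpow_le_rpow_neg {a b K k : ℝ} (ha : 0 < a) (hK : 0 < K) (hb : 0 < b)
    (hk : 0 ≤ k) (h : a ≤ K * b) : (K ^ k)⁻¹ * (b ^ k)⁻¹ ≤ a ^ (-k) := by
  rw [Real.rpow_neg ha.le, ← mul_inv, ← Real.mul_rpow hK.le hb.le]
  gcongr

/-- (Lemma on the Poisson kernel of the Hermite operator.)  For `d ≥ 1`,
`m ≥ -d`, `σ ∈ (0,1)`, every `t > 0` and `x ∈ ℝ^d`, there are finite constants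
`c₁(t,x), c₂(t,x) > 0` with `c₁(t,x) Φ_σ(y) ≤ p^σ_t(x,y) ≤ c₂(t,x) Φ_σ(y)` for all `y`. -/
theorem hermite_poisson_kernel_two_sided_bound
    (d : ℕ) (hd : 1 ≤ d) (m : ℝ) (hm : -(d : ℝ) ≤ m)
    (σ : ℝ) (hσ : σ ∈ Set.Ioo (0 : ℝ) 1) :
    ∀ t > (0 : ℝ), ∀ x : EuclideanSpace ℝ (Fin d),
      ∃ c₁ > (0 : ℝ), ∃ c₂ > (0 : ℝ), ∀ y : EuclideanSpace ℝ (Fin d),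
        c₁ * PhiSigma d m σ y ≤ hermitePoisson d m σ t x y ∧
        hermitePoisson d m σ t x y ≤ c₂ * PhiSigma d m σ y := by
  intro t ht x
  have hσ0 := hσ.1
  have hΓ := Real.Gamma_pos_of_pos hσ0
  set A : ℝ := (t / 2) ^ (2 * σ) / Real.Gamma σ *
    (Real.pi ^ (-(d : ℝ) / 2) * Real.exp (‖x‖ ^ 2 / 2)) with hA
  have hA0 : 0 < A := by positivity
  rcases eq_or_ne m (-(d : ℝ)) with hmd | hmd
  · obtain ⟨c, hc, h₁⟩ := exists_le_integral_poissonProfile_zero d hσ ht x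
    obtain ⟨C, hC, h₂⟩ := exists_integral_poissonProfile_zero_le d hσ ht x
    refine ⟨A * (c * (2 ^ σ)⁻¹), by positivity, A * (C * 1 ^ σ), by positivity, fun y => ?_⟩
    have hy := norm_nonneg y
    have hL : 0 ≤ Real.log (1 + ‖y‖) := Real.log_nonneg (by linarith)
    have l1 := log_exp_one_add_le hy
    have l2 := log_one_add_le_log_exp_one_add hy
    have l3 := one_le_log_exp_one_add hy
    rw [hermitePoisson_eq, PhiSigma, if_pos hmd, hmd, add_neg_cancel, div_eq_mul_inv, ← hA]
    have e₁ := mul_inv_rpow_le_rpow_neg (a := 1 + Real.log (1 + ‖y‖) / 2) (K := 2)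
      (b := Real.log (Real.exp 1 + ‖y‖)) (k := σ) (by positivity) two_pos (by positivity) hσ0.le
      (by linarith)
    have e₂ := rpow_neg_le_mul_inv_rpow (a := 1 + Real.log (1 + ‖y‖)) (K := 1)
      (b := Real.log (Real.exp 1 + ‖y‖)) (k := σ) (by positivity) one_pos (by positivity) hσ0.le
      (by linarith)
    constructor
    · calc _ = A * Real.exp (-‖y‖ ^ 2 / 2) *
            (c * ((2 ^ σ)⁻¹ * (Real.log (Real.exp 1 + ‖y‖) ^ σ)⁻¹)) := by ring
        _ ≤ A * Real.exp (-‖y‖ ^ 2 / 2) * (c * (1 + Real.log (1 + ‖y‖) / 2) ^ (-σ)) := by gcongr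
        _ ≤ _ := by gcongr; exact h₁ y
    · calc _ ≤ A * Real.exp (-‖y‖ ^ 2 / 2) * (C * (1 + Real.log (1 + ‖y‖)) ^ (-σ)) := by
            gcongr; exact h₂ y
        _ ≤ A * Real.exp (-‖y‖ ^ 2 / 2) *
            (C * (1 ^ σ * (Real.log (Real.exp 1 + ‖y‖) ^ σ)⁻¹)) := by gcongr
        _ = _ := by ring
  · have hl : 0 < (d : ℝ) + m := by
      have := lt_of_le_of_ne hm hmd.symm
      linarith
    obtain ⟨c, hc, h₁⟩ := exists_le_integral_poissonProfile d hl.le hσ ht x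
    obtain ⟨C, hC, h₂⟩ := exists_integral_poissonProfile_pos_le d hl hσ ht x
    refine ⟨A * (c * (3 ^ (1 + σ))⁻¹), by positivity, A * (C * 2 ^ (1 + σ)), by positivity,
      fun y => ?_⟩
    have hy := norm_nonneg y
    have hL : 0 ≤ Real.log (1 + ‖y‖) := Real.log_nonneg (by linarith)
    have l1 := log_exp_one_add_le hy
    have l2 := log_one_add_le_log_exp_one_add hy
    have l3 := one_le_log_exp_one_add hy
    have e : Real.exp (-(d + m) * (Real.log (1 + ‖y‖) / 2)) =
        ((1 + ‖y‖) ^ (((d : ℝ) + m) / 2))⁻¹ := by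
      rw [Real.rpow_def_of_pos (by positivity), ← Real.exp_neg]
      ring_nf
    rw [hermitePoisson_eq, PhiSigma, if_neg hmd, div_eq_mul_inv, mul_inv, ← hA, ← e]
    have e₁ := mul_inv_rpow_le_rpow_neg (a := 2 + Real.log (1 + ‖y‖) / 2) (K := 3)
      (b := Real.log (Real.exp 1 + ‖y‖)) (k := 1 + σ) (by positivity) three_pos (by positivity)
      (by positivity) (by linarith)
    have e₂ := rpow_neg_le_mul_inv_rpow (a := 1 + Real.log (1 + ‖y‖) / 2) (K := 2)
      (b := Real.log (Real.exp 1 + ‖y‖)) (k := 1 + σ) (by positivity) two_pos (by positivity)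
      (by positivity) (by linarith)
    constructor
    · calc _ = A * Real.exp (-‖y‖ ^ 2 / 2) *
            (c * (Real.exp (-(d + m) * (Real.log (1 + ‖y‖) / 2)) *
              ((3 ^ (1 + σ))⁻¹ * (Real.log (Real.exp 1 + ‖y‖) ^ (1 + σ))⁻¹))) := by ring
        _ ≤ A * Real.exp (-‖y‖ ^ 2 / 2) *
            (c * (Real.exp (-(d + m) * (Real.log (1 + ‖y‖) / 2)) *
              (2 + Real.log (1 + ‖y‖) / 2) ^ (-(1 + σ)))) := by gcongr
        _ ≤ _ := by gcongr; exact h₁ y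
    · calc _ ≤ A * Real.exp (-‖y‖ ^ 2 / 2) *
            (C * (Real.exp (-(d + m) * (Real.log (1 + ‖y‖) / 2)) *
              (1 + Real.log (1 + ‖y‖) / 2) ^ (-(1 + σ)))) := by
            gcongr; exact h₂ y
        _ ≤ A * Real.exp (-‖y‖ ^ 2 / 2) *
            (C * (Real.exp (-(d + m) * (Real.log (1 + ‖y‖) / 2)) *
              (2 ^ (1 + σ) * (Real.log (Real.exp 1 + ‖y‖) ^ (1 + σ))⁻¹))) := by gcongr
        _ = _ := by ring
end

section
/- Let d ≥ 1, m ≥ -d, σ > 0, let h_t be the Mehler heat kernel of L = -Δ + |x|² + m, fix A > 0 with tanh(A) = 1/2, and set K(x,y) = ∫₀^A h_t(x,y) t^{-(1+σ)} dt. Then there exists c = c(σ,d,m) > 0 such that K(x,y) ≤ c / |x−y|^{d+2σ} for all x, y ∈ ℝ^d with x ≠ y. -/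
open MeasureTheory Set Filter
open RealInnerProductSpace

theorem Real.tanh_le_self {t : ℝ} (ht : 0 ≤ t) : Real.tanh t ≤ t := by
  have hmono : MonotoneOn (fun x : ℝ => x * Real.cosh x - Real.sinh x) (Ici 0) := by
    refine monotoneOn_of_hasDerivWithinAt_nonneg (f' := fun x => x * Real.sinh x)
      (convex_Ici 0) (by fun_prop) (fun x _ => ?_) (fun x hx => ?_)
    · have h := ((hasDerivAt_id x).mul (Real.hasDerivAt_cosh x)).sub (Real.hasDerivAt_sinh x)
      exact (h.congr_deriv (by simp)).hasDerivWithinAt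
    · rw [interior_Ici, mem_Ioi] at hx
      exact mul_nonneg hx.le (Real.sinh_nonneg_iff.2 hx.le)
  have h := hmono self_mem_Ici ht ht
  simp only [zero_mul, Real.sinh_zero, sub_zero] at h
  rw [Real.tanh_eq_sinh_div_cosh, div_le_iff₀ (Real.cosh_pos t)]
  linarith

theorem Real.tanh_pos_of_pos {t : ℝ} (ht : 0 < t) : 0 < Real.tanh t := by
  rw [Real.tanh_eq_sinh_div_cosh]
  exact div_pos (Real.sinh_pos_iff.2 ht) (Real.cosh_pos t)

theorem Real.inv_two_mul_tanh_two_mul {t : ℝ} (ht : 0 < t) :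
    1 / (2 * Real.tanh (2 * t)) = 1 / (4 * Real.tanh t) + Real.tanh t / 4 := by
  have hs := (Real.sinh_pos_iff.2 ht).ne'
  have hc := (Real.cosh_pos t).ne'
  simp only [Real.tanh_eq_sinh_div_cosh, Real.sinh_two_mul, Real.cosh_two_mul]
  field_simp
  ring

theorem neg_norm_sub_sq_le_four_mul_inner {E : Type*} [NormedAddCommGroup E]
    [InnerProductSpace ℝ E] (x y : E) : -‖x - y‖ ^ 2 ≤ 4 * ⟪x, y⟫ := by
  have h1 := norm_add_sq_real x y
  have h2 := norm_sub_sq_real x y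
  have h3 := sq_nonneg ‖x + y‖
  linarith

/-- The exponent in Mehler's formula is dominated by that of the Euclidean heat kernel. -/
theorem mehler_exponent_le {E : Type*} [NormedAddCommGroup E] [InnerProductSpace ℝ E]
    {t : ℝ} (ht : 0 < t) (x y : E) :
    -‖x - y‖ ^ 2 / (2 * Real.tanh (2 * t)) - Real.tanh t * ⟪x, y⟫
      ≤ -(‖x - y‖ ^ 2 / 4 * t⁻¹) := by
  have hτ := Real.tanh_pos_of_pos ht
  have hin := mul_le_mul_of_nonneg_left (neg_norm_sub_sq_le_four_mul_inner x y) hτ.le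
  have hinv : t⁻¹ ≤ (Real.tanh t)⁻¹ := inv_anti₀ hτ (Real.tanh_le_self ht.le)
  have hmul := mul_le_mul_of_nonneg_left hinv (sq_nonneg ‖x - y‖)
  have hexp : -‖x - y‖ ^ 2 / (2 * Real.tanh (2 * t))
      = -(‖x - y‖ ^ 2 * (Real.tanh t)⁻¹) / 4 - Real.tanh t * ‖x - y‖ ^ 2 / 4 := by
    rw [div_eq_mul_one_div, Real.inv_two_mul_tanh_two_mul ht]
    ring
  rw [hexp]
  linarith

/-- On bounded time intervals the Mehler kernel has a Euclidean Gaussian upper bound. -/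
theorem mehler_le_gaussian {d : ℕ} {m A t : ℝ} (hm : -(d : ℝ) ≤ m) (ht : 0 < t) (htA : t ≤ A)
    (x y : EuclideanSpace ℝ (Fin d)) :
    mehler d m t x y ≤ Real.exp (A * d) * (4 * Real.pi) ^ (-(d : ℝ) / 2) *
      (t ^ (-(d : ℝ) / 2) * Real.exp (-(‖x - y‖ ^ 2 / 4 * t⁻¹))) := by
  have hd : (0 : ℝ) ≤ d := Nat.cast_nonneg d
  have hπ := Real.pi_pos
  have h1 : Real.exp (-t * m) ≤ Real.exp (A * d) := by
    refine Real.exp_le_exp.2 ?_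
    nlinarith
  have h2 : (2 * Real.pi * Real.sinh (2 * t)) ^ (-(d : ℝ) / 2)
      ≤ (4 * Real.pi) ^ (-(d : ℝ) / 2) * t ^ (-(d : ℝ) / 2) := by
    rw [← Real.mul_rpow (by positivity) ht.le]
    refine Real.rpow_le_rpow_of_nonpos (by positivity) ?_ (by linarith)
    have := Real.self_le_sinh_iff.2 (by linarith : 0 ≤ 2 * t)
    nlinarith
  have h3 := Real.exp_le_exp.2 (mehler_exponent_le ht x y)
  have hs : 0 < Real.sinh (2 * t) := Real.sinh_pos_iff.2 (by linarith)
  calc mehler d m t x y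
      ≤ Real.exp (A * d) * ((4 * Real.pi) ^ (-(d : ℝ) / 2) * t ^ (-(d : ℝ) / 2)) *
          Real.exp (-(‖x - y‖ ^ 2 / 4 * t⁻¹)) := by
        unfold mehler
        gcongr
    _ = _ := by ring

theorem mehler_nonneg {d : ℕ} {m t : ℝ} (ht : 0 ≤ t) (x y : EuclideanSpace ℝ (Fin d)) :
    0 ≤ mehler d m t x y := by
  have hs : 0 ≤ Real.sinh (2 * t) := Real.sinh_nonneg_iff.2 (by linarith)
  have hπ := Real.pi_pos
  unfold mehler
  positivity

theorem inverse_gamma_integrand_eq (k b : ℝ) {t : ℝ} (ht : 0 < t) :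
    t ^ ((-1 : ℝ) - 1) * ((t ^ (-1 : ℝ)) ^ (k - 1) * Real.exp (-(b * t ^ (-1 : ℝ))))
      = t ^ (-k - 1) * Real.exp (-(b * t⁻¹)) := by
  rw [← Real.rpow_mul ht.le, ← mul_assoc, ← Real.rpow_add ht, Real.rpow_neg_one]
  ring_nf

theorem integrableOn_rpow_mul_exp_neg_mul_inv {k b : ℝ} (hk : 0 < k) (hb : 0 < b) :
    IntegrableOn (fun t : ℝ => t ^ (-k - 1) * Real.exp (-(b * t⁻¹))) (Ioi 0) := by
  have h : IntegrableOn (fun u : ℝ => u ^ (k - 1) * Real.exp (-(b * u))) (Ioi 0) := by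
    simpa using
      integrableOn_rpow_mul_exp_neg_mul_rpow (s := k - 1) (by linarith) one_pos hb
  refine ((integrableOn_Ioi_comp_rpow_iff' _ (by norm_num : (-1 : ℝ) ≠ 0)).2 h).congr_fun
    (fun t ht => ?_) measurableSet_Ioi
  exact inverse_gamma_integrand_eq k b ht

theorem integral_rpow_mul_exp_neg_mul_inv {k b : ℝ} (hk : 0 < k) (hb : 0 < b) :
    ∫ t in Ioi (0 : ℝ), t ^ (-k - 1) * Real.exp (-(b * t⁻¹)) = (1 / b) ^ k * Real.Gamma k := by
  rw [← Real.integral_rpow_mul_exp_neg_mul_Ioi hk hb,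
    ← integral_comp_rpow_Ioi (fun u : ℝ => u ^ (k - 1) * Real.exp (-(b * u)))
      (by norm_num : (-1 : ℝ) ≠ 0)]
  refine setIntegral_congr_fun measurableSet_Ioi (fun t ht => ?_)
  simp only [abs_neg, abs_one, one_mul, smul_eq_mul]
  exact (inverse_gamma_integrand_eq k b ht).symm

/-- For the Mehler heat kernel of `L = -Δ + |x|² + m` and `A > 0` with
`tanh A = 1/2`, the kernel `K(x,y) = ∫₀^A h_t(x,y) t^{-(1+σ)} dt` satisfies
`K(x,y) ≤ c / |x-y|^{d+2σ}` for all `x ≠ y`. -/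
theorem mehler_truncated_kernel_size_estimate
    (d : ℕ) (hd : 1 ≤ d) (m : ℝ) (hm : -(d : ℝ) ≤ m) (σ : ℝ) (hσ : 0 < σ)
    (A : ℝ) (hA0 : 0 < A) (hA : Real.tanh A = 1 / 2) :
    ∃ c > (0 : ℝ), ∀ x y : EuclideanSpace ℝ (Fin d), x ≠ y →
      (∫ t in Set.Ioo (0 : ℝ) A, mehler d m t x y * t ^ (-(1 + σ)))
        ≤ c / ‖x - y‖ ^ ((d : ℝ) + 2 * σ) := by
  set C : ℝ := Real.exp (A * d) * (4 * Real.pi) ^ (-(d : ℝ) / 2) with hC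
  set k : ℝ := (d : ℝ) / 2 + σ with hk
  have hk0 : 0 < k := by positivity
  have hC0 : 0 < C := by have := Real.pi_pos; positivity
  have hΓ := Real.Gamma_pos_of_pos hk0
  refine ⟨C * (4 ^ k * Real.Gamma k), by positivity, fun x y hxy => ?_⟩
  have hr : 0 < ‖x - y‖ := norm_pos_iff.2 (sub_ne_zero.2 hxy)
  have hb : 0 < ‖x - y‖ ^ 2 / 4 := by positivity
  set g : ℝ → ℝ := fun t => C * (t ^ (-k - 1) * Real.exp (-(‖x - y‖ ^ 2 / 4 * t⁻¹))) with hg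
  have hgint : IntegrableOn g (Ioi 0) :=
    (integrableOn_rpow_mul_exp_neg_mul_inv hk0 hb).const_mul C
  calc ∫ t in Ioo (0 : ℝ) A, mehler d m t x y * t ^ (-(1 + σ))
      ≤ ∫ t in Ioo (0 : ℝ) A, g t := by
        refine integral_mono_of_nonneg ?_ (hgint.mono_set Ioo_subset_Ioi_self) ?_
        · filter_upwards [ae_restrict_mem measurableSet_Ioo] with t ht
          exact mul_nonneg (mehler_nonneg ht.1.le x y) (Real.rpow_nonneg ht.1.le _)
        · filter_upwards [ae_restrict_mem measurableSet_Ioo] with t ht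
          have hpow : t ^ (-k - 1) = t ^ (-(d : ℝ) / 2) * t ^ (-(1 + σ)) := by
            rw [← Real.rpow_add ht.1, hk]
            ring_nf
          have h := mul_le_mul_of_nonneg_right (mehler_le_gaussian hm ht.1 ht.2.le x y)
            (Real.rpow_nonneg ht.1.le (-(1 + σ)))
          refine h.trans_eq ?_
          simp only [hg, hpow]
          ring
    _ ≤ ∫ t in Ioi (0 : ℝ), g t := by
        refine setIntegral_mono_set hgint ?_ Ioo_subset_Ioi_self.eventuallyLE
        filter_upwards [ae_restrict_mem measurableSet_Ioi] with t ht
        have ht' : 0 < t := ht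
        simp only [hg, Pi.zero_apply]
        positivity
    _ = C * (4 ^ k * Real.Gamma k) / ‖x - y‖ ^ ((d : ℝ) + 2 * σ) := by
        have hrk : (‖x - y‖ ^ 2) ^ k = ‖x - y‖ ^ ((d : ℝ) + 2 * σ) := by
          rw [← Real.rpow_natCast_mul hr.le, hk]
          congr 1
          push_cast
          ring
        rw [integral_const_mul, integral_rpow_mul_exp_neg_mul_inv hk0 hb, one_div_div,
          Real.div_rpow (by norm_num) (by positivity), hrk]
        ring
end

section
/- Let d ≥ 1, R > 0, σ > 0, and set K(x,y) = ∫₀^∞ e^{-tR} (4πt)^{-d/2} e^{-|x−y|²/(4t)} t^{-(1+σ)} dt. Then for every x ∈ ℝ^d there exists c(x) > 0 such that K(x,y) ≤ c(x) · e^{-√(R(1+|y|²))} / (1+|y|)^{(d+1)/2+σ} for all y with |y| ≥ 2 max{|x|, 1}. -/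
open MeasureTheory Set Filter
open RealInnerProductSpace

theorem rpow_mul_exp_neg_quarter_le {p u : ℝ} (hp : 0 < p) (hu : 0 ≤ u) :
    u ^ p * Real.exp (-(u / 4)) ≤ (4 * p) ^ p := by
  have h1 : u / (4 * p) ≤ Real.exp (u / (4 * p)) := by
    linarith [Real.add_one_le_exp (u / (4 * p))]
  have h2 : (u / (4 * p)) ^ p ≤ Real.exp (u / 4) := by
    calc (u / (4 * p)) ^ p ≤ Real.exp (u / (4 * p)) ^ p :=
          Real.rpow_le_rpow (by positivity) h1 hp.le
      _ = Real.exp (u / 4) := by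
          rw [← Real.exp_mul]; congr 1; field_simp
  rw [Real.div_rpow hu (by positivity), div_le_iff₀ (by positivity)] at h2
  rw [Real.exp_neg, ← div_eq_mul_inv, div_le_iff₀ (Real.exp_pos _)]
  linarith

theorem rpow_neg_mul_exp_neg_inv_le {p s : ℝ} (hp : 0 < p) (hs : 0 < s) :
    s ^ (-p) * Real.exp (-(1 / (4 * s))) ≤ (4 * p) ^ p := by
  have h := rpow_mul_exp_neg_quarter_le hp (inv_pos.2 hs).le
  rw [Real.inv_rpow hs.le, ← Real.rpow_neg hs.le] at h
  have e : s⁻¹ / 4 = 1 / (4 * s) := by field_simp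
  rwa [e] at h

/-- Near its minimum the phase `k² s - k + 1 / (4 s)` is bounded below by a parabola; elsewhere
it is bounded below by `k / 4`. -/
theorem phase_lower_bound {k s : ℝ} (hk : 0 < k) (hs : 0 < s) :
    (1 / (4 * k) ≤ s ∧ k ^ 3 * (s - 1 / (2 * k)) ^ 2 ≤ k ^ 2 * s - k + 1 / (4 * s)) ∨
      k / 4 ≤ k ^ 2 * s - k + 1 / (4 * s) := by
  have e : k ^ 2 * s - k + 1 / (4 * s) = (k * s - 1 / 2) ^ 2 / s := by field_simp; ring
  have e2 : k ^ 3 * (s - 1 / (2 * k)) ^ 2 = k * (k * s - 1 / 2) ^ 2 := by field_simp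
  rw [e, e2]
  rcases le_total (1 / (4 * k)) s with h1 | h1
  · rcases le_total (k * s) 1 with h2 | h2
    · left
      refine ⟨h1, ?_⟩
      rw [le_div_iff₀ hs]
      nlinarith [sq_nonneg (k * s - 1 / 2)]
    · right
      rw [le_div_iff₀ hs]
      nlinarith
  · right
    rw [le_div_iff₀ (by positivity)] at h1
    rw [le_div_iff₀ hs]
    nlinarith

theorem rpow_neg_mul_exp_neg_phase_le {p k r s : ℝ} (hp : 0 < p) (hk : 0 < k) (hr : 1 ≤ r)
    (hs : 0 < s) :
    s ^ (-p) * Real.exp (-(r * (k ^ 2 * s - k + 1 / (4 * s)))) ≤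
      (4 * k) ^ p * Real.exp (-(r * k ^ 3) * (s - 1 / (2 * k)) ^ 2) +
        Real.exp (-((r - 1) * (k / 4))) * ((4 * p) ^ p * Real.exp k) *
          Real.exp (-k ^ 2 * s) := by
  rcases phase_lower_bound hk hs with ⟨h1, h2⟩ | h
  · refine le_add_of_le_of_nonneg ?_ (by positivity)
    have h3 : s ^ (-p) ≤ (4 * k) ^ p := by
      calc s ^ (-p) ≤ (1 / (4 * k)) ^ (-p) :=
            Real.rpow_le_rpow_of_nonpos (by positivity) h1 (by linarith)
        _ = (4 * k) ^ p := by
            rw [one_div, Real.inv_rpow (by positivity), Real.rpow_neg (by positivity), inv_inv]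
    refine mul_le_mul h3 (Real.exp_le_exp.2 ?_) (Real.exp_pos _).le (by positivity)
    nlinarith
  · refine le_add_of_nonneg_of_le (by positivity) ?_
    have h3 : Real.exp (-(r * (k ^ 2 * s - k + 1 / (4 * s)))) ≤
        Real.exp (-((r - 1) * (k / 4))) * (Real.exp k * Real.exp (-k ^ 2 * s) *
          Real.exp (-(1 / (4 * s)))) := by
      simp only [← Real.exp_add]
      refine Real.exp_le_exp.2 ?_
      nlinarith [mul_le_mul_of_nonneg_left h (sub_nonneg.2 hr)]
    calc _ ≤ s ^ (-p) * (Real.exp (-((r - 1) * (k / 4))) * (Real.exp k * Real.exp (-k ^ 2 * s) *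
          Real.exp (-(1 / (4 * s))))) := by gcongr
      _ = Real.exp (-((r - 1) * (k / 4))) * Real.exp k * Real.exp (-k ^ 2 * s) *
          (s ^ (-p) * Real.exp (-(1 / (4 * s)))) := by ring
      _ ≤ Real.exp (-((r - 1) * (k / 4))) * Real.exp k * Real.exp (-k ^ 2 * s) *
          (4 * p) ^ p := by gcongr; exact rpow_neg_mul_exp_neg_inv_le hp hs
      _ = _ := by ring

/-- Laplace-type bound for the integral with phase `k² s - k + 1 / (4 s)`. -/
theorem exists_integral_rpow_neg_mul_exp_neg_phase_le {p k : ℝ} (hp : 0 < p) (hk : 0 < k) :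
    ∃ C > (0 : ℝ), ∀ r : ℝ, 1 ≤ r →
      ∫ s in Ioi (0 : ℝ), s ^ (-p) * Real.exp (-(r * (k ^ 2 * s - k + 1 / (4 * s)))) ≤
        C * r ^ (-(1 / 2) : ℝ) := by
  set D : ℝ := ∫ s in Ioi (0 : ℝ), Real.exp (-k ^ 2 * s) with hD
  have hD0 : 0 ≤ D := integral_nonneg fun s => (Real.exp_pos _).le
  refine ⟨(4 * k) ^ p * √(Real.pi / k ^ 3) +
    (√2 / √k * Real.exp (k / 4)) * ((4 * p) ^ p * Real.exp k) * D, by positivity, ?_⟩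
  intro r hr
  have hr0 : 0 < r := by linarith
  have hb : 0 < r * k ^ 3 := by positivity
  have hg : Integrable fun s : ℝ => Real.exp (-(r * k ^ 3) * (s - 1 / (2 * k)) ^ 2) :=
    (integrable_exp_neg_mul_sq hb).comp_sub_right (1 / (2 * k))
  have hgi : ∫ s in Ioi (0 : ℝ), Real.exp (-(r * k ^ 3) * (s - 1 / (2 * k)) ^ 2) ≤
      √(Real.pi / (r * k ^ 3)) := by
    rw [← integral_gaussian, ← integral_sub_right_eq_self
      (fun s : ℝ => Real.exp (-(r * k ^ 3) * s ^ 2)) (1 / (2 * k))]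
    exact setIntegral_le_integral hg (Eventually.of_forall fun s => (Real.exp_pos _).le)
  have he : IntegrableOn (fun s : ℝ => Real.exp (-k ^ 2 * s)) (Ioi 0) :=
    integrableOn_exp_mul_Ioi (by nlinarith [sq_pos_of_pos hk]) 0
  have hroot : r ^ (-(1 / 2) : ℝ) = 1 / √r := by
    rw [Real.rpow_neg hr0.le, Real.sqrt_eq_rpow, one_div (r ^ _)]
  have hdecay : Real.exp (-((r - 1) * (k / 4))) ≤ √2 / √k * Real.exp (k / 4) * (1 / √r) := by
    have h := rpow_mul_exp_neg_quarter_le (p := 1 / 2) (u := k * r) (by norm_num) (by positivity)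
    rw [← Real.sqrt_eq_rpow, ← Real.sqrt_eq_rpow, Real.sqrt_mul hk.le,
      show (4 * (1 / 2) : ℝ) = 2 by norm_num] at h
    have h' : Real.exp (-(k * r / 4)) ≤ √2 / √k * (1 / √r) := by
      rw [div_mul_div_comm, mul_one, le_div_iff₀ (by positivity)]
      linarith
    calc Real.exp (-((r - 1) * (k / 4))) = Real.exp (-(k * r / 4)) * Real.exp (k / 4) := by
          rw [← Real.exp_add]; congr 1; ring
      _ ≤ √2 / √k * (1 / √r) * Real.exp (k / 4) := by gcongr
      _ = _ := by ring
  calc _ ≤ ∫ s in Ioi (0 : ℝ), ((4 * k) ^ p * Real.exp (-(r * k ^ 3) * (s - 1 / (2 * k)) ^ 2) +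
        Real.exp (-((r - 1) * (k / 4))) * ((4 * p) ^ p * Real.exp k) *
          Real.exp (-k ^ 2 * s)) := by
        refine integral_mono_of_nonneg ?_ ((hg.integrableOn.const_mul _).add (he.const_mul _)) ?_
        · filter_upwards [ae_restrict_mem measurableSet_Ioi] with s hs
          have hs' : (0 : ℝ) < s := hs
          simp only [Pi.zero_apply]
          positivity
        · filter_upwards [ae_restrict_mem measurableSet_Ioi] with s hs
          exact rpow_neg_mul_exp_neg_phase_le hp hk hr hs
    _ = (4 * k) ^ p * (∫ s in Ioi (0 : ℝ), Real.exp (-(r * k ^ 3) * (s - 1 / (2 * k)) ^ 2)) +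
        Real.exp (-((r - 1) * (k / 4))) * ((4 * p) ^ p * Real.exp k) * D := by
        rw [integral_add (hg.integrableOn.const_mul _) (he.const_mul _), integral_const_mul,
          integral_const_mul]
    _ ≤ (4 * k) ^ p * √(Real.pi / (r * k ^ 3)) +
        (√2 / √k * Real.exp (k / 4) * (1 / √r)) * ((4 * p) ^ p * Real.exp k) * D := by
        gcongr
    _ = _ := by
        rw [hroot, mul_comm r, ← div_div, Real.sqrt_div (by positivity) r]
        ring

/-- The subordination integral of the heat kernel of `-Δ + R` decays like
`e^{-√R r} r^{-((d+1)/2+σ)}`. -/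
theorem exists_integral_heat_kernel_le (d : ℕ) {R σ : ℝ} (hR : 0 < R) (hσ : 0 < σ) :
    ∃ C > (0 : ℝ), ∀ r : ℝ, 1 ≤ r →
      (∫ t in Ioi (0 : ℝ), Real.exp (-t * R) * (4 * Real.pi * t) ^ (-(d : ℝ) / 2) *
        Real.exp (-r ^ 2 / (4 * t)) * t ^ (-(1 + σ))) ≤
      C * (Real.exp (-(√R * r)) * r ^ (-(((d : ℝ) + 1) / 2 + σ))) := by
  have hk : 0 < √R := Real.sqrt_pos.2 hR
  have hkR : √R ^ 2 = R := Real.sq_sqrt hR.le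
  set k := √R
  have hp : 0 < (d : ℝ) / 2 + 1 + σ := by positivity
  obtain ⟨C, hC, h⟩ := exists_integral_rpow_neg_mul_exp_neg_phase_le hp hk
  set p := (d : ℝ) / 2 + 1 + σ with hpd
  refine ⟨(4 * Real.pi) ^ (-(d : ℝ) / 2) * C, by positivity, fun r hr => ?_⟩
  have hr0 : 0 < r := by linarith
  set F : ℝ → ℝ := fun t => Real.exp (-t * R) * (4 * Real.pi * t) ^ (-(d : ℝ) / 2) *
        Real.exp (-r ^ 2 / (4 * t)) * t ^ (-(1 + σ)) with hF
  have hsub : ∫ t in Ioi (0 : ℝ), F t = r * ∫ s in Ioi (0 : ℝ), F (r * s) := by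
    rw [integral_comp_mul_left_Ioi F 0 hr0, mul_zero, smul_eq_mul, mul_inv_cancel_left₀ hr0.ne']
  have hpt : ∀ s ∈ Ioi (0 : ℝ), F (r * s) =
      ((4 * Real.pi) ^ (-(d : ℝ) / 2) * Real.exp (-(k * r)) * r ^ (-p)) *
        (s ^ (-p) * Real.exp (-(r * (k ^ 2 * s - k + 1 / (4 * s))))) := by
    intro s hs
    have hs : 0 < s := hs
    have e1 : Real.exp (-(r * s) * R) * Real.exp (-r ^ 2 / (4 * (r * s))) =
        Real.exp (-(k * r)) * Real.exp (-(r * (k ^ 2 * s - k + 1 / (4 * s)))) := by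
      rw [← Real.exp_add, ← Real.exp_add, hkR]
      congr 1
      field_simp
      ring
    have e2 : (4 * Real.pi * (r * s)) ^ (-(d : ℝ) / 2) * (r * s) ^ (-(1 + σ)) =
        (4 * Real.pi) ^ (-(d : ℝ) / 2) * (r ^ (-p) * s ^ (-p)) := by
      rw [Real.mul_rpow (by positivity) (by positivity), mul_assoc,
        ← Real.rpow_add (by positivity), ← Real.mul_rpow hr0.le hs.le]
      congr 2
      rw [hpd]; ring
    calc F (r * s) = (Real.exp (-(r * s) * R) * Real.exp (-r ^ 2 / (4 * (r * s)))) *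
          ((4 * Real.pi * (r * s)) ^ (-(d : ℝ) / 2) * (r * s) ^ (-(1 + σ))) := by
          rw [hF]; ring
      _ = _ := by rw [e1, e2]; ring
  rw [hsub, setIntegral_congr_fun measurableSet_Ioi hpt, integral_const_mul]
  have hpow : r ^ (-(((d : ℝ) + 1) / 2 + σ)) = r * r ^ (-p) * r ^ (-(1 / 2) : ℝ) := by
    nth_rewrite 2 [← Real.rpow_one r]
    rw [← Real.rpow_add hr0, ← Real.rpow_add hr0]
    congr 1
    rw [hpd]; ring
  calc _ ≤ r * (((4 * Real.pi) ^ (-(d : ℝ) / 2) * Real.exp (-(k * r)) * r ^ (-p)) *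
        (C * r ^ (-(1 / 2) : ℝ))) := by
        gcongr
        exact h r hr
    _ = _ := by rw [hpow]; ring

/-- For `𝔏 = -Δ + R` with heat kernel
`h_t(x,y) = e^{-tR}(4πt)^{-d/2} e^{-|x-y|²/(4t)}`, the kernel
`K(x,y) = ∫₀^∞ h_t(x,y) t^{-(1+σ)} dt` satisfies
`K(x,y) ≤ c(x) e^{-√(R(1+|y|²))} / (1+|y|)^{(d+1)/2+σ}` for `|y| ≥ 2 max{|x|,1}`. -/
theorem laplacian_plus_R_kernel_weight_bound
    (d : ℕ) (hd : 1 ≤ d) (R : ℝ) (hR : 0 < R) (σ : ℝ) (hσ : 0 < σ) :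
    ∀ x : EuclideanSpace ℝ (Fin d), ∃ c > (0 : ℝ),
      ∀ y : EuclideanSpace ℝ (Fin d), 2 * max ‖x‖ 1 ≤ ‖y‖ →
        (∫ t in Set.Ioi (0 : ℝ),
            Real.exp (-t * R) * (4 * Real.pi * t) ^ (-(d : ℝ) / 2) *
              Real.exp (-‖x - y‖ ^ 2 / (4 * t)) * t ^ (-(1 + σ)))
          ≤ c * (Real.exp (-Real.sqrt (R * (1 + ‖y‖ ^ 2))) /
              (1 + ‖y‖) ^ (((d : ℝ) + 1) / 2 + σ)) := by
  intro x
  obtain ⟨C, hC, h⟩ := exists_integral_heat_kernel_le d hR hσ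
  have hq : 0 < ((d : ℝ) + 1) / 2 + σ := by positivity
  set q := ((d : ℝ) + 1) / 2 + σ
  refine ⟨C * (Real.exp (√R * (‖x‖ + 1)) * 4 ^ q), by positivity, fun y hy => ?_⟩
  have hx1 : 2 * ‖x‖ ≤ ‖y‖ := by linarith [le_max_left ‖x‖ 1]
  have hy2 : 2 ≤ ‖y‖ := by linarith [le_max_right ‖x‖ 1]
  have hr : ‖y‖ - ‖x‖ ≤ ‖x - y‖ := by
    rw [norm_sub_rev]; exact norm_sub_norm_le y x
  have hexp : Real.exp (-(√R * ‖x - y‖)) ≤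
      Real.exp (√R * (‖x‖ + 1)) * Real.exp (-√(R * (1 + ‖y‖ ^ 2))) := by
    rw [← Real.exp_add, Real.sqrt_mul hR.le]
    refine Real.exp_le_exp.2 ?_
    have h1 : √(1 + ‖y‖ ^ 2) ≤ 1 + ‖y‖ := by
      rw [Real.sqrt_le_left (by positivity)]
      nlinarith
    nlinarith [mul_le_mul_of_nonneg_left (show √(1 + ‖y‖ ^ 2) ≤ ‖x - y‖ + ‖x‖ + 1 by linarith)
      (Real.sqrt_nonneg R)]
  have hpow : ‖x - y‖ ^ (-q) ≤ 4 ^ q / (1 + ‖y‖) ^ q := by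
    calc ‖x - y‖ ^ (-q) ≤ ((1 + ‖y‖) / 4) ^ (-q) :=
          Real.rpow_le_rpow_of_nonpos (by positivity) (by linarith) (by linarith)
      _ = 4 ^ q / (1 + ‖y‖) ^ q := by
          rw [Real.rpow_neg (by positivity), Real.div_rpow (by positivity) (by norm_num), inv_div]
  calc _ ≤ C * (Real.exp (-(√R * ‖x - y‖)) * ‖x - y‖ ^ (-q)) := h _ (by linarith)
    _ ≤ C * ((Real.exp (√R * (‖x‖ + 1)) * Real.exp (-√(R * (1 + ‖y‖ ^ 2)))) *
        (4 ^ q / (1 + ‖y‖) ^ q)) := by gcongr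
    _ = _ := by ring
end

section
/- Let d ≥ 1, β ∈ (1,2], x₀ ∈ ℝ^d, and let f : ℝ^d → ℝ be locally integrable, differentiable at x₀, and satisfying |f(x₀+h) − f(x₀) − ∇f(x₀)·h| ≤ c |h|^β for all |h| ≤ δ, for some constants c, δ > 0. Then for every α ∈ (0, β), f is strictly α-smooth at x₀. -/
open MeasureTheory Set Filter
open RealInnerProductSpace

/-- On the ball of radius `δ / 2`, a quotient `u h / ‖h‖ ^ m` whose numerator is
`O(‖h‖ ^ p)` is integrable as soon as `m < d + p`. -/
lemma integrableOn_abs_div_norm_rpow {d : ℕ} (hd : 1 ≤ d) {u : EuclideanSpace ℝ (Fin d) → ℝ}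
    (hu : AEStronglyMeasurable u volume) {C δ p m : ℝ} (hC : 0 ≤ C) (hδ : 0 < δ)
    (hp : 0 < p) (hm : m < d + p)
    (hbound : ∀ h : EuclideanSpace ℝ (Fin d), ‖h‖ ≤ δ → |u h| ≤ C * ‖h‖ ^ p) :
    IntegrableOn (fun h => |u h| / ‖h‖ ^ m) {h | ‖h‖ ≤ δ / 2} := by
  have hball : IntegrableOn (fun h => |u h| / ‖h‖ ^ m) (Metric.ball 0 δ) := by
    refine integrableOn_ball_of_norm_le_rpow (μ := volume) (C := C) (α := m - p)
      (by simpa using hd) (by simpa using by linarith) ?_ ?_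
    · refine (ae_restrict_iff' measurableSet_ball).2 (.of_forall fun h hh => ?_)
      have hh' : ‖h‖ ≤ δ := (mem_ball_zero_iff.1 hh).le
      rcases eq_or_ne h 0 with rfl | h0
      · have hu0 : |u 0| ≤ 0 := by
          simpa [Real.zero_rpow hp.ne'] using hbound 0 (by simpa using hδ.le)
        rw [le_antisymm hu0 (abs_nonneg _)]
        simp only [zero_div, norm_zero]
        positivity
      · have hn : 0 < ‖h‖ := norm_pos_iff.2 h0
        rw [Real.norm_of_nonneg (by positivity), neg_sub, Real.rpow_sub hn, ← mul_div_assoc]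
        gcongr
        exact hbound h hh'
    · have hnorm : Measurable fun h : EuclideanSpace ℝ (Fin d) => ‖h‖ ^ m :=
        measurable_norm.pow_const m
      exact (hu.norm.aemeasurable.div hnorm.aemeasurable).aestronglyMeasurable
  exact hball.mono_set fun h (hh : ‖h‖ ≤ δ / 2) => mem_ball_zero_iff.2 (by linarith)

/-- If `f ∈ Lip_β(x₀)` with `β ∈ (1,2]`, i.e. `f` is differentiable at
`x₀` and `|f(x₀+h) - f(x₀) - ∇f(x₀)·h| ≤ c |h|^β` for `|h| ≤ δ`, then `f` is strictly
`α`-smooth at `x₀` for every `α ∈ (0,β)`. -/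
theorem strict_smoothness_of_lipschitz_high_order
    (d : ℕ) (hd : 1 ≤ d) (β : ℝ) (hβ : β ∈ Set.Ioc (1 : ℝ) 2)
    (x₀ : EuclideanSpace ℝ (Fin d))
    (f : EuclideanSpace ℝ (Fin d) → ℝ) (hf : MeasureTheory.LocallyIntegrable f)
    (hdiff : DifferentiableAt ℝ f x₀)
    (c δ : ℝ) (hc : 0 < c) (hδ : 0 < δ)
    (hlip : ∀ h : EuclideanSpace ℝ (Fin d), ‖h‖ ≤ δ →
      |f (x₀ + h) - f x₀ - fderiv ℝ f x₀ h| ≤ c * ‖h‖ ^ β) :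
    ∀ α ∈ Set.Ioo (0 : ℝ) β, DalphaStAt d α f x₀ := by
  rintro α ⟨-, hαβ⟩
  obtain ⟨hβ1, hβ2⟩ := hβ
  have hadd : AEStronglyMeasurable (fun h => f (x₀ + h)) volume :=
    hf.aestronglyMeasurable.comp_quasiMeasurePreserving
      (measurePreserving_add_left volume x₀).quasiMeasurePreserving
  have hsub : AEStronglyMeasurable (fun h => f (x₀ - h)) volume :=
    hf.aestronglyMeasurable.comp_quasiMeasurePreserving
      (Measure.measurePreserving_sub_left volume x₀).quasiMeasurePreserving
  have hlip_neg : ∀ h : EuclideanSpace ℝ (Fin d), ‖h‖ ≤ δ →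
      |f (x₀ - h) - f x₀ + fderiv ℝ f x₀ h| ≤ c * ‖h‖ ^ β := fun h hh => by
    simpa [← sub_eq_add_neg] using hlip (-h) (by simpa using hh)
  refine ⟨⟨δ / 2, by positivity, ?_⟩, δ / 2, by positivity, ?_⟩
  · refine integrableOn_abs_div_norm_rpow (C := 2 * c) (p := β) (m := d + α) hd
      ((hadd.add hsub).sub aestronglyMeasurable_const) (by positivity) hδ (by linarith)
      (by linarith) fun h hh => ?_
    have h₁ := abs_le.1 (hlip h hh)
    have h₂ := abs_le.1 (hlip_neg h hh)
    simp only [Pi.add_apply, Pi.sub_apply]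
    exact abs_le.2 ⟨by linarith, by linarith⟩
  · refine integrableOn_abs_div_norm_rpow
      (C := 2 * c * δ ^ (β - 1) + 2 * ‖fderiv ℝ f x₀‖) (p := 1) (m := max (d + α - 3) 0)
      hd (hadd.sub hsub) (by positivity) hδ one_pos (max_lt (by linarith) (by positivity))
      fun h hh => ?_
    have hpow : c * ‖h‖ ^ β ≤ c * (δ ^ (β - 1) * ‖h‖) := by
      have hsplit : ‖h‖ ^ β = ‖h‖ ^ (β - 1) * ‖h‖ := by
        rw [← Real.rpow_add_one' (norm_nonneg h) (by linarith), sub_add_cancel]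
      rw [hsplit]
      gcongr
    have h₁ := abs_le.1 (hlip h hh)
    have h₂ := abs_le.1 (hlip_neg h hh)
    have h₃ := abs_le.1 ((fderiv ℝ f x₀).le_opNorm h)
    simp only [Real.rpow_one, Pi.sub_apply]
    exact abs_le.2 ⟨by linarith, by linarith⟩
end

section
/- Let d ≥ 1 and γ ∈ [0,d), and define f : ℝ^d → ℝ by f(x) = sign(x·e₁) / |x|^γ for x ≠ 0 and f(0) = 0, where e₁ is the first standard basis vector. Then: (i) f is α-smooth at 0 for every α ∈ (0,2) (indeed f(h) + f(−h) − 2f(0) = 0 for a.e. h); and (ii) if α ∈ (0,2) satisfies α ≥ 3 − γ, then ∫_{|h|≤δ} |f(h) − f(−h)| / |h|^{d+α−3} dh = ∞ for every δ > 0, so f is not strictly α-smooth at 0. -/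
open MeasureTheory Set Filter
open RealInnerProductSpace

open scoped ENNReal

section PowerNorm

variable {E : Type*} [NormedAddCommGroup E] [NormedSpace ℝ E] [FiniteDimensional ℝ E]
  [Nontrivial E] [MeasurableSpace E] [BorelSpace E] (μ : Measure E) [μ.IsAddHaarMeasure]

/-- A power of the norm with exponent at most `-dim E` is not integrable near the origin. -/
theorem not_integrableOn_ball_norm_rpow_neg {s r : ℝ} (hs : (Module.finrank ℝ E : ℝ) ≤ s)
    (hr : 0 < r) : ¬ IntegrableOn (fun x : E => ‖x‖ ^ (-s)) (Metric.ball 0 r) μ := by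
  intro h
  have hr' : 0 < min r 1 := lt_min hr one_pos
  have h₁ := (integrableOn_fun_norm_addHaar μ (f := fun y : ℝ => y ^ (-s))).1
    (h.mono_set (Metric.ball_subset_ball (min_le_left r 1)))
  have hinv : IntegrableOn (fun y : ℝ => y⁻¹) (Ioo 0 (min r 1)) := by
    refine Integrable.mono' h₁ measurable_inv.aestronglyMeasurable ?_
    filter_upwards [ae_restrict_mem measurableSet_Ioo] with y hy
    have hy₁ : y ≤ 1 := hy.2.le.trans (min_le_right r 1)
    rw [Real.norm_of_nonneg (inv_nonneg.2 hy.1.le), smul_eq_mul, ← Real.rpow_natCast,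
      ← Real.rpow_add hy.1, ← Real.rpow_neg_one]
    refine Real.rpow_le_rpow_of_exponent_ge hy.1 hy₁ ?_
    rw [Nat.cast_sub Module.finrank_pos]
    push_cast
    linarith
  rw [← integrableOn_Ioc_iff_integrableOn_Ioo,
    ← intervalIntegrable_iff_integrableOn_Ioc_of_le hr'.le, intervalIntegrable_inv_iff] at hinv
  rcases hinv with h₀ | h₀
  · exact hr'.ne h₀
  · exact h₀ left_mem_uIcc

theorem lintegral_ball_norm_rpow_neg_eq_top {s r : ℝ} (hs : (Module.finrank ℝ E : ℝ) ≤ s)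
    (hr : 0 < r) : ∫⁻ x in Metric.ball (0 : E) r, ENNReal.ofReal (‖x‖ ^ (-s)) ∂μ = ⊤ := by
  by_contra h
  refine not_integrableOn_ball_norm_rpow_neg μ hs hr ⟨?_, ?_⟩
  · exact (measurable_norm.pow_const _).aestronglyMeasurable
  · rw [hasFiniteIntegral_iff_ofReal (ae_of_all _ fun x => Real.rpow_nonneg (norm_nonneg x) _)]
    exact lt_top_iff_ne_top.2 h

end PowerNorm

theorem EuclideanSpace.ae_apply_ne_zero {ι : Type*} [Fintype ι] (i : ι) :
    ∀ᵐ x : EuclideanSpace ℝ ι, x i ≠ 0 := by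
  classical
  have h := Measure.addHaar_submodule (volume : Measure (EuclideanSpace ℝ ι))
    (LinearMap.ker (EuclideanSpace.proj i : EuclideanSpace ℝ ι →L[ℝ] ℝ).toLinearMap) (by
      intro h
      have : EuclideanSpace.single i (1 : ℝ) ∈ (⊤ : Submodule ℝ (EuclideanSpace ℝ ι)) := trivial
      rw [← h] at this
      simp at this)
  rw [ae_iff]
  convert h using 2
  ext x
  simp

/-- Let `γ ∈ [0,d)` and `f(x) = sign(x·e₁)/|x|^γ` (with `f(0) = 0`).
Then (i) `f` is `α`-smooth at `0` for every `α ∈ (0,2)` — indeed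
`f(h) + f(-h) - 2f(0) = 0` for a.e. `h`; and (ii) if `α ∈ (0,2)` satisfies `α ≥ 3 - γ`,
then `∫_{|h|≤δ} |f(h) - f(-h)| / |h|^{d+α-3} dh = ∞` for every `δ > 0`, so `f` is not
strictly `α`-smooth at `0`. -/
theorem odd_homogeneous_example_smoothness
    (d : ℕ) (hd : 0 < d) (γ : ℝ) (hγ0 : 0 ≤ γ) (hγd : γ < d)
    (f : EuclideanSpace ℝ (Fin d) → ℝ)
    (hf : ∀ x : EuclideanSpace ℝ (Fin d), f x = Real.sign (x ⟨0, hd⟩) / ‖x‖ ^ γ) :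
    (∀ᵐ h : EuclideanSpace ℝ (Fin d), f h + f (-h) - 2 * f 0 = 0) ∧
    (∀ α ∈ Set.Ioo (0 : ℝ) 2, DalphaAt d α f 0) ∧
    (∀ α ∈ Set.Ioo (0 : ℝ) 2, 3 - γ ≤ α →
      (∀ δ > (0 : ℝ),
        ∫⁻ h in {h : EuclideanSpace ℝ (Fin d) | ‖h‖ ≤ δ},
          ENNReal.ofReal (|f h - f (-h)| / ‖h‖ ^ ((d : ℝ) + α - 3)) = ⊤) ∧
      ¬ DalphaStAt d α f 0) := by
  have hneg (x) : f (-x) = -f x := by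
    simp [hf, Real.sign_neg, neg_div]
  have hzero : f 0 = 0 := by simp [hf]
  have htop (α : ℝ) (hα : 3 - γ ≤ α) (δ : ℝ) (hδ : 0 < δ) :
      ∫⁻ h in {h : EuclideanSpace ℝ (Fin d) | ‖h‖ ≤ δ},
        ENNReal.ofReal (|f h - f (-h)| / ‖h‖ ^ ((d : ℝ) + α - 3)) = ⊤ := by
    have : Nonempty (Fin d) := ⟨⟨0, hd⟩⟩
    have hs : (Module.finrank ℝ (EuclideanSpace ℝ (Fin d)) : ℝ) ≤ γ + (d + α - 3) := by
      rw [finrank_euclideanSpace_fin]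
      linarith
    rw [eq_top_iff, ← lintegral_ball_norm_rpow_neg_eq_top volume hs hδ]
    refine (lintegral_mono_ae ?_).trans
      (lintegral_mono_set fun x hx => (mem_ball_zero_iff.1 hx).le)
    filter_upwards [ae_restrict_of_ae (EuclideanSpace.ae_apply_ne_zero (⟨0, hd⟩ : Fin d))] with x hx
    have hxn : 0 < ‖x‖ := norm_pos_iff.2 (by rintro rfl; simp at hx)
    have hsign : |Real.sign (x ⟨0, hd⟩)| = 1 := by
      rcases Real.sign_apply_eq_of_ne_zero _ hx with h | h <;> simp [h]
    have hfx : |f x| = ‖x‖ ^ (-γ) := by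
      rw [hf, abs_div, hsign, abs_of_nonneg (Real.rpow_nonneg hxn.le _), Real.rpow_neg hxn.le,
        one_div]
    refine ENNReal.ofReal_le_ofReal ?_
    rw [hneg, sub_neg_eq_add, ← two_mul, abs_mul, abs_two, hfx, neg_add, Real.rpow_add hxn,
      Real.rpow_neg hxn.le (_ - 3), ← div_eq_mul_inv]
    gcongr
    linarith [Real.rpow_nonneg hxn.le (-γ)]
  refine ⟨ae_of_all _ fun h => by simp [hneg, hzero], fun α _ => ⟨1, one_pos, ?_⟩,
    fun α _ hα => ⟨htop α hα, ?_⟩⟩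
  · simp [hneg, hzero]
  · rintro ⟨-, δ, hδ, hint⟩
    rw [max_eq_left (by linarith)] at hint
    simp only [zero_add, zero_sub] at hint
    have hfin := hint.2
    rw [hasFiniteIntegral_iff_ofReal (ae_of_all _ fun x => by positivity)] at hfin
    exact hfin.ne (htop α hα δ hδ)
end
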